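/- arXiv:2308.02791 — 4 statements merged into one kernel-verified Lean document; each statement's English description precedes it below -/
import Mathlib

section
/- Let I ⊂ R = K[x₁,…,xₙ] be a monomial ideal minimally generated by f₁,…,f_m with deg(f_k) = d_k, such that for each k = 2,…,m the colon ideal (f₁,…,f_{k-1}) : f_k is generated by a regular sequence of monomials α_{k,1},…,α_{k,r_k} with deg(α_{k,i}) = a_{k,i}. Then the Hilbert series of I is HS(I,t) = [t^{d₁} + ∑_{k=2}^{m} (1 - t^{a_{k,1}})⋯(1 - t^{a_{k,r_k}}) t^{d_k}] / (1-t)^n. -/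
open MvPolynomial

/-- `L` is generated by a regular sequence of `r` monomials whose degrees are given by `a`
(a sequence of monomials is regular iff the supports are pairwise disjoint and each is
nonconstant). -/
def IsRegSeqSpan {K : Type} [Field K] {σ : Type} (L : Ideal (MvPolynomial σ K))
    (r : ℕ) (a : Fin r → ℕ) : Prop :=
  ∃ α : Fin r → (σ →₀ ℕ),
    (∀ t, (α t).support.Nonempty) ∧
    (∀ s t, s ≠ t → Disjoint (α s).support (α t).support) ∧
    (∀ t, (monomial (α t) (1 : K)).totalDegree = a t) ∧
    L = Ideal.span (Set.range fun t => monomial (α t) (1 : K))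

/-- The Hilbert series of a graded submodule of `K[x₁,…,xₙ]`:
`HS(I,t) = ∑_d dim_K (I_d) t^d`, with integer coefficients. -/
noncomputable def hilbSeries {K : Type} [Field K] {n : ℕ}
    (I : Ideal (MvPolynomial (Fin n) K)) : PowerSeries ℤ :=
  PowerSeries.mk fun dd =>
    (Module.finrank K
      ↥(Submodule.restrictScalars K I ⊓ homogeneousSubmodule (Fin n) K dd) : ℤ)

/-- Exponents of degree `d`. -/
noncomputable def expDeg (n d : ℕ) : Finset (Fin n →₀ ℕ) :=
  Finset.finsuppAntidiag Finset.univ d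

lemma mem_expDeg {n d : ℕ} {e : Fin n →₀ ℕ} : e ∈ expDeg n d ↔ e.degree = d := by
  simp [expDeg, Finsupp.degree_eq_sum]

open Classical in
/-- Generating series of a set of exponents. -/
noncomputable def genS {n : ℕ} (p : (Fin n →₀ ℕ) → Prop) : PowerSeries ℤ :=
  PowerSeries.mk fun d => (((expDeg n d).filter p).card : ℤ)

lemma genS_split {n : ℕ} (p q s : (Fin n →₀ ℕ) → Prop) (h : ∀ e, p e ↔ q e ∨ s e)
    (h2 : ∀ e, q e → ¬ s e) : genS p = genS q + genS s := by
  classical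
  ext d
  simp only [genS, PowerSeries.coeff_mk, map_add]
  rw [← Nat.cast_add, ← Finset.card_union_of_disjoint, ← Finset.filter_or]
  · congr 2
    ext e
    simp [h]
  · rw [Finset.disjoint_filter]
    exact fun e _ he => h2 e he

lemma genS_false {n : ℕ} : genS (fun _ : Fin n →₀ ℕ => False) = 0 := by
  ext d
  simp [genS]

lemma genS_true (n : ℕ) :
    genS (fun _ : Fin n →₀ ℕ => True) * (1 - PowerSeries.X) ^ n = 1 := by
  have : genS (fun _ : Fin n →₀ ℕ => True) = (PowerSeries.mk 1 : PowerSeries ℤ) ^ n := by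
    have h : (PowerSeries.mk 1 : PowerSeries ℤ) ^ n
      = ∏ _i : Fin n, (PowerSeries.mk 1 : PowerSeries ℤ) := by simp
    rw [h]
    ext d
    rw [PowerSeries.coeff_prod]
    simp [genS, expDeg]
  rw [this, ← mul_pow, PowerSeries.mk_one_mul_one_sub_eq_one, one_pow]

lemma genS_shift {n : ℕ} (f : Fin n →₀ ℕ) (p q : (Fin n →₀ ℕ) → Prop)
    (h : ∀ e, p (f + e) ↔ q e) (h2 : ∀ e, p e → f ≤ e) :
    genS p = PowerSeries.X ^ f.degree * genS q := by
  classical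
  ext d
  rw [PowerSeries.coeff_X_pow_mul']
  simp only [genS, PowerSeries.coeff_mk]
  split_ifs with hd
  · congr 1
    symm
    apply Finset.card_bij (fun e _ => f + e)
    · intro e he
      simp only [Finset.mem_filter, mem_expDeg] at he ⊢
      refine ⟨?_, (h e).2 he.2⟩
      rw [map_add, he.1]; omega
    · intro a _ b _ hab
      exact add_left_cancel hab
    · intro b hb
      simp only [Finset.mem_filter, mem_expDeg] at hb
      obtain ⟨e, rfl⟩ := exists_add_of_le (h2 b hb.2)
      refine ⟨e, ?_, rfl⟩
      simp only [Finset.mem_filter, mem_expDeg]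
      refine ⟨?_, (h e).1 hb.2⟩
      rw [map_add] at hb
      omega
  · rw [Nat.cast_eq_zero, Finset.card_eq_zero, Finset.filter_eq_empty_iff]
    intro e he hp
    obtain ⟨e, rfl⟩ := exists_add_of_le (h2 e hp)
    rw [mem_expDeg, map_add] at he
    omega

lemma le_add_iff_of_disj {n : ℕ} {a b e : Fin n →₀ ℕ} (h : Disjoint a.support b.support) :
    a ≤ b + e ↔ a ≤ e := by
  refine ⟨fun hh => ?_, fun hh => hh.trans (by simp)⟩
  intro i
  by_cases hi : a i = 0
  · simp [hi]
  · have : b i = 0 := by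
      by_contra hb
      exact (Finset.disjoint_left.1 h) (Finsupp.mem_support_iff.2 hi) (Finsupp.mem_support_iff.2 hb)
    have := hh i
    simp_all

lemma genS_reg {n : ℕ} {ι : Type} [DecidableEq ι] (α : ι → (Fin n →₀ ℕ))
    (hα : ∀ s t, s ≠ t → Disjoint (α s).support (α t).support) (T : Finset ι) :
    genS (fun e => ∀ t ∈ T, ¬ α t ≤ e) * (1 - PowerSeries.X) ^ n
      = ∏ t ∈ T, (1 - PowerSeries.X ^ (α t).degree) := by
  induction T using Finset.induction_on with
  | empty => simpa using genS_true n
  | insert s T hs ih =>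
    rw [Finset.prod_insert hs, ← ih]
    have h1 := genS_split (fun e => ∀ t ∈ T, ¬ α t ≤ e)
      (fun e => ∀ t ∈ insert s T, ¬ α t ≤ e)
      (fun e => α s ≤ e ∧ ∀ t ∈ T, ¬ α t ≤ e)
      (by intro e; simp only [Finset.forall_mem_insert]; tauto)
      (by intro e; simp only [Finset.forall_mem_insert]; tauto)
    have h2 := genS_shift (α s) (fun e => α s ≤ e ∧ ∀ t ∈ T, ¬ α t ≤ e)
      (fun e => ∀ t ∈ T, ¬ α t ≤ e)
      (by
        intro e
        simp only [le_add_iff_nonneg_right, zero_le, true_and]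
        refine forall₂_congr fun t ht => ?_
        rw [le_add_iff_of_disj (hα t s (by rintro rfl; exact hs ht))])
      (fun e he => he.1)
    rw [h2] at h1
    linear_combination (1 - PowerSeries.X) ^ n * (-h1)

lemma hilb_eq {K : Type} [Field K] {n : ℕ} (S : Set (Fin n →₀ ℕ)) :
    hilbSeries (Ideal.span ((fun s => monomial s (1 : K)) '' S))
      = genS (fun e => ∃ s ∈ S, s ≤ e) := by
  classical
  ext d
  simp only [hilbSeries, genS, PowerSeries.coeff_mk]
  have : Submodule.restrictScalars K (Ideal.span ((fun s => monomial s (1 : K)) '' S))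
      ⊓ homogeneousSubmodule (Fin n) K d
      = restrictSupport K (((expDeg n d).filter (fun e => ∃ s ∈ S, s ≤ e) :
          Finset (Fin n →₀ ℕ)) : Set (Fin n →₀ ℕ)) := by
    ext x
    rw [Submodule.mem_inf, Submodule.restrictScalars_mem, mem_ideal_span_monomial_image,
      homogeneousSubmodule_eq_finsupp_supported, mem_restrictSupport_iff]
    change _ ∧ (x.support : Set (Fin n →₀ ℕ)) ⊆ {e | e.degree = d} ↔ _
    simp only [Set.subset_def, Finset.mem_coe, Finset.mem_filter, mem_expDeg, Set.mem_setOf_eq]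
    exact ⟨fun h e he => ⟨h.2 e he, h.1 e he⟩, fun h => ⟨fun e he => (h e he).2,
      fun e he => (h e he).1⟩⟩
  rw [this, Module.finrank_eq_card_basis (basisRestrictSupport K _)]
  simp

lemma mono_mem {K : Type} [Field K] {n : ℕ} (S : Set (Fin n →₀ ℕ)) (e : Fin n →₀ ℕ) :
    monomial e (1 : K) ∈ Ideal.span ((fun s => monomial s (1 : K)) '' S) ↔ ∃ s ∈ S, s ≤ e := by
  classical
  rw [mem_ideal_span_monomial_image]
  simp [support_monomial]

lemma genS_sum {n m : ℕ} (f : Fin m → (Fin n →₀ ℕ)) (j : ℕ) :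
    genS (fun e => ∃ l : Fin m, (l : ℕ) < j ∧ f l ≤ e)
      = ∑ k ∈ Finset.univ.filter (fun k : Fin m => (k : ℕ) < j),
        PowerSeries.X ^ (f k).degree *
          genS (fun e => ¬ ∃ l : Fin m, (l : ℕ) < (k : ℕ) ∧ f l ≤ f k + e) := by
  induction j with
  | zero => simpa using genS_false
  | succ j ih =>
    by_cases hj : j < m
    · have h1 := genS_split (fun e => ∃ l : Fin m, (l : ℕ) < j + 1 ∧ f l ≤ e)
        (fun e => ∃ l : Fin m, (l : ℕ) < j ∧ f l ≤ e)
        (fun e => f ⟨j, hj⟩ ≤ e ∧ ¬ ∃ l : Fin m, (l : ℕ) < j ∧ f l ≤ e)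
        (by
          intro e
          constructor
          · rintro ⟨l, hl, hle⟩
            by_cases hq : ∃ l : Fin m, (l : ℕ) < j ∧ f l ≤ e
            · exact Or.inl hq
            · refine Or.inr ⟨?_, hq⟩
              have : l = ⟨j, hj⟩ := by
                ext
                by_contra hne
                exact hq ⟨l, by simp at hne; omega, hle⟩
              rwa [← this]
          · rintro (⟨l, hl, hle⟩ | ⟨h, -⟩)
            · exact ⟨l, by omega, hle⟩
            · exact ⟨⟨j, hj⟩, by simp, h⟩)
        (fun e he h => h.2 he)
      have h2 := genS_shift (f ⟨j, hj⟩)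
        (fun e => f ⟨j, hj⟩ ≤ e ∧ ¬ ∃ l : Fin m, (l : ℕ) < j ∧ f l ≤ e)
        (fun e => ¬ ∃ l : Fin m, (l : ℕ) < j ∧ f l ≤ f ⟨j, hj⟩ + e)
        (by intro e; simp) (fun e he => he.1)
      have h3 : Finset.univ.filter (fun k : Fin m => (k : ℕ) < j + 1)
          = insert ⟨j, hj⟩ (Finset.univ.filter (fun k : Fin m => (k : ℕ) < j)) := by
        ext k
        simp [Fin.ext_iff]
        omega
      rw [h1, h2, h3, Finset.sum_insert (by simp), ih, add_comm]
    · have h3 : ∀ k : Fin m, (k : ℕ) < j + 1 ↔ (k : ℕ) < j := fun k => by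
        have := k.2
        omega
      simp only [h3]
      exact ih

/-- Hilbert series of a monomial ideal with regular quotients:
`HS(I,t)·(1-t)^n = t^{d₁} + ∑_{k=2}^{m} (1-t^{a_{k,1}})⋯(1-t^{a_{k,r_k}}) t^{d_k}`. -/
theorem stmt_8 {K : Type} [Field K] {n m : ℕ} (hm : 0 < m)
    (f : Fin m → (Fin n →₀ ℕ)) (d r : Fin m → ℕ) (a : (k : Fin m) → Fin (r k) → ℕ)
    (I : Ideal (MvPolynomial (Fin n) K))
    (hI : I = Ideal.span (Set.range fun k => monomial (f k) (1 : K)))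
    (hmin : ∀ k : Fin m, monomial (f k) (1 : K) ∉
      Ideal.span ((fun l => monomial (f l) (1 : K)) '' {l : Fin m | l ≠ k}))
    (hd : ∀ k, (monomial (f k) (1 : K)).totalDegree = d k)
    (hcolon : ∀ k : Fin m, 0 < (k : ℕ) →
      IsRegSeqSpan
        ((Ideal.span ((fun l => monomial (f l) (1 : K)) '' {l : Fin m | (l : ℕ) < (k : ℕ)})).colon
          (Ideal.span {monomial (f k) (1 : K)}))
        (r k) (a k)) :
    hilbSeries I * (1 - PowerSeries.X) ^ n
      = PowerSeries.X ^ (d ⟨0, hm⟩)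
        + ∑ k ∈ Finset.univ.filter (fun k : Fin m => 0 < (k : ℕ)),
            (∏ t : Fin (r k), (1 - PowerSeries.X ^ (a k t))) * PowerSeries.X ^ (d k) := by
  have hdeg : ∀ e : Fin n →₀ ℕ, (monomial e (1 : K)).totalDegree = e.degree := by
    intro e
    rw [totalDegree_monomial _ one_ne_zero]
    rfl
  have hr : ∀ S : Set (Fin m), (fun l => monomial (f l) (1 : K)) '' S
      = (fun s => monomial s (1 : K)) '' (f '' S) := fun S => by rw [Set.image_image]
  have hG : hilbSeries I = genS (fun e => ∃ l : Fin m, (l : ℕ) < m ∧ f l ≤ e) := by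
    rw [hI, ← Set.image_univ, hr, hilb_eq]
    simp
  rw [hG, genS_sum, Finset.sum_mul]
  have h0 : Finset.univ.filter (fun k : Fin m => (k : ℕ) < m)
      = insert ⟨0, hm⟩ (Finset.univ.filter (fun k : Fin m => 0 < (k : ℕ))) := by
    ext k
    simp [Fin.ext_iff]
    omega
  rw [h0, Finset.sum_insert (by simp)]
  congr 1
  · have := genS_true n
    simp only [Nat.not_lt_zero, false_and, exists_false, not_false_eq_true]
    rw [mul_assoc, this, ← hd, hdeg, mul_one]
  · refine Finset.sum_congr rfl fun k hk => ?_
    obtain ⟨α, -, hdis, hda, hL⟩ := hcolon k (Finset.mem_filter.1 hk).2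
    have hreg := genS_reg α hdis Finset.univ
    have hiff : ∀ e, (∃ l : Fin m, (l : ℕ) < (k : ℕ) ∧ f l ≤ f k + e) ↔ ∃ t, α t ≤ e := by
      intro e
      have h1 : monomial e (1 : K) ∈ (Ideal.span ((fun l => monomial (f l) (1 : K)) ''
          {l : Fin m | (l : ℕ) < (k : ℕ)})).colon (Ideal.span {monomial (f k) (1 : K)})
          ↔ ∃ l : Fin m, (l : ℕ) < (k : ℕ) ∧ f l ≤ f k + e := by
        rw [Ideal.mem_colon_span_singleton, monomial_mul, one_mul, hr, mono_mem, add_comm e]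
        simp
      have h2 : monomial e (1 : K) ∈ Ideal.span (Set.range fun t => monomial (α t) (1 : K))
          ↔ ∃ t, α t ≤ e := by
        have : (Set.range fun t => monomial (α t) (1 : K))
          = (fun s => monomial s (1 : K)) '' (Set.range α) := by
          rw [← Set.range_comp]; rfl
        rw [this, mono_mem]
        simp
      rw [← h1, hL, h2]
    simp only [hiff]
    simp only [Finset.mem_univ, true_imp_iff] at hreg
    simp only [not_exists]
    rw [mul_assoc, hreg, ← hd, hdeg, mul_comm]
    congr 1
    refine Finset.prod_congr rfl fun t _ => ?_
    rw [← hda, hdeg]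
end

section
/- Let I = (f₁,…,f_m) ⊂ R = K[x₁,…,xₙ] be a monomial ideal with deg(f_k) = d_k such that for k = 2,…,m the colon ideal (f₁,…,f_{k-1}) : f_k is generated by a regular sequence of r_k monomials all of degree a_k. Then for all i, j ≥ 0: β_{i,j}(I) ≤ ∑_{k ∈ K_j^i} C(r_k, i), where K_j^i = {1 ≤ k ≤ m : a_k·i + d_k = j} (with a₁ = r₁ = 0 and C(0, 0) = 1). -/
open MvPolynomial

/-- Data of a minimal graded free complex over `MvPolynomial σ K`:
free modules `F i = Fin (N i) → R` with generator degrees `g i`, differentials `d i`,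
exactness at every positive stage and homogeneous minimal (entries of positive degree)
differentials. -/
structure MinFreeResData (K : Type) [Field K] (σ : Type) where
  N : ℕ → ℕ
  g : (i : ℕ) → Fin (N i) → ℕ
  d : (i : ℕ) →
    ((Fin (N (i + 1)) → MvPolynomial σ K) →ₗ[MvPolynomial σ K] (Fin (N i) → MvPolynomial σ K))
  hexact : ∀ i, LinearMap.range (d (i + 1)) = LinearMap.ker (d i)
  hdeg : ∀ i k l, if g i l < g (i + 1) k
      then d i (Pi.single k 1) l ∈ homogeneousSubmodule σ K (g (i + 1) k - g i l)
      else d i (Pi.single k 1) l = 0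

/-- A minimal graded free resolution of an ideal `I` (as a graded module). -/
structure MinFreeResOfIdeal {K : Type} [Field K] {σ : Type} (I : Ideal (MvPolynomial σ K))
    extends MinFreeResData K σ where
  ε : (Fin (N 0) → MvPolynomial σ K) →ₗ[MvPolynomial σ K] MvPolynomial σ K
  hrange : LinearMap.range ε = I
  hker : LinearMap.ker ε = LinearMap.range (d 0)
  hεdeg : ∀ k, ε (Pi.single k 1) ∈ homogeneousSubmodule σ K (g 0 k)

/-- The graded Betti number `β_{i,j}` read off from a minimal free resolution. -/
def MinFreeResData.betti {K : Type} [Field K] {σ : Type}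
    (res : MinFreeResData K σ) (i j : ℕ) : ℕ :=
  (Finset.univ.filter fun k => res.g i k = j).card

/-- Projective dimension, `max{i : β_{i,j} ≠ 0 for some j}`, as an element of `ℕ∞`. -/
noncomputable def MinFreeResData.pdim {K : Type} [Field K] {σ : Type}
    (res : MinFreeResData K σ) : ℕ∞ :=
  sSup ((fun i : ℕ => (i : ℕ∞)) '' {i | ∃ j, res.betti i j ≠ 0})

/-- Castelnuovo–Mumford regularity, `max{j - i : β_{i,j} ≠ 0}`, as an element of `ℕ∞`. -/
noncomputable def MinFreeResData.reg {K : Type} [Field K] {σ : Type}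
    (res : MinFreeResData K σ) : ℕ∞ :=
  sSup ((fun p : ℕ × ℕ => ((p.2 - p.1 : ℕ) : ℕ∞)) '' {p | res.betti p.1 p.2 ≠ 0})

namespace Pf

variable {K : Type} [Field K] {σ : Type}

def H (K : Type) [Field K] (σ : Type) (s j : ℕ) : AddSubgroup (MvPolynomial σ K) where
  carrier := {p | ∀ e, coeff e p ≠ 0 → e.degree + s = j}
  zero_mem' := by intro e h; simp at h
  add_mem' := by
    intro p q hp hq e h
    by_cases h1 : coeff e p = 0
    · by_cases h2 : coeff e q = 0
      · simp [h1, h2] at h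
      · exact hq e h2
    · exact hp e h1
  neg_mem' := by
    intro p hp e h
    apply hp e
    simpa using h

lemma mem_H {s j : ℕ} {p : MvPolynomial σ K} :
    p ∈ H K σ s j ↔ ∀ e, coeff e p ≠ 0 → e.degree + s = j := Iff.rfl

lemma H_mul {s t j : ℕ} {p q : MvPolynomial σ K} (hp : p ∈ H K σ t j) (hq : q ∈ H K σ s t) :
    p * q ∈ H K σ s j := by
  classical
  intro e h
  rw [coeff_mul] at h
  obtain ⟨x, hx, hx2⟩ := Finset.exists_ne_zero_of_sum_ne_zero h
  rw [Finset.HasAntidiagonal.mem_antidiagonal] at hx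
  have h1 := hp x.1 (left_ne_zero_of_mul hx2)
  have h2 := hq x.2 (right_ne_zero_of_mul hx2)
  rw [← hx, map_add]
  omega

lemma one_mem_H (s : ℕ) : (1 : MvPolynomial σ K) ∈ H K σ s s := by
  classical
  intro e h
  rw [coeff_one] at h
  have : (0 : σ →₀ ℕ) = e := by
    by_contra h'
    simp [h'] at h
  subst this
  simp

/-- homogeneous component -/
noncomputable def cp (s j : ℕ) (p : MvPolynomial σ K) : MvPolynomial σ K :=
  ∑ e ∈ p.support.filter (fun e => e.degree + s = j), monomial e (coeff e p)

lemma coeff_cp (s j : ℕ) (p : MvPolynomial σ K) (e : σ →₀ ℕ) :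
    coeff e (cp s j p) = if e.degree + s = j then coeff e p else 0 := by
  classical
  rw [cp, coeff_sum]
  simp only [coeff_monomial]
  rw [Finset.sum_ite_eq']
  by_cases h : e.degree + s = j <;> simp [h]
  exact fun h => h.symm

lemma cp_mem (s j : ℕ) (p : MvPolynomial σ K) : cp s j p ∈ H K σ s j := by
  intro e h
  rw [coeff_cp] at h
  by_contra h'
  simp [h'] at h

lemma cp_eq {s j : ℕ} {p : MvPolynomial σ K} (h : p ∈ H K σ s j) : cp s j p = p := by
  ext e
  rw [coeff_cp]
  split_ifs with h1
  · rfl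
  · by_contra h2
    exact h1 (h e (Ne.symm h2))

lemma cp_add (s j : ℕ) (p q : MvPolynomial σ K) : cp s j (p + q) = cp s j p + cp s j q := by
  ext e
  simp only [coeff_cp, coeff_add]
  split_ifs <;> simp

lemma cp_sum {ι : Type} (s j : ℕ) (S : Finset ι) (p : ι → MvPolynomial σ K) :
    cp s j (∑ k ∈ S, p k) = ∑ k ∈ S, cp s j (p k) := by
  ext e
  simp only [coeff_cp, coeff_sum]
  split_ifs <;> simp

lemma cp_mul {s t j : ℕ} (p : MvPolynomial σ K) {q : MvPolynomial σ K} (hq : q ∈ H K σ s t) :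
    cp s j (p * q) = cp t j p * q := by
  classical
  ext e
  rw [coeff_cp, coeff_mul, coeff_mul]
  have : ∀ x ∈ Finset.HasAntidiagonal.antidiagonal e, coeff x.1 (cp t j p) * coeff x.2 q =
      if e.degree + s = j then coeff x.1 p * coeff x.2 q else 0 := by
    intro x hx
    rw [Finset.HasAntidiagonal.mem_antidiagonal] at hx
    rw [coeff_cp]
    by_cases h : coeff x.2 q = 0
    · simp [h]
    · have h2 := hq x.2 h
      have h3 : e.degree = x.1.degree + x.2.degree := by rw [← hx, map_add]
      have h4 : (e.degree + s = j) ↔ (x.1.degree + t = j) := by omega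
      simp only [h4]
      split_ifs <;> simp
  rw [Finset.sum_congr rfl this]
  split_ifs <;> simp

end Pf

namespace Pf

variable {K : Type} [Field K] {σ : Type}

structure GrMod (K : Type) [Field K] (σ : Type) where
  M : Type
  [ac : AddCommGroup M]
  [md : Module (MvPolynomial σ K) M]
  pc : ℕ → AddSubgroup M
  smul_mem : ∀ i j p x, p ∈ H K σ i j → x ∈ pc i → p • x ∈ pc j

attribute [instance] GrMod.ac GrMod.md

def Fr (K : Type) [Field K] (σ : Type) {ι : Type} (g : ι → ℕ) (j : ℕ) :
    AddSubgroup (ι → MvPolynomial σ K) where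
  carrier := {c | ∀ k, c k ∈ H K σ (g k) j}
  zero_mem' := fun k => (H K σ (g k) j).zero_mem
  add_mem' := fun hp hq k => (H K σ (g k) j).add_mem (hp k) (hq k)
  neg_mem' := fun hp k => (H K σ (g k) j).neg_mem (hp k)

lemma mem_Fr {ι : Type} {g : ι → ℕ} {j : ℕ} {c : ι → MvPolynomial σ K} :
    c ∈ Fr K σ g j ↔ ∀ k, c k ∈ H K σ (g k) j := Iff.rfl

lemma single_mem_Fr {ι : Type} [DecidableEq ι] (g : ι → ℕ) (k : ι) :
    (Pi.single k 1 : ι → MvPolynomial σ K) ∈ Fr K σ g (g k) := by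
  intro l
  by_cases h : l = k
  · subst h
    rw [Pi.single_eq_same]; exact one_mem_H _
  · simpa [h] using (H K σ (g l) (g k)).zero_mem

lemma lin_eq {ι : Type} [Fintype ι] [DecidableEq ι] {M : Type} [AddCommGroup M]
    [Module (MvPolynomial σ K) M] (ε : (ι → MvPolynomial σ K) →ₗ[MvPolynomial σ K] M)
    (c : ι → MvPolynomial σ K) : ε c = ∑ k, c k • ε (Pi.single k 1) := by
  conv_lhs => rw [pi_eq_sum_univ' c]
  rw [map_sum]
  refine Finset.sum_congr rfl fun k _ => ?_
  rw [map_smul]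

lemma graded_map {ι : Type} [Fintype ι] [DecidableEq ι] (M : GrMod K σ) {g : ι → ℕ}
    {ε : (ι → MvPolynomial σ K) →ₗ[MvPolynomial σ K] M.M}
    (hε : ∀ k, ε (Pi.single k 1) ∈ M.pc (g k)) {j : ℕ} {c : ι → MvPolynomial σ K}
    (hc : c ∈ Fr K σ g j) : ε c ∈ M.pc j := by
  rw [lin_eq]
  exact AddSubgroup.sum_mem _ fun k _ => M.smul_mem _ _ _ _ (hc k) (hε k)

/-- free graded module -/
noncomputable def FM (K : Type) [Field K] (σ : Type) {ι : Type} (g : ι → ℕ) : GrMod K σ where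
  M := ι → MvPolynomial σ K
  pc := Fr K σ g
  smul_mem := fun i j p x hp hx k => H_mul hp (hx k)

noncomputable def Ker {ι : Type} {M : Type} [AddCommGroup M] [Module (MvPolynomial σ K) M] (g : ι → ℕ)
    (ε : (ι → MvPolynomial σ K) →ₗ[MvPolynomial σ K] M) : GrMod K σ where
  M := ι → MvPolynomial σ K
  pc := fun j => Fr K σ g j ⊓ (LinearMap.ker ε).toAddSubgroup
  smul_mem := fun i j p x hp hx =>
    ⟨fun k => H_mul hp (hx.1 k), (LinearMap.ker ε).smul_mem p hx.2⟩

lemma mem_Ker {ι : Type} {M : Type} [AddCommGroup M] [Module (MvPolynomial σ K) M] {g : ι → ℕ}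
    {ε : (ι → MvPolynomial σ K) →ₗ[MvPolynomial σ K] M} {j : ℕ} {c : ι → MvPolynomial σ K} :
    c ∈ (Ker g ε).pc j ↔ c ∈ Fr K σ g j ∧ ε c = 0 := Iff.rfl

structure IsCover (M : GrMod K σ) {ι : Type} [Fintype ι] [DecidableEq ι] (g : ι → ℕ)
    (ε : (ι → MvPolynomial σ K) →ₗ[MvPolynomial σ K] M.M) : Prop where
  deg : ∀ k, ε (Pi.single k 1) ∈ M.pc (g k)
  surj : ∀ j, ∀ x ∈ M.pc j, ∃ c ∈ Fr K σ g j, ε c = x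

def P : ℕ → GrMod K σ → (ℕ → ℕ → ℕ) → Prop
  | 0, _, _ => True
  | n + 1, M, b => ∃ (ι : Type) (_ : Fintype ι) (_ : DecidableEq ι) (g : ι → ℕ)
      (ε : (ι → MvPolynomial σ K) →ₗ[MvPolynomial σ K] M.M),
      IsCover M g ε ∧ (∀ j, (Finset.univ.filter fun k => g k = j).card ≤ b 0 j) ∧
      P n (Ker g ε) (fun i => b (i + 1))

lemma P_mono (n : ℕ) : ∀ (M : GrMod K σ) (b c : ℕ → ℕ → ℕ) (_ : ∀ i j, b i j ≤ c i j),
    P n M b → P n M c := by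
  induction n with
  | zero => intros; trivial
  | succ n ih =>
    rintro M b c hbc ⟨ι, i1, i2, g, ε, h1, h2, h3⟩
    exact ⟨ι, i1, i2, g, ε, h1, fun j => (h2 j).trans (hbc 0 j),
      ih _ _ _ (fun i j => hbc (i + 1) j) h3⟩

lemma P_zero (n : ℕ) : ∀ (M : GrMod K σ) (b : ℕ → ℕ → ℕ) (_ : ∀ j, ∀ x ∈ M.pc j, x = 0),
    P n M b := by
  induction n with
  | zero => intros; trivial
  | succ n ih =>
    intro M b h
    refine ⟨Fin 0, inferInstance, inferInstance, fun _ => 0, 0, ⟨fun k => k.elim0, ?_⟩, ?_, ?_⟩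
    · intro j x hx
      exact ⟨0, (Fr K σ _ j).zero_mem, by simp [h j x hx]⟩
    · intro j; simp
    · apply ih
      intro j x hx
      funext k
      exact k.elim0

lemma horseshoe (n : ℕ) : ∀ (M' M M'' : GrMod K σ) (b' b'' : ℕ → ℕ → ℕ)
    (u : M'.M →ₗ[MvPolynomial σ K] M.M) (v : M.M →ₗ[MvPolynomial σ K] M''.M)
    (_ : ∀ j, ∀ x ∈ M'.pc j, u x ∈ M.pc j) (_ : ∀ j, ∀ x ∈ M.pc j, v x ∈ M''.pc j)
    (_ : ∀ j, ∀ x ∈ M'.pc j, u x = 0 → x = 0)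
    (_ : ∀ j, ∀ x ∈ M'.pc j, v (u x) = 0)
    (_ : ∀ j, ∀ x ∈ M.pc j, v x = 0 → ∃ y ∈ M'.pc j, u y = x)
    (_ : ∀ j, ∀ x ∈ M''.pc j, ∃ y ∈ M.pc j, v y = x),
    P n M' b' → P n M'' b'' → P n M (fun i j => b' i j + b'' i j) := by
  induction n with
  | zero => intros; trivial
  | succ n ih =>
    rintro M' M M'' b' b'' u v hu hv hinj hvu hex hsurj ⟨ι', _, _, g', ε', h1', h2', h3'⟩
      ⟨ι'', _, _, g'', ε'', h1'', h2'', h3''⟩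
    choose m hm hvm using fun k => hsurj _ _ (h1''.deg k)
    let pl : ((ι' ⊕ ι'') → MvPolynomial σ K) →ₗ[MvPolynomial σ K] (ι' → MvPolynomial σ K) :=
      LinearMap.funLeft _ _ Sum.inl
    let pr : ((ι' ⊕ ι'') → MvPolynomial σ K) →ₗ[MvPolynomial σ K] (ι'' → MvPolynomial σ K) :=
      LinearMap.funLeft _ _ Sum.inr
    let L : (ι'' → MvPolynomial σ K) →ₗ[MvPolynomial σ K] M.M :=
      Fintype.linearCombination (MvPolynomial σ K) m
    let ε : ((ι' ⊕ ι'') → MvPolynomial σ K) →ₗ[MvPolynomial σ K] M.M :=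
      u ∘ₗ ε' ∘ₗ pl + L ∘ₗ pr
    have hL1 : ∀ k, L (Pi.single k 1) = m k := by
      intro k
      simp [L]
    have hvL : ∀ c, v (L c) = ε'' c := by
      intro c
      rw [lin_eq L, lin_eq ε'', map_sum]
      refine Finset.sum_congr rfl fun k _ => ?_
      rw [map_smul, hL1, hvm]
    have hLdeg : ∀ j c, c ∈ Fr K σ g'' j → L c ∈ M.pc j := fun j c hc =>
      graded_map M (fun k => by rw [hL1]; exact hm k) hc
    have hεapp : ∀ c, ε c = u (ε' (fun k => c (Sum.inl k))) + L (fun k => c (Sum.inr k)) :=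
      fun c => rfl
    have hFr : ∀ j c, c ∈ Fr K σ (Sum.elim g' g'') j ↔
        (fun k => c (Sum.inl k)) ∈ Fr K σ g' j ∧ (fun k => c (Sum.inr k)) ∈ Fr K σ g'' j := by
      intro j c
      simp only [mem_Fr, Sum.forall, Sum.elim_inl, Sum.elim_inr]
    have hε'deg : ∀ j c, c ∈ Fr K σ g' j → ε' c ∈ M'.pc j := fun j c hc =>
      graded_map M' h1'.deg hc
    have hεdeg : ∀ j c, c ∈ Fr K σ (Sum.elim g' g'') j → ε c ∈ M.pc j := by
      intro j c hc
      rw [hFr] at hc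
      rw [hεapp]
      exact (M.pc j).add_mem (hu _ _ (hε'deg _ _ hc.1)) (hLdeg _ _ hc.2)
    have hvε : ∀ j c, c ∈ Fr K σ (Sum.elim g' g'') j →
        v (ε c) = ε'' (fun k => c (Sum.inr k)) := by
      intro j c hc
      rw [hFr] at hc
      rw [hεapp, map_add, hvL, hvu j _ (hε'deg _ _ hc.1), zero_add]
    -- core lifting
    have key : ∀ j x c'', x ∈ M.pc j → c'' ∈ Fr K σ g'' j → ε'' c'' = v x →
        ∃ c' ∈ Fr K σ g' j, ε (Sum.elim c' c'') = x := by
      intro j x c'' hx hc'' h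
      obtain ⟨y, hy, hyx⟩ := hex j (x - L c'') ((M.pc j).sub_mem hx (hLdeg _ _ hc''))
        (by rw [map_sub, hvL, h, sub_self])
      obtain ⟨c', hc', rfl⟩ := h1'.surj j y hy
      refine ⟨c', hc', ?_⟩
      rw [hεapp]
      simp only [Sum.elim_inl, Sum.elim_inr]
      rw [hyx, sub_add_cancel]
    refine ⟨ι' ⊕ ι'', inferInstance, inferInstance, Sum.elim g' g'', ε, ⟨?_, ?_⟩, ?_, ?_⟩
    · intro k
      exact hεdeg _ _ (single_mem_Fr _ k)
    · intro j x hx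
      obtain ⟨c'', hc'', h⟩ := h1''.surj j (v x) (hv _ _ hx)
      obtain ⟨c', hc', h'⟩ := key j x c'' hx hc'' h
      exact ⟨_, (hFr _ _).2 ⟨hc', hc''⟩, h'⟩
    · intro j
      have e1 := h2' j
      have e2 := h2'' j
      rw [Finset.card_filter] at e1 e2 ⊢
      rw [Fintype.sum_sum_type]
      exact add_le_add e1 e2
    · let U : (ι' → MvPolynomial σ K) →ₗ[MvPolynomial σ K] ((ι' ⊕ ι'') → MvPolynomial σ K) :=
        { toFun := fun c => Sum.elim c 0
          map_add' := by
            intro x y; funext k; cases k <;> simp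
          map_smul' := by
            intro x y; funext k; cases k <;> simp }
      have hU : ∀ c, U c = Sum.elim c 0 := fun c => rfl
      have hεU : ∀ c, ε (U c) = u (ε' c) := by
        intro c
        rw [hεapp, hU]
        simp only [Sum.elim_inl, Sum.elim_inr]
        change _ + L 0 = _
        rw [map_zero, add_zero]
      refine ih (Ker g' ε') (Ker (Sum.elim g' g'') ε) (Ker g'' ε'') _ _ U pr
        ?_ ?_ ?_ ?_ ?_ ?_ h3' h3''
      · rintro j x ⟨hx, hx2⟩
        refine ⟨(hFr _ _).2 ⟨hx, (Fr K σ g'' j).zero_mem⟩, ?_⟩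
        change ε (U x) = 0
        have hx3 : ε' x = 0 := hx2
        exact (hεU x).trans ((congrArg u hx3).trans (map_zero u))
      · rintro j x ⟨hx, hx2⟩
        refine ⟨((hFr _ _).1 hx).2, ?_⟩
        have hx3 : ε x = 0 := hx2
        have := hvε j x hx
        rw [hx3, map_zero] at this
        exact this.symm
      · intro j x hx h0
        funext k
        exact congrFun h0 (Sum.inl k)
      · intro j x hx
        rfl
      · rintro j x ⟨hx, hx2⟩ h0
        have hxe : x = U (fun k => x (Sum.inl k)) := by
          funext k
          cases k with
          | inl k => rfl
          | inr k => exact congrFun h0 k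
        have hx1 := ((hFr _ _).1 hx).1
        refine ⟨fun k => x (Sum.inl k), ⟨hx1, ?_⟩, hxe.symm⟩
        have hx3 : ε x = 0 := hx2
        rw [hxe, hεU] at hx3
        exact hinj j _ (hε'deg _ _ hx1) hx3
      · rintro j x ⟨hx, hx2⟩
        have hx3 : ε'' x = 0 := hx2
        obtain ⟨c', hc', h⟩ := key j 0 x (M.pc j).zero_mem hx (by rw [hx3, map_zero])
        exact ⟨Sum.elim c' x, ⟨(hFr _ _).2 ⟨hc', hx⟩, h⟩, rfl⟩

end Pf

namespace Pf

variable {K : Type} [Field K] {σ : Type}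

noncomputable def ZM (K : Type) [Field K] (σ : Type) : GrMod K σ where
  M := MvPolynomial σ K
  pc := fun _ => ⊥
  smul_mem := by
    intro i j p x _ hx
    rw [AddSubgroup.mem_bot] at hx ⊢
    rw [hx, smul_zero]

lemma P_iso (n : ℕ) (M' M : GrMod K σ) (b : ℕ → ℕ → ℕ)
    (u : M'.M →ₗ[MvPolynomial σ K] M.M)
    (hu : ∀ j, ∀ x ∈ M'.pc j, u x ∈ M.pc j)
    (hinj : ∀ j, ∀ x ∈ M'.pc j, u x = 0 → x = 0)
    (hsurj : ∀ j, ∀ x ∈ M.pc j, ∃ y ∈ M'.pc j, u y = x) (h : P n M' b) : P n M b := by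
  have := horseshoe n M' M (ZM K σ) b (fun _ _ => 0) u 0 hu (fun j x _ => AddSubgroup.zero_mem _)
    hinj (fun _ _ _ => rfl) (fun j x hx _ => hsurj j x hx) (fun j x hx => ⟨0, AddSubgroup.zero_mem _, by
      rw [LinearMap.zero_apply]
      exact (AddSubgroup.mem_bot.1 hx).symm⟩) h (P_zero n _ _ fun j x hx => AddSubgroup.mem_bot.1 hx)
  simpa using this

noncomputable def IdMod (I : Ideal (MvPolynomial σ K)) (s : ℕ) : GrMod K σ where
  M := MvPolynomial σ K
  pc := fun j => H K σ s j ⊓ Submodule.toAddSubgroup I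
  smul_mem := fun _ _ p _ hp hx => ⟨H_mul hp hx.1, I.mul_mem_left p hx.2⟩

noncomputable def CycMod (I : Ideal (MvPolynomial σ K)) (f : MvPolynomial σ K) (t : ℕ) :
    GrMod K σ where
  M := MvPolynomial σ K ⧸ I
  pc := fun j => AddSubgroup.map (I.mkQ.toAddMonoidHom.comp (AddMonoidHom.mulRight f)) (H K σ t j)
  smul_mem := by
    rintro i j p _ hp ⟨q, hq, rfl⟩
    refine ⟨p * q, H_mul hp hq, ?_⟩
    change I.mkQ ((p * q) * f) = p • I.mkQ (q * f)
    rw [← map_smul, smul_eq_mul, mul_assoc]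

def cone (t : ℕ) (c : ℕ → ℕ → ℕ) : ℕ → ℕ → ℕ
  | 0, j => if t = j then 1 else 0
  | i + 1, j => c i j

lemma P_cyc (n : ℕ) (I L : Ideal (MvPolynomial σ K)) (f : MvPolynomial σ K) (t : ℕ)
    (c : ℕ → ℕ → ℕ) (hL : ∀ p, p ∈ L ↔ p * f ∈ I) (h : P n (IdMod L t) c) :
    P (n + 1) (CycMod I f t) (cone t c) := by
  let ε : (Unit → MvPolynomial σ K) →ₗ[MvPolynomial σ K] (MvPolynomial σ K ⧸ I) :=
    I.mkQ ∘ₗ (LinearMap.mulRight (MvPolynomial σ K) f) ∘ₗ (LinearMap.proj ())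
  have hε : ∀ c, ε c = I.mkQ (c () * f) := fun c => rfl
  refine ⟨Unit, inferInstance, inferInstance, fun _ => t, ε, ⟨?_, ?_⟩, ?_, ?_⟩
  · intro k
    refine ⟨1, one_mem_H t, ?_⟩
    change I.mkQ (1 * f) = I.mkQ _
    congr 1
  · rintro j _ ⟨p, hp, rfl⟩
    exact ⟨fun _ => p, fun _ => hp, rfl⟩
  · intro j
    by_cases h : t = j <;> simp [cone, h]
  · refine P_iso n (IdMod L t) _ _ (LinearMap.pi fun _ => LinearMap.id :
      MvPolynomial σ K →ₗ[MvPolynomial σ K] (Unit → MvPolynomial σ K)) ?_ ?_ ?_ h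
    · rintro j (x : MvPolynomial σ K) ⟨hx, hx2⟩
      refine ⟨fun _ => hx, ?_⟩
      change I.mkQ (x * f) = 0
      rw [Submodule.mkQ_apply, Submodule.Quotient.mk_eq_zero]
      exact (hL x).1 hx2
    · intro j x hx h0
      exact congrFun h0 ()
    · rintro j x ⟨hx, hx2⟩
      refine ⟨x (), ⟨hx (), ?_⟩, rfl⟩
      have : I.mkQ (x () * f) = 0 := hx2
      rw [Submodule.mkQ_apply, Submodule.Quotient.mk_eq_zero] at this
      exact (hL _).2 this

lemma lemA (n s t : ℕ) (I L : Ideal (MvPolynomial σ K)) (hI : ∀ s j p, p ∈ I → cp s j p ∈ I)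
    (f : MvPolynomial σ K) (hf : f ∈ H K σ s t) (b c : ℕ → ℕ → ℕ)
    (hL : ∀ p, p ∈ L ↔ p * f ∈ I) (h1 : P (n + 1) (IdMod I s) b) (h2 : P n (IdMod L t) c) :
    P (n + 1) (IdMod (I ⊔ Ideal.span {f}) s) (fun i j => b i j + cone t c i j) := by
  refine horseshoe (n + 1) (IdMod I s) (IdMod (I ⊔ Ideal.span {f}) s) (CycMod I f t) b _
    LinearMap.id I.mkQ ?_ ?_ ?_ ?_ ?_ ?_ h1 (P_cyc n I L f t c hL h2)
  · rintro j x ⟨hx, hx2⟩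
    exact ⟨hx, (le_sup_left : I ≤ I ⊔ Ideal.span {f}) hx2⟩
  · rintro j (x : MvPolynomial σ K) ⟨hx, hx2⟩
    obtain ⟨y, hy, z, hz, rfl⟩ := Submodule.mem_sup.1 (show x ∈ I ⊔ Ideal.span {f} from hx2)
    obtain ⟨a, rfl⟩ := Ideal.mem_span_singleton'.1 hz
    refine ⟨cp t j a, cp_mem _ _ _, ?_⟩
    change I.mkQ (cp t j a * f) = I.mkQ (y + a * f)
    have e := cp_eq hx
    rw [cp_add, cp_mul a hf] at e
    rw [← e, map_add, Submodule.mkQ_apply I (cp s j y),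
      (Submodule.Quotient.mk_eq_zero I).2 (hI _ _ _ hy), zero_add]
  · intro j x _ h0
    exact h0
  · rintro j x ⟨hx, hx2⟩
    exact (Submodule.Quotient.mk_eq_zero I).2 hx2
  · rintro j x ⟨hx, hx2⟩ h0
    exact ⟨x, ⟨hx, (Submodule.Quotient.mk_eq_zero I).1 h0⟩, rfl⟩
  · rintro j _ ⟨p, hp, rfl⟩
    exact ⟨p * f, ⟨H_mul hp hf, (le_sup_right : Ideal.span {f} ≤ I ⊔ Ideal.span {f})
      (Ideal.mem_span_singleton'.2 ⟨p, rfl⟩)⟩, rfl⟩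

lemma mem_span_mon {ι : Type} (α : ι → σ →₀ ℕ) (T : Set ι) (p : MvPolynomial σ K) :
    p ∈ Ideal.span ((fun t => monomial (α t) (1 : K)) '' T) ↔
      ∀ e, coeff e p ≠ 0 → ∃ t ∈ T, α t ≤ e := by
  have : (fun t => monomial (α t) (1 : K)) '' T = (fun s => monomial s (1 : K)) '' (α '' T) := by
    rw [Set.image_image]
  rw [this, mem_ideal_span_monomial_image]
  simp [mem_support_iff]

lemma span_mon_cp {ι : Type} (α : ι → σ →₀ ℕ) (T : Set ι) (s j : ℕ) (p : MvPolynomial σ K)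
    (hp : p ∈ Ideal.span ((fun t => monomial (α t) (1 : K)) '' T)) :
    cp s j p ∈ Ideal.span ((fun t => monomial (α t) (1 : K)) '' T) := by
  rw [mem_span_mon] at hp ⊢
  intro e he
  apply hp
  intro h
  rw [coeff_cp, h] at he
  simp at he

lemma mon_mem_H (α : σ →₀ ℕ) (s : ℕ) :
    monomial α (1 : K) ∈ H K σ s (s + α.degree) := by
  classical
  intro e he
  rw [coeff_monomial] at he
  have : α = e := by
    by_contra h
    simp [h] at he
  subst this
  omega

lemma span_image_insert {ι : Type} (F : ι → MvPolynomial σ K) (T : Set ι) (t : ι) :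
    Ideal.span (F '' (insert t T)) = Ideal.span (F '' T) ⊔ Ideal.span {F t} := by
  rw [Set.image_insert_eq, Ideal.span_insert, sup_comm]

lemma P_bot (n s : ℕ) (b : ℕ → ℕ → ℕ) : P n (IdMod (⊥ : Ideal (MvPolynomial σ K)) s) b :=
  P_zero n _ _ fun _ _ hx => hx.2

lemma lemB {ι : Type} [DecidableEq ι] (α : ι → σ →₀ ℕ) (a : ℕ) (hα : ∀ t, (α t).degree = a)
    (hdis : ∀ s t, s ≠ t → Disjoint (α s).support (α t).support) (T : Finset ι) :
    ∀ n s, P n (IdMod (Ideal.span ((fun t => monomial (α t) (1 : K)) '' (T : Set ι))) s)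
      (fun i j => if a * (i + 1) + s = j then T.card.choose (i + 1) else 0) := by
  induction T using Finset.induction_on with
  | empty =>
    intro n s
    simp only [Finset.coe_empty, Set.image_empty, Ideal.span_empty]
    exact P_bot _ _ _
  | insert t T ht ih =>
    intro n s
    cases n with
    | zero => trivial
    | succ n =>
      rw [Finset.coe_insert, span_image_insert]
      have hf := mon_mem_H (K := K) (α t) s
      rw [hα t] at hf
      refine P_mono _ _ _ _ ?_ (lemA n s (s + a) _ _ (span_mon_cp α T) _ hf _ _ ?_ (ih _ s)
        (ih n (s + a)))
      · intro i j
        rw [Finset.card_insert_of_notMem ht]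
        cases i with
        | zero =>
          simp only [cone]
          have : (a * (0 + 1) + s = j) ↔ (s + a = j) := by omega
          simp only [this]
          split_ifs <;> simp
        | succ i =>
          simp only [cone]
          have : (a * (i + 1) + (s + a) = j) ↔ (a * (i + 1 + 1) + s = j) := by
            rw [mul_add a (i + 1) 1]; omega
          simp only [this]
          split_ifs
          · rw [Nat.choose_succ_succ T.card (i + 1), add_comm]
          · simp
      · intro p
        constructor
        · intro h
          exact Ideal.mul_mem_right _ _ h
        · intro h
          rw [mem_span_mon] at h ⊢
          intro e he
          obtain ⟨l, hl, hle⟩ := h (e + α t) (by rw [coeff_mul_monomial, mul_one]; exact he)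
          refine ⟨l, hl, fun x => ?_⟩
          by_cases hx : α l x = 0
          · rw [hx]; exact Nat.zero_le _
          · have hlt : l ≠ t := by
              rintro rfl
              exact ht hl
            have h1 := Finset.disjoint_left.1 (hdis l t hlt) (Finsupp.mem_support_iff.2 hx)
            have h2 : α t x = 0 := Finsupp.notMem_support_iff.1 h1
            have h3 := hle x
            rw [Finsupp.add_apply, h2, add_zero] at h3
            exact h3

lemma deg_eq (α : σ →₀ ℕ) : (monomial α (1 : K)).totalDegree = α.degree := by
  rw [totalDegree_monomial _ one_ne_zero]
  rfl

lemma mainP {m : ℕ} (f : Fin m → (σ →₀ ℕ)) (d a r : Fin m → ℕ)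
    (hd : ∀ k, (monomial (f k) (1 : K)).totalDegree = d k)
    (hcolon : ∀ k : Fin m,
      IsRegSeqSpan
        ((Ideal.span ((fun l => monomial (f l) (1 : K)) '' {l : Fin m | (l : ℕ) < (k : ℕ)})).colon
          (Ideal.span {monomial (f k) (1 : K)}))
        (r k) (fun _ => a k)) (n : ℕ) (k : ℕ) (hk : k ≤ m) :
    P (n + 1) (IdMod (Ideal.span ((fun l => monomial (f l) (1 : K)) '' {l : Fin m | (l : ℕ) < k})) 0)
      (fun i j => ∑ l ∈ Finset.univ.filter (fun l : Fin m => (l : ℕ) < k),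
        if a l * i + d l = j then (r l).choose i else 0) := by
  induction k with
  | zero =>
    simp only [not_lt_zero, Set.setOf_false, Set.image_empty, Ideal.span_empty]
    exact P_bot _ _ _
  | succ k ih =>
    have hset : {l : Fin m | (l : ℕ) < k + 1} = insert ⟨k, hk⟩ {l : Fin m | (l : ℕ) < k} := by
      ext l
      simp only [Set.mem_setOf_eq, Set.mem_insert_iff, Fin.ext_iff]
      omega
    have hfs : (Finset.univ.filter fun l : Fin m => (l : ℕ) < k + 1) =
        insert ⟨k, hk⟩ (Finset.univ.filter fun l : Fin m => (l : ℕ) < k) := by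
      ext l
      simp only [Finset.mem_filter, Finset.mem_univ, true_and, Finset.mem_insert, Fin.ext_iff]
      omega
    rw [hset, span_image_insert]
    obtain ⟨α, h1, h2, h3, h4⟩ := hcolon ⟨k, hk⟩
    have hf := mon_mem_H (K := K) (f ⟨k, hk⟩) 0
    rw [← deg_eq (K := K), hd] at hf
    have hB := lemB (K := K) α (a ⟨k, hk⟩) (fun t => by rw [← deg_eq (K := K), h3]) h2 Finset.univ n
      (0 + d ⟨k, hk⟩)
    rw [Finset.coe_univ, Set.image_univ, ← h4] at hB
    refine P_mono _ _ _ _ ?_ (lemA n 0 _ _ _ (span_mon_cp f _) _ hf _ _ ?_ (ih (by omega)) hB)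
    · intro i j
      rw [hfs, Finset.sum_insert (by simp), add_comm]
      gcongr
      cases i with
      | zero => simp [cone]
      | succ i => simp [cone]
    · intro p
      rw [Submodule.mem_colon]
      constructor
      · intro h
        exact h _ (Ideal.mem_span_singleton_self _)
      · intro h x hx
        obtain ⟨q, rfl⟩ := Ideal.mem_span_singleton'.1 hx
        rw [smul_eq_mul, mul_left_comm]
        exact Ideal.mul_mem_left _ _ h

end Pf

namespace Pf

variable {K : Type} [Field K] {σ : Type}

lemma retract_lift (Z W : GrMod K σ) {ι ι' : Type} [Fintype ι] [DecidableEq ι] [Fintype ι']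
    [DecidableEq ι'] (g : ι → ℕ) (g' : ι' → ℕ)
    (ε : (ι → MvPolynomial σ K) →ₗ[MvPolynomial σ K] Z.M)
    (ε' : (ι' → MvPolynomial σ K) →ₗ[MvPolynomial σ K] W.M)
    (hε : IsCover Z g ε) (hε' : IsCover W g' ε')
    (hmin : ∀ c, ε c = 0 → ∀ k, coeff 0 (c k) = 0)
    (u : Z.M →ₗ[MvPolynomial σ K] W.M) (v : W.M →ₗ[MvPolynomial σ K] Z.M)
    (hu : ∀ j, ∀ x ∈ Z.pc j, u x ∈ W.pc j) (hv : ∀ j, ∀ x ∈ W.pc j, v x ∈ Z.pc j)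
    (hvu : ∀ j, ∀ x ∈ Z.pc j, v (u x) = x) :
    ∃ (U : (ι → MvPolynomial σ K) →ₗ[MvPolynomial σ K] (ι' → MvPolynomial σ K))
      (V : (ι' → MvPolynomial σ K) →ₗ[MvPolynomial σ K] (ι → MvPolynomial σ K)),
      (∀ j c, c ∈ Fr K σ g j → U c ∈ Fr K σ g' j) ∧ (∀ j c, c ∈ Fr K σ g' j → V c ∈ Fr K σ g j) ∧
      (∀ c, V (U c) = c) ∧ (∀ c, ε' (U c) = u (ε c)) ∧ (∀ c, ε (V c) = v (ε' c)) := by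
  choose m hm hm2 using fun k => hε'.surj _ _ (hu _ _ (hε.deg k))
  choose w hw hw2 using fun k => hε.surj _ _ (hv _ _ (hε'.deg k))
  obtain ⟨U, hU⟩ : ∃ U : (ι → MvPolynomial σ K) →ₗ[MvPolynomial σ K] (ι' → MvPolynomial σ K),
      ∀ k, U (Pi.single k 1) = m k :=
    ⟨Fintype.linearCombination (MvPolynomial σ K) m, fun k => by simp⟩
  obtain ⟨V, hV⟩ : ∃ V : (ι' → MvPolynomial σ K) →ₗ[MvPolynomial σ K] (ι → MvPolynomial σ K),
      ∀ k, V (Pi.single k 1) = w k :=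
    ⟨Fintype.linearCombination (MvPolynomial σ K) w, fun k => by simp⟩
  have hUd : ∀ j c, c ∈ Fr K σ g j → U c ∈ Fr K σ g' j := fun j c hc =>
    graded_map (FM K σ g') (ε := U) (fun k => (hU k).symm ▸ hm k) hc
  have hVd : ∀ j c, c ∈ Fr K σ g' j → V c ∈ Fr K σ g j := fun j c hc =>
    graded_map (FM K σ g) (ε := V) (fun k => (hV k).symm ▸ hw k) hc
  have hεU : ∀ c, ε' (U c) = u (ε c) := by
    intro c
    have h1 := lin_eq (ε' ∘ₗ U) c
    have h2 := lin_eq (u ∘ₗ ε) c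
    simp only [LinearMap.comp_apply] at h1 h2
    rw [h1, h2]
    exact Finset.sum_congr rfl fun k _ => by rw [hU, hm2]
  have hεV : ∀ c, ε (V c) = v (ε' c) := by
    intro c
    have h1 := lin_eq (ε ∘ₗ V) c
    have h2 := lin_eq (v ∘ₗ ε') c
    simp only [LinearMap.comp_apply] at h1 h2
    rw [h1, h2]
    exact Finset.sum_congr rfl fun k _ => by rw [hV, hw2]
  let η : Module.End (MvPolynomial σ K) (ι → MvPolynomial σ K) := 1 - V ∘ₗ U
  have hη : ∀ c, η c = c - V (U c) := fun c => rfl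
  have hηd : ∀ j c, c ∈ Fr K σ g j → η c ∈ Fr K σ g j := by
    intro j c hc
    rw [hη]
    exact (Fr K σ g j).sub_mem hc (hVd _ _ (hUd _ _ hc))
  have hεη : ∀ c, ε (η c) = 0 := by
    intro c
    have h1 := lin_eq (ε ∘ₗ η) c
    simp only [LinearMap.comp_apply] at h1
    rw [h1]
    refine Finset.sum_eq_zero fun k _ => ?_
    rw [hη, map_sub, hεV, hεU, hvu _ _ (hε.deg k), sub_self, smul_zero]
  have hlow : ∀ k l, η (Pi.single k 1) l ≠ 0 → g l + 1 ≤ g k := by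
    intro k l h
    obtain ⟨e, he⟩ := ne_zero_iff.1 h
    have h1 := hηd _ _ (single_mem_Fr g k) l e he
    have h2 : e ≠ 0 := by
      rintro rfl
      exact he (hmin _ (hεη _) l)
    have h3 : e.degree ≠ 0 := by
      rwa [Ne, Finsupp.degree_eq_zero_iff]
    omega
  have hpow : ∀ t k l, (η ^ t) (Pi.single k 1) l ≠ 0 → g l + t ≤ g k := by
    intro t
    induction t with
    | zero =>
      intro k l h
      have : l = k := by
        by_contra h'
        simp [h'] at h
      subst this
      simp
    | succ t ih =>
      intro k l h
      rw [pow_succ, Module.End.mul_apply, lin_eq (η ^ t), Finset.sum_apply] at h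
      obtain ⟨q, _, hq⟩ := Finset.exists_ne_zero_of_sum_ne_zero h
      rw [Pi.smul_apply, smul_eq_mul] at hq
      have h1 := hlow k q (left_ne_zero_of_mul hq)
      have h2 := ih q l (right_ne_zero_of_mul hq)
      omega
  let T := (∑ k, g k) + 1
  have hT : η ^ T = 0 := by
    refine LinearMap.ext fun c => ?_
    rw [lin_eq (η ^ T) c]
    refine Finset.sum_eq_zero fun k _ => ?_
    have : (η ^ T) (Pi.single k 1) = 0 := by
      funext l
      by_contra h
      have h1 := hpow T k l h
      have h2 : g k ≤ ∑ k, g k := Finset.single_le_sum (fun _ _ => Nat.zero_le _) (Finset.mem_univ k)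
      simp only [T] at h1
      omega
    rw [this, smul_zero]
  let ψ : Module.End (MvPolynomial σ K) (ι → MvPolynomial σ K) :=
    ∑ i ∈ Finset.range T, η ^ i
  have hψ1 : ψ * (1 - η) = 1 := by
    rw [geom_sum_mul_neg, hT, sub_zero]
  have hψ2 : (1 - η) * ψ = 1 := by
    rw [mul_neg_geom_sum, hT, sub_zero]
  have hφ : ∀ c, (1 - η) c = V (U c) := by
    intro c
    rw [LinearMap.sub_apply, hη, Module.End.one_apply]
    abel
  have hpd : ∀ i j c, c ∈ Fr K σ g j → (η ^ i) c ∈ Fr K σ g j := by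
    intro i
    induction i with
    | zero => intro j c hc; simpa using hc
    | succ i ih =>
      intro j c hc
      rw [pow_succ', Module.End.mul_apply]
      exact hηd _ _ (ih _ _ hc)
  have hψd : ∀ j c, c ∈ Fr K σ g j → ψ c ∈ Fr K σ g j := by
    intro j c hc
    simp only [ψ, LinearMap.sum_apply]
    exact AddSubgroup.sum_mem _ fun i _ => hpd i j c hc
  refine ⟨U, ψ ∘ₗ V, hUd, fun j c hc => hψd _ _ (hVd _ _ hc), ?_, hεU, ?_⟩
  · intro c
    rw [LinearMap.comp_apply, ← hφ, ← Module.End.mul_apply, hψ1, Module.End.one_apply]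
  · intro c
    rw [LinearMap.comp_apply, ← hεV]
    have h1 : V c = (1 - η) (ψ (V c)) := by
      rw [← Module.End.mul_apply, hψ2, Module.End.one_apply]
    conv_rhs => rw [h1]
    rw [LinearMap.sub_apply, map_sub, hεη, sub_zero, Module.End.one_apply]

lemma card_retract {ι ι' : Type} [Fintype ι] [DecidableEq ι] [Fintype ι']
    [DecidableEq ι'] (g : ι → ℕ) (g' : ι' → ℕ)
    (U : (ι → MvPolynomial σ K) →ₗ[MvPolynomial σ K] (ι' → MvPolynomial σ K))
    (V : (ι' → MvPolynomial σ K) →ₗ[MvPolynomial σ K] (ι → MvPolynomial σ K))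
    (hU : ∀ j c, c ∈ Fr K σ g j → U c ∈ Fr K σ g' j)
    (hVU : ∀ c, V (U c) = c) (j : ℕ) :
    (Finset.univ.filter fun k => g k = j).card ≤ (Finset.univ.filter fun k => g' k = j).card := by
  let A : Matrix {l // g' l = j} {k // g k = j} K :=
    Matrix.of fun l k => constantCoeff (U (Pi.single k.1 1) l.1)
  let B : Matrix {k // g k = j} {l // g' l = j} K :=
    Matrix.of fun k l => constantCoeff (V (Pi.single l.1 1) k.1)
  have hBA : B * A = 1 := by
    ext k k'
    rw [Matrix.mul_apply]
    simp only [A, B, Matrix.of_apply]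
    have h1 : V (U (Pi.single k'.1 1)) k.1 = (Pi.single k'.1 1 : ι → MvPolynomial σ K) k.1 := by
      rw [hVU]
    rw [lin_eq V, Finset.sum_apply] at h1
    have h2 := congrArg constantCoeff h1
    rw [map_sum] at h2
    simp only [Pi.smul_apply, smul_eq_mul, map_mul] at h2
    have h3 : ∀ l, g' l ≠ j → constantCoeff (U (Pi.single k'.1 1) l) = 0 := by
      intro l hl
      by_contra h
      have := hU _ _ (single_mem_Fr g k'.1) l 0 h
      rw [map_zero, zero_add, k'.2] at this
      exact hl this
    rw [← Finset.sum_filter_of_ne (p := fun l => g' l = j)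
      (fun l _ hl => by
        by_contra h
        rw [h3 l h, zero_mul] at hl
        exact hl rfl)] at h2
    rw [Finset.sum_subtype (p := fun l => g' l = j) _ (by simp)] at h2
    rw [Finset.sum_congr rfl fun l _ => mul_comm _ _, h2, Matrix.one_apply]
    by_cases hk : k = k'
    · subst hk; simp
    · have : k.1 ≠ k'.1 := fun h => hk (Subtype.ext h)
      simp [hk, this]
  have h1 : (B * A).rank ≤ A.rank := Matrix.rank_mul_le_right B A
  rw [hBA, Matrix.rank_one] at h1
  have h2 := h1.trans (Matrix.rank_le_card_height A)
  rwa [Fintype.card_subtype, Fintype.card_subtype] at h2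

def shift (res : MinFreeResData K σ) : MinFreeResData K σ where
  N := fun i => res.N (i + 1)
  g := fun i => res.g (i + 1)
  d := fun i => res.d (i + 1)
  hexact := fun i => res.hexact (i + 1)
  hdeg := fun i => res.hdeg (i + 1)

lemma homog_mem_H {p : MvPolynomial σ K} {s t : ℕ} (h : s ≤ t)
    (hp : p ∈ homogeneousSubmodule σ K (t - s)) : p ∈ H K σ s t := by
  intro e he
  have := (mem_homogeneousSubmodule _ _).1 hp he
  have h2 : e.degree = t - s := by
    rw [← this, Finsupp.degree_eq_weight_one]; rfl
  omega

lemma d_deg (res : MinFreeResData K σ) (i : ℕ) (k) :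
    res.d i (Pi.single k 1) ∈ Fr K σ (res.g i) (res.g (i + 1) k) := by
  intro l
  have := res.hdeg i k l
  split_ifs at this with h
  · exact homog_mem_H h.le this
  · rw [this]
    exact AddSubgroup.zero_mem _

lemma d_min (res : MinFreeResData K σ) (i : ℕ) (c) (l) :
    coeff 0 (res.d i c l) = 0 := by
  rw [lin_eq, Finset.sum_apply, coeff_sum]
  refine Finset.sum_eq_zero fun k _ => ?_
  rw [Pi.smul_apply, smul_eq_mul]
  have h0 : constantCoeff (res.d i (Pi.single k 1) l) = 0 := by
    have := res.hdeg i k l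
    split_ifs at this with h
    · by_contra h'
      have := homog_mem_H h.le this 0 h'
      rw [map_zero] at this
      omega
    · rw [this, map_zero]
  change constantCoeff _ = 0
  rw [map_mul, h0, mul_zero]

/-- lifting along a graded map of free modules, componentwise -/
lemma cp_lin {ι : Type} [Fintype ι] [DecidableEq ι] (g : ι → ℕ) (s j : ℕ)
    (D : (ι → MvPolynomial σ K) →ₗ[MvPolynomial σ K] MvPolynomial σ K)
    (hD : ∀ k, D (Pi.single k 1) ∈ H K σ s (g k)) (c : ι → MvPolynomial σ K) :
    D (fun k => cp (g k) j (c k)) = cp s j (D c) := by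
  rw [lin_eq D, lin_eq D, cp_sum]
  refine Finset.sum_congr rfl fun k _ => ?_
  rw [smul_eq_mul, smul_eq_mul, cp_mul _ (hD k)]

lemma shift_cover (res : MinFreeResData K σ) {M : Type} [AddCommGroup M]
    [Module (MvPolynomial σ K) M] (ε : (Fin (res.N 0) → MvPolynomial σ K) →ₗ[MvPolynomial σ K] M)
    (hk : LinearMap.ker ε = LinearMap.range (res.d 0)) :
    IsCover (Ker (res.g 0) ε) (res.g 1) (res.d 0) := by
  refine ⟨fun k => ⟨d_deg res 0 k, ?_⟩, ?_⟩
  · change res.d 0 (Pi.single k 1) ∈ LinearMap.ker ε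
    rw [hk]
    exact ⟨_, rfl⟩
  · rintro j x ⟨hx, hx2⟩
    have hx3 : x ∈ LinearMap.ker ε := hx2
    rw [hk] at hx3
    obtain ⟨c, hc⟩ := hx3
    refine ⟨fun k => cp (res.g 1 k) j (c k), fun k => cp_mem _ _ _, ?_⟩
    funext l
    have := cp_lin (res.g 1) (res.g 0 l) j (LinearMap.proj l ∘ₗ res.d 0)
      (fun k => d_deg res 0 k l) c
    simp only [LinearMap.comp_apply, LinearMap.proj_apply] at this
    refine this.trans ?_
    rw [hc]
    exact cp_eq (hx l)

theorem compare (n : ℕ) : ∀ (res : MinFreeResData K σ) (Z W : GrMod K σ)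
    (ε : (Fin (res.N 0) → MvPolynomial σ K) →ₗ[MvPolynomial σ K] Z.M)
    (_ : IsCover Z (res.g 0) ε) (_ : LinearMap.ker ε = LinearMap.range (res.d 0))
    (u : Z.M →ₗ[MvPolynomial σ K] W.M) (v : W.M →ₗ[MvPolynomial σ K] Z.M)
    (_ : ∀ j, ∀ x ∈ Z.pc j, u x ∈ W.pc j) (_ : ∀ j, ∀ x ∈ W.pc j, v x ∈ Z.pc j)
    (_ : ∀ j, ∀ x ∈ Z.pc j, v (u x) = x) (b : ℕ → ℕ → ℕ) (_ : P (n + 1) W b) (j : ℕ),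
    (Finset.univ.filter fun k => res.g n k = j).card ≤ b n j := by
  induction n with
  | zero =>
    rintro res Z W ε h1 h2 u v hu hv hvu b ⟨ι', _, _, g', ε', h1', h2', h3'⟩ j
    obtain ⟨U, V, hU, hV, hVU, -, -⟩ := retract_lift Z W (res.g 0) g' ε ε' h1 h1' (by
      intro c hc k
      have : c ∈ LinearMap.ker ε := hc
      rw [h2] at this
      obtain ⟨y, rfl⟩ := this
      exact d_min res 0 y k) u v hu hv hvu
    exact (card_retract _ _ U V hU hVU j).trans (h2' j)
  | succ n ih =>
    rintro res Z W ε h1 h2 u v hu hv hvu b ⟨ι', _, _, g', ε', h1', h2', h3'⟩ j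
    obtain ⟨U, V, hU, hV, hVU, hεU, hεV⟩ := retract_lift Z W (res.g 0) g' ε ε' h1 h1' (by
      intro c hc k
      have : c ∈ LinearMap.ker ε := hc
      rw [h2] at this
      obtain ⟨y, rfl⟩ := this
      exact d_min res 0 y k) u v hu hv hvu
    refine ih (shift res) (Ker (res.g 0) ε) (Ker g' ε') (res.d 0) (shift_cover res ε h2)
      (res.hexact 0).symm U V ?_ ?_ (fun _ x _ => hVU x) (fun i => b (i + 1)) h3' j
    · rintro j x ⟨hx, hx2⟩
      have hx3 : ε x = 0 := hx2
      exact ⟨hU _ _ hx, (hεU x).trans ((congrArg u hx3).trans (map_zero u))⟩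
    · rintro j x ⟨hx, hx2⟩
      have hx3 : ε' x = 0 := hx2
      exact ⟨hV _ _ hx, (hεV x).trans ((congrArg v hx3).trans (map_zero v))⟩

theorem final {I : Ideal (MvPolynomial σ K)} (res : MinFreeResOfIdeal I) (i j : ℕ)
    (b : ℕ → ℕ → ℕ) (h : P (i + 1) (IdMod I 0) b) : res.toMinFreeResData.betti i j ≤ b i j := by
  have hd : ∀ k, res.ε (Pi.single k 1) ∈ H K σ 0 (res.g 0 k) := fun k =>
    homog_mem_H (Nat.zero_le _) (res.hεdeg k)
  have hr : ∀ c, res.ε c ∈ I := fun c => by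
    have : res.ε c ∈ LinearMap.range res.ε := ⟨c, rfl⟩
    rwa [res.hrange] at this
  refine compare i res.toMinFreeResData (IdMod I 0) (IdMod I 0) res.ε ⟨?_, ?_⟩ res.hker
    LinearMap.id LinearMap.id (fun _ _ h => h) (fun _ _ h => h) (fun _ _ _ => rfl) b h j
  · intro k
    exact ⟨hd k, hr _⟩
  · rintro j x ⟨hx, hx2⟩
    have hx3 : x ∈ I := hx2
    rw [← res.hrange] at hx3
    obtain ⟨c, hc⟩ := hx3
    refine ⟨fun k => cp (res.g 0 k) j (c k), fun k => cp_mem _ _ _, ?_⟩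
    refine (cp_lin (res.g 0) 0 j res.ε hd c).trans ?_
    rw [hc]
    exact cp_eq hx

end Pf

/-- If `I = (f₁,…,f_m)` is a monomial ideal with `deg f_k = d_k` whose successive colon
ideals `(f₁,…,f_{k-1}) : f_k` are generated by regular sequences of `r_k` monomials all of
degree `a_k` (with the convention `a₁ = r₁ = 0`), then for all `i, j`:
`β_{i,j}(I) ≤ ∑_{k : a_k·i + d_k = j} C(r_k, i)`. -/
theorem stmt_10 {K : Type} [Field K] {n m : ℕ} (hm : 0 < m)
    (f : Fin m → (Fin n →₀ ℕ)) (d a r : Fin m → ℕ)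
    (I : Ideal (MvPolynomial (Fin n) K))
    (hI : I = Ideal.span (Set.range fun k => monomial (f k) (1 : K)))
    (hd : ∀ k, (monomial (f k) (1 : K)).totalDegree = d k)
    (ha0 : a ⟨0, hm⟩ = 0) (hr0 : r ⟨0, hm⟩ = 0)
    (hcolon : ∀ k : Fin m, 0 < (k : ℕ) →
      IsRegSeqSpan
        ((Ideal.span ((fun l => monomial (f l) (1 : K)) '' {l : Fin m | (l : ℕ) < (k : ℕ)})).colon
          (Ideal.span {monomial (f k) (1 : K)}))
        (r k) (fun _ => a k))
    (res : MinFreeResOfIdeal I) (i j : ℕ) :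
    res.toMinFreeResData.betti i j ≤
      ∑ k ∈ Finset.univ.filter (fun k : Fin m => a k * i + d k = j), Nat.choose (r k) i := by
  have hP := Pf.mainP f d a r hd (fun k => by
    by_cases hk : 0 < (k : ℕ)
    · exact hcolon k hk
    · have hk0 : k = ⟨0, hm⟩ := Fin.ext (by simpa using hk)
      subst hk0
      rw [hr0]
      refine ⟨fun t => t.elim0, fun t => t.elim0, fun t => t.elim0, fun t => t.elim0, ?_⟩
      have e1 : {l : Fin m | (l : ℕ) < ((⟨0, hm⟩ : Fin m) : ℕ)} = ∅ := by
        ext l; simp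
      rw [e1, Set.image_empty, Ideal.span_empty, Set.range_eq_empty, Ideal.span_empty, eq_bot_iff]
      intro p hp
      rw [Submodule.mem_colon] at hp
      have h1 := hp _ (Ideal.mem_span_singleton_self _)
      rw [Ideal.mem_bot, smul_eq_mul] at h1
      rw [Ideal.mem_bot]
      rcases mul_eq_zero.1 h1 with h2 | h2
      · exact h2
      · simp at h2) i m le_rfl
  have e2 : (fun l => monomial (f l) (1 : K)) '' {l : Fin m | (l : ℕ) < m} =
      Set.range fun k => monomial (f k) (1 : K) := by
    have : {l : Fin m | (l : ℕ) < m} = Set.univ := by ext l; simp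
    rw [this, Set.image_univ]
  rw [e2, ← hI] at hP
  refine (Pf.final res i j _ hP).trans (le_of_eq ?_)
  rw [Finset.sum_filter (fun k : Fin m => a k * i + d k = j)]
  refine Finset.sum_congr ?_ fun _ _ => rfl
  ext l
  simp
end

section
/- Let I = (f₁,…,f_m) ⊂ R be a monomial ideal with deg(f_k) = d_k such that each colon ideal (f₁,…,f_{k-1}) : f_k (k = 2,…,m) is generated by a single monomial of degree a_k (i.e., r₂ = ⋯ = r_m = 1). Then β_{0,j}(I) = |{1 ≤ k ≤ m : d_k = j}|, β_{1,j}(I) = |{2 ≤ k ≤ m : a_k + d_k = j}|, and β_{i,j}(I) = 0 for all i ≥ 2. -/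
open MvPolynomial

namespace Stmt11

variable {K : Type} [Field K] {σ : Type}

/-- `v` is homogeneous of degree `e` for the shifts `s`. -/
def Hom {ι : Type} (e : ℕ) (s : ι → ℕ) (v : ι → MvPolynomial σ K) : Prop :=
  ∀ t μ, coeff μ (v t) ≠ 0 → Finsupp.degree μ + s t = e

/-- homogeneous part -/
noncomputable def part (e s : ℕ) (p : MvPolynomial σ K) : MvPolynomial σ K :=
  if s ≤ e then homogeneousComponent (e - s) p else 0

theorem coeff_part (e s : ℕ) (p : MvPolynomial σ K) (μ : σ →₀ ℕ) :
    coeff μ (part e s p) = if Finsupp.degree μ + s = e then coeff μ p else 0 := by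
  classical
  unfold part
  split_ifs with h1 h2 h2
  · rw [coeff_homogeneousComponent, if_pos (by omega)]
  · rw [coeff_homogeneousComponent, if_neg (by omega)]
  · omega
  · simp

theorem apply_eq {ι κ : Type} [Fintype ι] [DecidableEq ι]
    (f : (ι → MvPolynomial σ K) →ₗ[MvPolynomial σ K] (κ → MvPolynomial σ K))
    (x : ι → MvPolynomial σ K) (t : κ) : f x t = ∑ i, x i * f (Pi.single i 1) t := by
  conv_lhs => rw [LinearMap.pi_apply_eq_sum_univ f x]
  rw [Finset.sum_apply]
  refine Finset.sum_congr rfl fun i _ => ?_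
  rw [Pi.smul_apply, smul_eq_mul]
  have : (fun j => if i = j then (1 : MvPolynomial σ K) else 0) = Pi.single i 1 := by
    funext j
    simp [Pi.single_apply, eq_comm]
  rw [this]

theorem cc_zero {ι κ : Type} [Fintype ι] [DecidableEq ι]
    (f : (ι → MvPolynomial σ K) →ₗ[MvPolynomial σ K] (κ → MvPolynomial σ K))
    (x : ι → MvPolynomial σ K) (hx : ∀ i, constantCoeff (x i) = 0) (t : κ) :
    constantCoeff (f x t) = 0 := by
  rw [apply_eq, map_sum]
  exact Finset.sum_eq_zero fun i _ => by rw [map_mul, hx, zero_mul]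

theorem cc_zero' {ι κ : Type} [Fintype ι] [DecidableEq ι]
    (f : (ι → MvPolynomial σ K) →ₗ[MvPolynomial σ K] (κ → MvPolynomial σ K))
    (hf : ∀ i t, constantCoeff (f (Pi.single i 1) t) = 0)
    (x : ι → MvPolynomial σ K) (t : κ) :
    constantCoeff (f x t) = 0 := by
  rw [apply_eq, map_sum]
  exact Finset.sum_eq_zero fun i _ => by rw [map_mul, hf, mul_zero]

theorem part_map {ι κ : Type} [Fintype ι] [DecidableEq ι]
    (f : (ι → MvPolynomial σ K) →ₗ[MvPolynomial σ K] (κ → MvPolynomial σ K))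
    (d : ι → ℕ) (s : κ → ℕ) (hf : ∀ i, Hom (d i) s (f (Pi.single i 1)))
    (e : ℕ) (v : ι → MvPolynomial σ K) (hv : Hom e s (f v)) :
    f (fun i => part e (d i) (v i)) = f v := by
  classical
  funext t
  ext μ
  have key : coeff μ (f (fun i => part e (d i) (v i)) t) =
      if Finsupp.degree μ + s t = e then coeff μ (f v t) else 0 := by
    rw [apply_eq, apply_eq f v, coeff_sum, coeff_sum, ← mul_boole, Finset.sum_mul]
    refine Finset.sum_congr rfl fun i _ => ?_
    rw [coeff_mul, coeff_mul, Finset.sum_mul]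
    refine Finset.sum_congr rfl fun p hp => ?_
    rw [Finset.HasAntidiagonal.mem_antidiagonal] at hp
    rw [coeff_part]
    by_cases hz : coeff p.2 (f (Pi.single i 1) t) = 0
    · simp [hz]
    · have := hf i t _ hz
      have h2 : Finsupp.degree μ = Finsupp.degree p.1 + Finsupp.degree p.2 := by
        rw [← hp, map_add]
      split_ifs <;> first | rfl | omega | simp
  rw [key]
  split_ifs with h
  · rfl
  · by_contra hne
    exact h (hv t μ (Ne.symm hne))

theorem hom_map {ι κ : Type} [Fintype ι] [DecidableEq ι]
    (f : (ι → MvPolynomial σ K) →ₗ[MvPolynomial σ K] (κ → MvPolynomial σ K))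
    (d : ι → ℕ) (s : κ → ℕ) (hf : ∀ i, Hom (d i) s (f (Pi.single i 1)))
    (e : ℕ) (v : ι → MvPolynomial σ K) (hv : Hom e d v) : Hom e s (f v) := by
  classical
  intro t μ hμ
  rw [apply_eq, coeff_sum] at hμ
  obtain ⟨i, _, hi⟩ := Finset.exists_ne_zero_of_sum_ne_zero hμ
  rw [coeff_mul] at hi
  obtain ⟨p, hp, hne⟩ := Finset.exists_ne_zero_of_sum_ne_zero hi
  rw [Finset.HasAntidiagonal.mem_antidiagonal] at hp
  have h1 := hv i _ (left_ne_zero_of_mul hne)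
  have h2 := hf i t _ (right_ne_zero_of_mul hne)
  rw [← hp, map_add]
  omega

/-- lifting -/
theorem lift {ι κ τ : Type} [Fintype ι] [DecidableEq ι]
    (φ : (ι → MvPolynomial σ K) →ₗ[MvPolynomial σ K] (τ → MvPolynomial σ K))
    (ψ : (κ → MvPolynomial σ K) →ₗ[MvPolynomial σ K] (τ → MvPolynomial σ K))
    (h : ∀ x, ∃ y, ψ y = φ x) :
    ∃ u : (ι → MvPolynomial σ K) →ₗ[MvPolynomial σ K] (κ → MvPolynomial σ K),
      ∀ x, ψ (u x) = φ x := by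
  choose y hy using fun i : ι => h (Pi.single i 1)
  refine ⟨(Pi.basisFun (MvPolynomial σ K) ι).constr ℕ y, ?_⟩
  intro x
  have : ψ ∘ₗ ((Pi.basisFun (MvPolynomial σ K) ι).constr ℕ y) = φ := by
    refine (Pi.basisFun (MvPolynomial σ K) ι).ext fun i => ?_
    rw [LinearMap.comp_apply, Module.Basis.constr_basis, hy]
    simp
  rw [← this]; rfl

theorem lift_hom {ι κ τ : Type} [Fintype ι] [DecidableEq ι] [Fintype κ] [DecidableEq κ]
    (φ : (ι → MvPolynomial σ K) →ₗ[MvPolynomial σ K] (τ → MvPolynomial σ K))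
    (ψ : (κ → MvPolynomial σ K) →ₗ[MvPolynomial σ K] (τ → MvPolynomial σ K))
    (h : ∀ x, ∃ y, ψ y = φ x) (g : ι → ℕ) (d : κ → ℕ) (s : τ → ℕ)
    (hφ : ∀ i, Hom (g i) s (φ (Pi.single i 1)))
    (hψ : ∀ i, Hom (d i) s (ψ (Pi.single i 1))) :
    ∃ u : (ι → MvPolynomial σ K) →ₗ[MvPolynomial σ K] (κ → MvPolynomial σ K),
      (∀ x, ψ (u x) = φ x) ∧ ∀ i, Hom (g i) d (u (Pi.single i 1)) := by
  choose y hy using fun i : ι => h (Pi.single i 1)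
  let y' : ι → κ → MvPolynomial σ K := fun i k => part (g i) (d k) (y i k)
  have hy' : ∀ i, ψ (y' i) = φ (Pi.single i 1) := by
    intro i
    rw [← hy]
    exact part_map ψ d s hψ (g i) (y i) (by rw [hy]; exact hφ i)
  refine ⟨(Pi.basisFun (MvPolynomial σ K) ι).constr ℕ y', ?_, ?_⟩
  · intro x
    have : ψ ∘ₗ ((Pi.basisFun (MvPolynomial σ K) ι).constr ℕ y') = φ := by
      refine (Pi.basisFun (MvPolynomial σ K) ι).ext fun i => ?_
      rw [LinearMap.comp_apply, Module.Basis.constr_basis, hy']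
      simp
    rw [← this]; rfl
  · intro i
    rw [← Pi.basisFun_apply, Module.Basis.constr_basis]
    intro t μ hμ
    by_contra hne
    apply hμ
    rw [coeff_part, if_neg hne]

theorem card_of_matrix {ι κ : Type} [Fintype ι] [DecidableEq ι] [Fintype κ] [DecidableEq κ]
    (A : Matrix ι κ K) (B : Matrix κ ι K) (h1 : A * B = 1) (h2 : B * A = 1)
    (d : ι → ℕ) (g : κ → ℕ) (hA : ∀ l k, A l k ≠ 0 → d l = g k) (j : ℕ) :
    (Finset.univ.filter fun k => g k = j).card = (Finset.univ.filter fun l => d l = j).card := by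
  let A' : Matrix {l // d l = j} {k // g k = j} K := A.submatrix (fun l => l.1) (fun k => k.1)
  let B' : Matrix {k // g k = j} {l // d l = j} K := B.submatrix (fun l => l.1) (fun k => k.1)
  have e1 : A' * B' = 1 := by
    ext l l'
    have := congrFun (congrFun h1 l.1) l'.1
    rw [Matrix.mul_apply] at this ⊢
    rw [Matrix.one_apply] at this ⊢
    simp only [← Subtype.ext_iff] at this
    rw [← this]
    have := Finset.sum_subtype_of_mem (s := Finset.univ.filter fun k => g k = j)
      (p := fun k => g k = j) (fun k => A l.1 k * B k l'.1) (by simp)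
    rw [Finset.subtype_eq_univ.2 (by simp)] at this
    refine this.trans ?_
    refine Finset.sum_subset (Finset.subset_univ _) fun k _ hk => ?_
    have : A l.1 k = 0 := by
      by_contra hne
      have := hA _ _ hne
      simp at hk
      exact hk (this.symm.trans l.2)
    rw [this, zero_mul]
  have e2 : B' * A' = 1 := by
    ext l l'
    have := congrFun (congrFun h2 l.1) l'.1
    rw [Matrix.mul_apply] at this ⊢
    rw [Matrix.one_apply] at this ⊢
    simp only [← Subtype.ext_iff] at this
    rw [← this]
    have := Finset.sum_subtype_of_mem (s := Finset.univ.filter fun k => d k = j)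
      (p := fun k => d k = j) (fun k => B l.1 k * A k l'.1) (by simp)
    rw [Finset.subtype_eq_univ.2 (by simp)] at this
    refine this.trans ?_
    refine Finset.sum_subset (Finset.subset_univ _) fun k _ hk => ?_
    have : A k l'.1 = 0 := by
      by_contra hne
      have := hA _ _ hne
      simp at hk
      exact hk (this.trans l'.2)
    rw [this, mul_zero]
  have := (Matrix.toLin'OfInv e1 e2).finrank_eq
  rw [Module.finrank_fintype_fun_eq_card, Module.finrank_fintype_fun_eq_card,
    Fintype.card_subtype, Fintype.card_subtype] at this
  first | exact this | exact this.symm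

theorem card_eq {ι κ : Type} [Fintype ι] [DecidableEq ι] [Fintype κ] [DecidableEq κ]
    (u : (κ → MvPolynomial σ K) →ₗ[MvPolynomial σ K] (ι → MvPolynomial σ K))
    (v : (ι → MvPolynomial σ K) →ₗ[MvPolynomial σ K] (κ → MvPolynomial σ K))
    (d : ι → ℕ) (g : κ → ℕ)
    (hu : ∀ i, Hom (g i) d (u (Pi.single i 1)))
    (h1 : ∀ x l, constantCoeff (u (v x) l) = constantCoeff (x l))
    (h2 : ∀ x l, constantCoeff (v (u x) l) = constantCoeff (x l)) (j : ℕ) :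
    (Finset.univ.filter fun k => g k = j).card = (Finset.univ.filter fun l => d l = j).card := by
  refine card_of_matrix (K := K) (Matrix.of fun l k => constantCoeff (u (Pi.single k 1) l))
    (Matrix.of fun k l => constantCoeff (v (Pi.single l 1) k)) ?_ ?_ d g ?_ j
  · ext l l'
    have := h1 (Pi.single l' 1) l
    rw [apply_eq, map_sum] at this
    simp only [map_mul] at this
    rw [Matrix.mul_apply, Matrix.one_apply]
    simp only [Matrix.of_apply]
    simp_rw [mul_comm] at this ⊢
    rw [this, Pi.single_apply]
    split_ifs <;> simp
  · ext l l'
    have := h2 (Pi.single l' 1) l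
    rw [apply_eq, map_sum] at this
    simp only [map_mul] at this
    rw [Matrix.mul_apply, Matrix.one_apply]
    simp only [Matrix.of_apply]
    simp_rw [mul_comm] at this ⊢
    rw [this, Pi.single_apply]
    split_ifs <;> simp
  · intro l k hne
    have := hu k l 0 hne
    simpa using this

/-- Comparison of a minimal resolution with a minimal one of length one. -/
theorem compare {ι₀ ι₁ ι₂ ι₃ κ₀ κ₁ τ : Type} [Fintype ι₀] [DecidableEq ι₀] [Fintype ι₁]
    [DecidableEq ι₁] [Fintype ι₂] [DecidableEq ι₂] [Fintype κ₀] [DecidableEq κ₀]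
    [Fintype κ₁] [DecidableEq κ₁] [Fintype ι₃] [DecidableEq ι₃]
    (φ0 : (ι₀ → MvPolynomial σ K) →ₗ[MvPolynomial σ K] (τ → MvPolynomial σ K))
    (φ1 : (ι₁ → MvPolynomial σ K) →ₗ[MvPolynomial σ K] (ι₀ → MvPolynomial σ K))
    (φ2 : (ι₂ → MvPolynomial σ K) →ₗ[MvPolynomial σ K] (ι₁ → MvPolynomial σ K))
    (φ3 : (ι₃ → MvPolynomial σ K) →ₗ[MvPolynomial σ K] (ι₂ → MvPolynomial σ K))
    (ψ0 : (κ₀ → MvPolynomial σ K) →ₗ[MvPolynomial σ K] (τ → MvPolynomial σ K))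
    (ψ1 : (κ₁ → MvPolynomial σ K) →ₗ[MvPolynomial σ K] (κ₀ → MvPolynomial σ K))
    (s : τ → ℕ) (g0 : ι₀ → ℕ) (g1 : ι₁ → ℕ) (d0 : κ₀ → ℕ) (d1 : κ₁ → ℕ)
    (hφ0 : ∀ i, Hom (g0 i) s (φ0 (Pi.single i 1)))
    (hφ1 : ∀ i, Hom (g1 i) g0 (φ1 (Pi.single i 1)))
    (hψ0 : ∀ i, Hom (d0 i) s (ψ0 (Pi.single i 1)))
    (hψ1 : ∀ i, Hom (d1 i) d0 (ψ1 (Pi.single i 1)))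
    (m1 : ∀ x t, constantCoeff (φ1 x t) = 0)
    (m2 : ∀ x t, constantCoeff (φ2 x t) = 0)
    (m3 : ∀ x t, constantCoeff (φ3 x t) = 0)
    (n1 : ∀ x t, constantCoeff (ψ1 x t) = 0)
    (c1 : ∀ x, φ0 (φ1 x) = 0) (c2 : ∀ x, φ1 (φ2 x) = 0)
    (e1 : ∀ x, φ0 x = 0 → ∃ y, φ1 y = x)
    (e2 : ∀ x, φ1 x = 0 → ∃ y, φ2 y = x)
    (e3 : ∀ x, φ2 x = 0 → ∃ y, φ3 y = x)
    (c1' : ∀ x, ψ0 (ψ1 x) = 0)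
    (e1' : ∀ x, ψ0 x = 0 → ∃ y, ψ1 y = x)
    (e2' : ∀ x, ψ1 x = 0 → x = 0)
    (r : ∀ x, ∃ y, ψ0 y = φ0 x) (r' : ∀ x, ∃ y, φ0 y = ψ0 x) :
    (∀ j, (Finset.univ.filter fun k => g0 k = j).card
      = (Finset.univ.filter fun l => d0 l = j).card) ∧
    (∀ j, (Finset.univ.filter fun k => g1 k = j).card
      = (Finset.univ.filter fun l => d1 l = j).card) ∧ IsEmpty ι₂ := by
  obtain ⟨u0, hu0, du0⟩ := lift_hom φ0 ψ0 r g0 d0 s hφ0 hψ0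
  obtain ⟨v0, hv0⟩ := lift ψ0 φ0 r'
  -- homotopies
  obtain ⟨h0, hh0⟩ := lift (v0 ∘ₗ u0 - LinearMap.id) φ1 (fun x => e1 _ (by
    simp [hv0, hu0]))
  obtain ⟨k0, hk0⟩ := lift (u0 ∘ₗ v0 - LinearMap.id) ψ1 (fun x => e1' _ (by
    simp [hv0, hu0]))
  obtain ⟨u1, hu1, du1⟩ := lift_hom (u0 ∘ₗ φ1) ψ1 (fun x => e1' _ (by
    simp [hu0, c1])) g1 d1 d0 (fun i =>
      hom_map u0 g0 d0 du0 _ _ (hφ1 i)) hψ1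
  obtain ⟨v1, hv1⟩ := lift (v0 ∘ₗ ψ1) φ1 (fun x => e1 _ (by
    simp [hv0, c1']))
  simp only [LinearMap.sub_apply, LinearMap.comp_apply, LinearMap.id_apply] at hh0 hk0 hu1 hv1
  obtain ⟨h1, hh1⟩ := lift (v1 ∘ₗ u1 - LinearMap.id - h0 ∘ₗ φ1) φ2 (fun x => e2 _ (by
    simp [hv1, hu1, hh0]))
  simp only [LinearMap.sub_apply, LinearMap.comp_apply, LinearMap.id_apply] at hh1
  have hk1 : ∀ x, u1 (v1 x) - x - k0 (ψ1 x) = 0 := fun x => e2' _ (by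
    simp [hv1, hu1, hk0])
  refine ⟨card_eq u0 v0 d0 g0 du0 ?_ ?_, card_eq u1 v1 d1 g1 du1 ?_ ?_, ?_⟩
  · intro x l
    have := n1 (k0 x) l
    rw [hk0, Pi.sub_apply, map_sub, sub_eq_zero] at this
    exact this
  · intro x l
    have := m1 (h0 x) l
    rw [hh0, Pi.sub_apply, map_sub, sub_eq_zero] at this
    exact this
  · intro x l
    have h := congrArg constantCoeff (congrFun (hk1 x) l)
    rw [Pi.sub_apply, Pi.sub_apply, map_sub, map_sub, cc_zero k0 _ (n1 x)] at h
    simpa [sub_eq_zero] using h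
  · intro x l
    have h := m2 (h1 x) l
    rw [hh1, Pi.sub_apply, Pi.sub_apply, map_sub, map_sub, cc_zero h0 _ (m1 x)] at h
    simpa [sub_eq_zero] using h
  · refine ⟨fun i => ?_⟩
    set x : ι₂ → MvPolynomial σ K := Pi.single i 1 with hx
    have hz : u1 (φ2 x) = 0 := e2' _ (by rw [hu1, c2, map_zero])
    have := hh1 (φ2 x)
    rw [hz, c2] at this
    obtain ⟨y, hy⟩ := e3 (h1 (φ2 x) + x) (by rw [map_add, this]; simp)
    have h3 := m3 y i
    rw [hy, Pi.add_apply, map_add, cc_zero h1 _ (m2 x)] at h3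
    simp [hx] at h3

theorem weight_one (μ : σ →₀ ℕ) : Finsupp.weight (1 : σ → ℕ) μ = Finsupp.degree μ :=
  (DFunLike.congr_fun (Finsupp.degree_eq_weight_one (R := ℕ)) μ).symm

theorem hom_monomial (α : σ →₀ ℕ) (c : K) (μ : σ →₀ ℕ)
    (h : coeff μ (monomial α c) ≠ 0) : μ = α := by
  classical
  rw [coeff_monomial] at h
  by_contra hne
  exact h (if_neg (Ne.symm hne))

theorem totalDegree_one (α : σ →₀ ℕ) :
    (monomial α (1 : K)).totalDegree = Finsupp.degree α := by
  rw [totalDegree_monomial _ one_ne_zero]; rfl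

/-- The explicit length-one resolution. -/
theorem explicit {n m : ℕ}
    (f : Fin m → (Fin n →₀ ℕ)) (d a : Fin m → ℕ)
    (hmin : ∀ k : Fin m, monomial (f k) (1 : K) ∉
      Ideal.span ((fun l => monomial (f l) (1 : K)) '' {l : Fin m | l ≠ k}))
    (hd : ∀ k, (monomial (f k) (1 : K)).totalDegree = d k)
    (hcolon : ∀ k : Fin m, 0 < (k : ℕ) →
      IsRegSeqSpan
        ((Ideal.span ((fun l => monomial (f l) (1 : K)) '' {l : Fin m | (l : ℕ) < (k : ℕ)})).colon
          (Ideal.span {monomial (f k) (1 : K)}))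
        1 (fun _ => a k)) :
    ∃ ψ1 : ({k : Fin m // 0 < (k : ℕ)} → MvPolynomial (Fin n) K) →ₗ[MvPolynomial (Fin n) K]
        (Fin m → MvPolynomial (Fin n) K),
      (∀ i, Hom (a i.1 + d i.1) d (ψ1 (Pi.single i 1))) ∧
      (∀ x t, constantCoeff (ψ1 x t) = 0) ∧
      (∀ x, ∑ k, ψ1 x k * monomial (f k) (1 : K) = 0) ∧
      (∀ x, ∑ k, x k * monomial (f k) (1 : K) = 0 → ∃ y, ψ1 y = x) ∧
      (∀ x, ψ1 x = 0 → x = 0) := by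
  classical
  have hd' : ∀ k, Finsupp.degree (f k) = d k := fun k => by rw [← hd, totalDegree_one]
  have H : ∀ k : {k : Fin m // 0 < (k : ℕ)}, ∃ α γ : Fin n →₀ ℕ, ∃ l : Fin m,
      (l : ℕ) < (k.1 : ℕ) ∧ α ≠ 0 ∧ γ ≠ 0 ∧ Finsupp.degree α = a k.1 ∧
      α + f k.1 = γ + f l ∧
      ∀ p : MvPolynomial (Fin n) K, p * monomial (f k.1) 1 ∈
        Ideal.span ((fun l => monomial (f l) (1 : K)) '' {l : Fin m | (l : ℕ) < (k.1 : ℕ)}) →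
        ∃ c, p = c * monomial α 1 := by
    intro k
    obtain ⟨α, hne, -, hdeg, hL⟩ := hcolon k.1 k.2
    have hmem : ∀ p : MvPolynomial (Fin n) K, p * monomial (f k.1) 1 ∈
        Ideal.span ((fun l => monomial (f l) (1 : K)) '' {l : Fin m | (l : ℕ) < (k.1 : ℕ)}) ↔
        ∃ c, p = c * monomial (α 0) 1 := by
      intro p
      have h1 : p ∈ (Ideal.span ((fun l => monomial (f l) (1 : K)) ''
          {l : Fin m | (l : ℕ) < (k.1 : ℕ)})).colon (Ideal.span {monomial (f k.1) (1 : K)}) ↔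
          p * monomial (f k.1) 1 ∈ Ideal.span ((fun l => monomial (f l) (1 : K)) ''
            {l : Fin m | (l : ℕ) < (k.1 : ℕ)}) := by
        exact Ideal.mem_colon_span_singleton
      rw [← h1, hL]
      have : (Set.range fun t : Fin 1 => monomial (α t) (1 : K)) = {monomial (α 0) 1} := by
        rw [Set.range_unique]; rfl
      rw [this, Ideal.mem_span_singleton']
      constructor
      · rintro ⟨c, hc⟩; exact ⟨c, hc.symm⟩
      · rintro ⟨c, hc⟩; exact ⟨c, hc.symm⟩
    have h0 := (hmem (monomial (α 0) 1)).2 ⟨1, by simp⟩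
    rw [monomial_mul, one_mul] at h0
    have h1 : ∃ l : Fin m, (l : ℕ) < k.1 ∧ f l ≤ α 0 + f k.1 := by
      have himg : ((fun l => monomial (f l) (1 : K)) '' {l : Fin m | (l : ℕ) < (k.1 : ℕ)}) =
        (fun s => monomial s (1 : K)) '' (f '' {l : Fin m | (l : ℕ) < (k.1 : ℕ)}) := by
        rw [Set.image_image]
      rw [himg, mem_ideal_span_monomial_image] at h0
      obtain ⟨s, ⟨l, hl, rfl⟩, hle⟩ := h0 (α 0 + f k.1) (by simp [mem_support_iff])
      exact ⟨l, hl, hle⟩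
    obtain ⟨l, hl, hle⟩ := h1
    have hα : α 0 ≠ 0 := by
      intro h
      have := hne 0
      rw [h] at this
      simp at this
    refine ⟨α 0, α 0 + f k.1 - f l, l, hl, hα, ?_, ?_, ?_, fun p => (hmem p).1⟩
    · intro hz
      have heq : f l = α 0 + f k.1 := le_antisymm hle (tsub_eq_zero_iff_le.1 hz)
      apply hmin l
      have : monomial (f l) (1 : K) = monomial (α 0) 1 * monomial (f k.1) 1 := by
        rw [monomial_mul, one_mul, heq]
      rw [this]
      refine Ideal.mul_mem_left _ _ (Ideal.subset_span ⟨k.1, ?_, rfl⟩)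
      intro h
      rw [h] at hl
      exact lt_irrefl _ hl
    · exact (totalDegree_one (K := K) _).symm.trans (hdeg 0)
    · rw [tsub_add_cancel_of_le hle]
  choose α γ l hl hα hγ hdα hsum hcol using H
  have hlne : ∀ k, l k ≠ k.1 := fun k h => by
    have := hl k
    rw [h] at this
    exact lt_irrefl _ this
  let y : {k : Fin m // 0 < (k : ℕ)} → Fin m → MvPolynomial (Fin n) K := fun k =>
    Pi.single k.1 (monomial (α k) 1) - Pi.single (l k) (monomial (γ k) 1)
  let ψ := Fintype.linearCombination (MvPolynomial (Fin n) K) y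
  have hψs : ∀ k c, ψ (Pi.single k c) = c • y k := fun k c =>
    Fintype.linearCombination_apply_single _ _ _ _
  have hψ1 : ∀ k, ψ (Pi.single k 1) = y k := fun k => by rw [hψs, one_smul]
  have hy1 : ∀ k, y k k.1 = monomial (α k) 1 := fun k => by
    simp [y, Pi.single_apply, (hlne k).symm]
  have hy2 : ∀ k (t : Fin m), (k.1 : ℕ) < t → y k t = 0 := fun k t ht => by
    have h1 : t ≠ k.1 := fun h => by rw [h] at ht; exact lt_irrefl _ ht
    have h2 : t ≠ l k := fun h => by rw [h] at ht; exact lt_asymm ht (hl k)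
    simp [y, Pi.single_apply, h1, h2]
  have hyc : ∀ k, ∑ t, y k t * monomial (f t) (1 : K) = 0 := by
    intro k
    simp only [y, Pi.sub_apply, sub_mul, Finset.sum_sub_distrib, Pi.single_apply, ite_mul,
      zero_mul, Finset.sum_ite_eq', Finset.mem_univ, if_true, monomial_mul, one_mul]
    rw [hsum, sub_self]
  have hc : ∀ x, ∑ k, ψ x k * monomial (f k) (1 : K) = 0 := by
    intro x
    simp_rw [apply_eq ψ x, Finset.sum_mul, mul_assoc]
    rw [Finset.sum_comm]
    refine Finset.sum_eq_zero fun k _ => ?_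
    rw [← Finset.mul_sum, hψ1, hyc, mul_zero]
  refine ⟨ψ, ?_, ?_, hc, ?_, ?_⟩
  · intro k t μ hμ
    rw [hψ1] at hμ
    have hs := congrArg Finsupp.degree (hsum k)
    rw [map_add, map_add, hdα, hd', hd'] at hs
    by_cases h1 : t = k.1
    · subst h1
      rw [hy1] at hμ
      rw [hom_monomial _ _ _ hμ, hdα]
    · by_cases h2 : t = l k
      · subst h2
        have : y k (l k) = monomial (γ k) (-1) := by
          simp [y, Pi.single_apply, h1]
        rw [this] at hμ
        rw [hom_monomial _ _ _ hμ, hs]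
      · simp [y, Pi.single_apply, h1, h2] at hμ
  · refine cc_zero' ψ fun k t => ?_
    rw [hψ1]
    by_contra hμ
    by_cases h1 : t = k.1
    · subst h1
      rw [hy1] at hμ
      exact hα k (hom_monomial _ _ _ hμ).symm
    · by_cases h2 : t = l k
      · subst h2
        have : y k (l k) = monomial (γ k) (-1) := by
          simp [y, Pi.single_apply, h1]
        rw [this] at hμ
        exact hγ k (hom_monomial _ _ _ hμ).symm
      · simp [y, Pi.single_apply, h1, h2] at hμ
  · have main : ∀ b : ℕ, ∀ x : Fin m → MvPolynomial (Fin n) K, (∀ k : Fin m, b ≤ k → x k = 0) →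
        ∑ k, x k * monomial (f k) (1 : K) = 0 → ∃ y, ψ y = x := by
      intro b
      induction b with
      | zero =>
        intro x hx _
        exact ⟨0, by rw [map_zero]; funext k; exact (hx k (Nat.zero_le _)).symm⟩
      | succ b ih =>
        intro x hx hs
        by_cases hb : b < m
        swap
        · exact ih x (fun k hk => absurd k.2 (by omega)) hs
        have hs2 := hs
        rw [← Finset.add_sum_erase _ _ (Finset.mem_univ (⟨b, hb⟩ : Fin m))] at hs2
        have hmem : x ⟨b, hb⟩ * monomial (f ⟨b, hb⟩) 1 ∈
            Ideal.span ((fun l => monomial (f l) (1 : K)) '' {l : Fin m | (l : ℕ) < b}) := by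
          rw [eq_neg_of_add_eq_zero_left hs2]
          refine neg_mem (sum_mem fun k hk => ?_)
          have hkb : k ≠ ⟨b, hb⟩ := (Finset.mem_erase.1 hk).1
          have hkb' : (k : ℕ) ≠ b := fun h => hkb (Fin.ext h)
          by_cases hlt : (k : ℕ) < b
          · exact Ideal.mul_mem_left _ _ (Ideal.subset_span ⟨k, hlt, rfl⟩)
          · rw [hx k (by omega), zero_mul]
            exact zero_mem _
        by_cases hb0 : b = 0
        · apply ih x _ hs
          subst hb0
          have hmz : (monomial (f ⟨0, hb⟩) (1 : K)) ≠ 0 := by simp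
          have hz : x ⟨0, hb⟩ = 0 := by
            simpa using hmem
          intro k _
          by_cases hk0 : (k : ℕ) = 0
          · have : k = ⟨0, hb⟩ := Fin.ext hk0
            rw [this, hz]
          · exact hx k (by omega)
        · let k : {k : Fin m // 0 < (k : ℕ)} := ⟨⟨b, hb⟩, Nat.pos_of_ne_zero hb0⟩
          obtain ⟨c, hcc⟩ := hcol k _ hmem
          obtain ⟨z, hz⟩ := ih (x - ψ (Pi.single k c)) (by
            intro t ht
            rw [hψs, Pi.sub_apply, Pi.smul_apply, smul_eq_mul]
            by_cases htb : (t : ℕ) = b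
            · have : t = k.1 := Fin.ext htb
              subst this
              rw [hy1, ← hcc, sub_self]
            · have h3 : (k.1 : ℕ) < t := by change b < _; omega
              rw [hy2 k t h3, hx t (by omega)]
              simp) (by
            simp only [Pi.sub_apply, sub_mul, Finset.sum_sub_distrib]
            rw [hs, hc, sub_self])
          exact ⟨z + Pi.single k c, by rw [map_add, hz, sub_add_cancel]⟩
    intro x hx
    exact main m x (fun k hk => absurd k.2 (by omega)) hx
  · intro x hx
    have main : ∀ j : ℕ, ∀ k : {k : Fin m // 0 < (k : ℕ)}, m - (k.1 : ℕ) = j → x k = 0 := by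
      intro j
      induction j using Nat.strong_induction_on with
      | _ j ih =>
        intro k hk
        have h := congrFun hx k.1
        rw [apply_eq, Finset.sum_eq_single k] at h
        · rw [hψ1, hy1] at h
          simpa using h
        · intro t _ htk
          rw [hψ1]
          rcases lt_trichotomy (t.1 : ℕ) (k.1 : ℕ) with h1 | h1 | h1
          · rw [hy2 t _ h1, mul_zero]
          · exact absurd (Subtype.ext (Fin.ext h1)) htk
          · have h4 := t.1.2
            rw [ih (m - (t.1 : ℕ)) (by omega) t rfl, zero_mul]
        · simp
    funext k
    exact main _ k rfl

end Stmt11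

/-- If `I = (f₁,…,f_m)` is a monomial ideal with `deg f_k = d_k` whose successive colon
ideals are each generated by a single monomial of degree `a_k` (`r₂ = ⋯ = r_m = 1`), then
`β_{0,j}(I) = #{k : d_k = j}`, `β_{1,j}(I) = #{k ≥ 2 : a_k + d_k = j}`, and
`β_{i,j}(I) = 0` for `i ≥ 2`. -/
theorem stmt_11 {K : Type} [Field K] {n m : ℕ} (hm : 0 < m)
    (f : Fin m → (Fin n →₀ ℕ)) (d a : Fin m → ℕ)
    (I : Ideal (MvPolynomial (Fin n) K))
    (hI : I = Ideal.span (Set.range fun k => monomial (f k) (1 : K)))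
    (hmin : ∀ k : Fin m, monomial (f k) (1 : K) ∉
      Ideal.span ((fun l => monomial (f l) (1 : K)) '' {l : Fin m | l ≠ k}))
    (hd : ∀ k, (monomial (f k) (1 : K)).totalDegree = d k)
    (hcolon : ∀ k : Fin m, 0 < (k : ℕ) →
      IsRegSeqSpan
        ((Ideal.span ((fun l => monomial (f l) (1 : K)) '' {l : Fin m | (l : ℕ) < (k : ℕ)})).colon
          (Ideal.span {monomial (f k) (1 : K)}))
        1 (fun _ => a k))
    (res : MinFreeResOfIdeal I) :
    (∀ j, res.toMinFreeResData.betti 0 j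
        = (Finset.univ.filter fun k : Fin m => d k = j).card) ∧
    (∀ j, res.toMinFreeResData.betti 1 j
        = (Finset.univ.filter fun k : Fin m => 0 < (k : ℕ) ∧ a k + d k = j).card) ∧
    (∀ i j, 2 ≤ i → res.toMinFreeResData.betti i j = 0) := by
  classical
  obtain ⟨ψ1, hψ1, n1, c1', e1', e2'⟩ := Stmt11.explicit f d a hmin hd hcolon
  let ψ0 : (Fin m → MvPolynomial (Fin n) K) →ₗ[MvPolynomial (Fin n) K]
      (Unit → MvPolynomial (Fin n) K) :=
    Fintype.linearCombination (MvPolynomial (Fin n) K) fun k _ => monomial (f k) (1 : K)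
  let φ0 : (Fin (res.N 0) → MvPolynomial (Fin n) K) →ₗ[MvPolynomial (Fin n) K]
      (Unit → MvPolynomial (Fin n) K) := LinearMap.pi fun _ => res.ε
  have hψs : ∀ k, ψ0 (Pi.single k 1) = fun _ => monomial (f k) 1 := fun k =>
    (Fintype.linearCombination_apply_single _ _ _ _).trans (one_smul _ _)
  have hψ0 : ∀ x t, ψ0 x t = ∑ k, x k * monomial (f k) (1 : K) := fun x t => by
    rw [Stmt11.apply_eq]; simp only [hψs]
  have hψ0' : ∀ x, ψ0 x = 0 ↔ ∑ k, x k * monomial (f k) (1 : K) = 0 := fun x => by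
    constructor
    · intro h; rw [← hψ0 x (), h]; rfl
    · intro h; funext t; rw [hψ0, h]; rfl
  have hφ0 : ∀ x t, φ0 x t = res.ε x := fun x t => rfl
  have hφ0' : ∀ x, φ0 x = 0 ↔ res.ε x = 0 := fun x => by
    constructor
    · intro h; rw [← hφ0 x (), h]; rfl
    · intro h; funext t; rw [hφ0, h]; rfl
  have mm : ∀ i x t, constantCoeff (res.d i x t) = 0 := by
    intro i
    refine Stmt11.cc_zero' _ fun k t => ?_
    have h := res.hdeg i k t
    split_ifs at h with hlt
    · by_contra hne
      have := h hne
      simp at this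
      omega
    · rw [h, map_zero]
  have hh1 : ∀ i k, Stmt11.Hom (res.g (i + 1) k) (res.g i) (res.d i (Pi.single k 1)) := by
    intro i k t μ hμ
    have h := res.hdeg i k t
    split_ifs at h with hlt
    · have := h hμ
      rw [Stmt11.weight_one] at this
      omega
    · rw [h] at hμ; simp at hμ
  have ex : ∀ i x, res.d i x = 0 → ∃ y, res.d (i + 1) y = x := by
    intro i x hx
    have : x ∈ LinearMap.ker (res.d i) := hx
    rw [← res.hexact i] at this
    exact this
  have cx : ∀ i x, res.d i (res.d (i + 1) x) = 0 := by
    intro i x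
    have : res.d (i + 1) x ∈ LinearMap.range (res.d (i + 1)) := ⟨x, rfl⟩
    rw [res.hexact i] at this
    exact this
  have hrange : ∀ p, p ∈ I ↔ ∃ x : Fin m → MvPolynomial (Fin n) K, ∑ k, x k * monomial (f k) (1 : K) = p := by
    intro p
    rw [hI, Ideal.mem_span_range_iff_exists_fun]
  have hrange' : ∀ p, p ∈ I ↔ ∃ x, res.ε x = p := by
    intro p
    exact (SetLike.ext_iff.1 res.hrange p).symm.trans LinearMap.mem_range
  obtain ⟨b0, b1, b2⟩ := Stmt11.compare φ0 (res.d 0) (res.d 1) (res.d 2) ψ0 ψ1 (fun _ => 0)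
    (res.g 0) (res.g 1) d (fun k : {k : Fin m // 0 < (k : ℕ)} => a k.1 + d k.1)
    (by
      intro k t μ hμ
      have := res.hεdeg k hμ
      rw [Stmt11.weight_one] at this
      exact this)
    (hh1 0)
    (by
      intro k t μ hμ
      rw [hψs] at hμ
      rw [Stmt11.hom_monomial _ _ _ hμ, ← hd, Stmt11.totalDegree_one]; rfl)
    hψ1 (mm 0) (mm 1) (mm 2) n1
    (by
      intro x
      rw [hφ0']
      have : res.d 0 x ∈ LinearMap.range (res.d 0) := ⟨x, rfl⟩
      rw [← res.hker] at this
      exact this)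
    (cx 0)
    (by
      intro x hx
      have : x ∈ LinearMap.ker res.ε := (hφ0' x).1 hx
      rw [res.hker] at this
      exact this)
    (ex 0) (ex 1)
    (fun x => (hψ0' _).2 (c1' x))
    (fun x hx => e1' x ((hψ0' x).1 hx))
    e2'
    (by
      intro x
      obtain ⟨y, hy⟩ := (hrange _).1 ((hrange' _).2 ⟨x, rfl⟩)
      exact ⟨y, by funext t; rw [hψ0, hφ0, hy]⟩)
    (by
      intro x
      obtain ⟨y, hy⟩ := (hrange' _).1 ((hrange _).2 ⟨x, rfl⟩)
      exact ⟨y, by funext t; rw [hψ0, hφ0, hy]⟩)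
  refine ⟨b0, ?_, ?_⟩
  · intro j
    refine (b1 j).trans ?_
    rw [← Fintype.card_subtype, ← Fintype.card_subtype]
    exact Fintype.card_congr
      (Equiv.subtypeSubtypeEquivSubtypeInter (fun k : Fin m => 0 < (k : ℕ))
        (fun k => a k + d k = j))
  · have emp : ∀ i, IsEmpty (Fin (res.N (i + 2))) := by
      intro i
      induction i with
      | zero => exact b2
      | succ i ih =>
        refine ⟨fun k => ?_⟩
        obtain ⟨y, hy⟩ := ex (i + 2) (Pi.single k 1) (by
          funext t
          exact (ih.false t).elim)
        have h := mm (i + 3) y k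
        rw [hy] at h
        simp at h
    intro i j hi
    obtain ⟨i, rfl⟩ := Nat.exists_eq_add_of_le' hi
    have := emp i
    unfold MinFreeResData.betti
    rw [Finset.card_eq_zero]
    ext k
    exact (this.false k).elim
end

section
/- Let I ⊂ R = K[x₁,…,xₙ] be a monomial ideal satisfying the hypotheses of Proposition on regular quotients (each colon ideal (f₁,…,f_{k−1}) : f_k generated by a regular sequence of monomials), and let Q(I) = max{d_k + a_{k,1}+⋯+a_{k,r_k} − r_k : 2 ≤ k ≤ m}, P(I) = max{r₂,…,r_m}, and D(I) the degree of the polynomial (1−t)ⁿ·HS(I,t). If P(I) + Q(I) = D(I), then reg(I) = Q(I), pdim(I) = P(I), and β_{P(I), P(I)+Q(I)}(I) ≠ 0 is the unique extremal Betti number of I. -/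
open MvPolynomial

set_option linter.unusedVariables false

namespace BettiAux

variable {K : Type} [Field K] {σ : Type}

/-- Homogeneous elements of degree `d` in `R(-e)`. -/
def Hs (e d : ℕ) : Submodule K (MvPolynomial σ K) where
  carrier := {p | ∀ c, coeff c p ≠ 0 → c.degree + e = d}
  zero_mem' := by intro c hc; simp at hc
  add_mem' := by
    intro p q hp hq c hc
    by_cases h : coeff c p = 0
    · apply hq; intro h'; apply hc; simp [h, h']
    · exact hp c h
  smul_mem' := by
    intro a p hp c hc
    apply hp; intro h; apply hc; simp [h]

lemma mem_Hs {e d : ℕ} {p : MvPolynomial σ K} :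
    p ∈ Hs e d ↔ ∀ c, coeff c p ≠ 0 → c.degree + e = d := Iff.rfl

lemma wt_one (c : σ →₀ ℕ) : Finsupp.weight (1 : σ → ℕ) c = c.degree := by
  rw [Finsupp.degree_eq_weight_one]; rfl

lemma mem_Hs_iff {e d : ℕ} {p : MvPolynomial σ K} (h : e ≤ d) :
    p ∈ Hs e d ↔ p ∈ homogeneousSubmodule σ K (d - e) := by
  rw [mem_homogeneousSubmodule, mem_Hs]
  constructor
  · intro hp c hc
    rw [wt_one]
    have := hp c hc
    omega
  · intro hp c hc
    have := hp hc
    rw [wt_one] at this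
    omega

lemma Hs_le {e d : ℕ} {p : MvPolynomial σ K} (hp : p ∈ Hs e d) (h0 : p ≠ 0) : e ≤ d := by
  obtain ⟨c, hc⟩ := MvPolynomial.ne_zero_iff.1 h0
  have := hp c hc
  omega

lemma Hs_eq_bot {e d : ℕ} {p : MvPolynomial σ K} (hp : p ∈ Hs e d) (h : d < e) : p = 0 := by
  by_contra h0
  have := Hs_le hp h0
  omega

lemma Hs_mul {e b d : ℕ} {p q : MvPolynomial σ K} (hp : p ∈ Hs e d) (hq : q ∈ Hs b e) :
    p * q ∈ Hs b d := by
  classical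
  intro c hc
  rw [coeff_mul] at hc
  obtain ⟨x, hx, hne⟩ := Finset.exists_ne_zero_of_sum_ne_zero hc
  have h1 := hp x.1 (left_ne_zero_of_mul hne)
  have h2 := hq x.2 (right_ne_zero_of_mul hne)
  rw [Finset.HasAntidiagonal.mem_antidiagonal] at hx
  rw [← hx, map_add]
  omega

lemma one_mem_Hs (e : ℕ) : (1 : MvPolynomial σ K) ∈ Hs e e := by
  classical
  intro c hc
  rw [coeff_one] at hc
  have : (0 : σ →₀ ℕ) = c := by by_contra h; simp [h] at hc
  simp [← this]

lemma monomial_mem_Hs (e : ℕ) (c : σ →₀ ℕ) (a : K) : monomial c a ∈ Hs e (c.degree + e) := by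
  classical
  intro c' hc
  rw [coeff_monomial] at hc
  have : c = c' := by by_contra h; simp [h] at hc
  rw [this]

/-- Projection onto the degree `d` part of `R(-e)`. -/
noncomputable def cmp (e d : ℕ) : MvPolynomial σ K →ₗ[K] MvPolynomial σ K :=
  if e ≤ d then homogeneousComponent (d - e) else 0

lemma coeff_cmp (e d : ℕ) (p : MvPolynomial σ K) (c : σ →₀ ℕ) :
    coeff c (cmp e d p) = if c.degree + e = d then coeff c p else 0 := by
  unfold cmp
  by_cases h : e ≤ d
  · rw [if_pos h, coeff_homogeneousComponent]
    by_cases h' : c.degree = d - e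
    · rw [if_pos h', if_pos (by omega)]
    · rw [if_neg h', if_neg (by omega)]
  · rw [if_neg h, if_neg (by omega)]; simp

lemma cmp_mem (e d : ℕ) (p : MvPolynomial σ K) : cmp e d p ∈ Hs e d := by
  intro c hc
  rw [coeff_cmp] at hc
  by_contra h; simp [h] at hc

lemma cmp_of_mem {e d : ℕ} {p : MvPolynomial σ K} (hp : p ∈ Hs e d) : cmp e d p = p := by
  ext c
  rw [coeff_cmp]
  split_ifs with h
  · rfl
  · by_contra h'; exact h (hp c (Ne.symm h'))

lemma cmp_of_ne {e d d' : ℕ} {p : MvPolynomial σ K} (hp : p ∈ Hs e d') (h : d' ≠ d) :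
    cmp e d p = 0 := by
  ext c
  rw [coeff_cmp]
  split_ifs with h1
  · simp only [coeff_zero]
    by_contra h'
    exact h ((hp c h').symm.trans h1)
  · simp

lemma cmp_mul {b e d : ℕ} {q : MvPolynomial σ K} (hq : q ∈ Hs b e) (p : MvPolynomial σ K) :
    cmp b d (p * q) = cmp e d p * q := by
  induction p using MvPolynomial.induction_on' with
  | monomial c a =>
    have h1 := monomial_mem_Hs (K := K) e c a
    have h2 := Hs_mul h1 hq
    by_cases h : c.degree + e = d
    · subst h
      rw [cmp_of_mem h1, cmp_of_mem h2]
    · rw [cmp_of_ne h1 h, cmp_of_ne h2 h, zero_mul]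
  | add p r hp hr => rw [add_mul, map_add, map_add, hp, hr, add_mul]

/-- Degree `d` part of the graded free module with generators in degrees `g`. -/
def Fr {ι : Type} (g : ι → ℕ) (d : ℕ) : Submodule K (ι → MvPolynomial σ K) where
  carrier := {v | ∀ k, v k ∈ Hs (g k) d}
  zero_mem' := fun _ => Submodule.zero_mem _
  add_mem' := fun hp hq k => Submodule.add_mem _ (hp k) (hq k)
  smul_mem' := fun a _ hp k => Submodule.smul_mem _ a (hp k)

lemma mem_Fr {ι : Type} {g : ι → ℕ} {d : ℕ} {v : ι → MvPolynomial σ K} :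
    v ∈ Fr g d ↔ ∀ k, v k ∈ Hs (g k) d := Iff.rfl

lemma Fr_smul {ι : Type} {g : ι → ℕ} {e d : ℕ} {c : MvPolynomial σ K} {v : ι → MvPolynomial σ K}
    (hc : c ∈ Hs e d) (hv : v ∈ Fr g e) : c • v ∈ Fr g d :=
  fun k => Hs_mul hc (hv k)

lemma single_mem_Fr {ι : Type} [DecidableEq ι] (g : ι → ℕ) (k : ι) :
    (Pi.single k 1 : ι → MvPolynomial σ K) ∈ Fr g (g k) := by
  intro l
  by_cases h : l = k
  · subst h; simpa using one_mem_Hs _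
  · simp [h]

/-- graded family -/
structure GS {M : Type} [AddCommGroup M] [Module (MvPolynomial σ K) M] (B : ℕ → Set M) : Prop where
  zero : ∀ d, 0 ∈ B d
  add : ∀ d x y, x ∈ B d → y ∈ B d → x + y ∈ B d
  smul : ∀ e d (c : MvPolynomial σ K) x, c ∈ Hs e d → x ∈ B e → c • x ∈ B d

lemma GS.neg {M : Type} [AddCommGroup M] [Module (MvPolynomial σ K) M] {B : ℕ → Set M}
    (h : GS (K := K) (σ := σ) B) {d : ℕ} {x : M} (hx : x ∈ B d) : -x ∈ B d := by
  have := h.smul d d (-1) x (Submodule.neg_mem _ (one_mem_Hs d)) hx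
  simpa using this

lemma GS.sum {M : Type} [AddCommGroup M] [Module (MvPolynomial σ K) M] {B : ℕ → Set M}
    (h : GS (K := K) (σ := σ) B) {d : ℕ} {ι : Type} (s : Finset ι) (x : ι → M)
    (hx : ∀ i, x i ∈ B d) : ∑ i ∈ s, x i ∈ B d := by
  classical
  induction s using Finset.induction_on with
  | empty => simpa using h.zero d
  | insert a s ha ih => rw [Finset.sum_insert ha]; exact h.add _ _ _ (hx a) ih

lemma GS_Fr {ι : Type} (g : ι → ℕ) :
    GS (K := K) (σ := σ) (fun d => (Fr (K := K) (σ := σ) g d : Set (ι → MvPolynomial σ K))) where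
  zero := fun d => Submodule.zero_mem _
  add := fun d x y hx hy => Submodule.add_mem _ hx hy
  smul := fun e d c x hc hx => Fr_smul hc hx

/-- degree part of the kernel -/
def Kr {ι M : Type} [AddCommGroup M] [Module (MvPolynomial σ K) M] (g : ι → ℕ)
    (ε : (ι → MvPolynomial σ K) →ₗ[MvPolynomial σ K] M) (d : ℕ) : Set (ι → MvPolynomial σ K) :=
  {v | v ∈ Fr g d ∧ ε v = 0}

lemma GS_Kr {ι M : Type} [AddCommGroup M] [Module (MvPolynomial σ K) M] (g : ι → ℕ)
    (ε : (ι → MvPolynomial σ K) →ₗ[MvPolynomial σ K] M) : GS (K := K) (σ := σ) (Kr g ε) where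
  zero := fun d => ⟨Submodule.zero_mem _, map_zero _⟩
  add := fun d x y hx hy => ⟨Submodule.add_mem _ hx.1 hy.1, by rw [map_add, hx.2, hy.2, add_zero]⟩
  smul := fun e d c x hc hx => ⟨Fr_smul hc hx.1, by rw [map_smul, hx.2, smul_zero]⟩

/-- `ε` presents the family `B`. -/
def Pres {ι M : Type} [AddCommGroup M] [Module (MvPolynomial σ K) M] (g : ι → ℕ)
    (ε : (ι → MvPolynomial σ K) →ₗ[MvPolynomial σ K] M) (B : ℕ → Set M) : Prop :=
  ∀ d, ε '' (Fr (K := K) (σ := σ) g d : Set (ι → MvPolynomial σ K)) = B d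

lemma Pres.mem {ι M : Type} [AddCommGroup M] [Module (MvPolynomial σ K) M] {g : ι → ℕ}
    {ε : (ι → MvPolynomial σ K) →ₗ[MvPolynomial σ K] M} {B : ℕ → Set M} (h : Pres g ε B)
    {d : ℕ} {v} (hv : v ∈ Fr g d) : ε v ∈ B d := by
  rw [← h d]; exact ⟨v, hv, rfl⟩

lemma Pres.exists {ι M : Type} [AddCommGroup M] [Module (MvPolynomial σ K) M] {g : ι → ℕ}
    {ε : (ι → MvPolynomial σ K) →ₗ[MvPolynomial σ K] M} {B : ℕ → Set M} (h : Pres g ε B)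
    {d : ℕ} {x} (hx : x ∈ B d) : ∃ v ∈ Fr g d, ε v = x := by
  rw [← h d] at hx; exact hx

lemma Pres.gs {ι M : Type} [AddCommGroup M] [Module (MvPolynomial σ K) M] {g : ι → ℕ}
    {ε : (ι → MvPolynomial σ K) →ₗ[MvPolynomial σ K] M} {B : ℕ → Set M} (h : Pres g ε B) :
    GS (K := K) (σ := σ) B where
  zero := fun d => by simpa using h.mem (Submodule.zero_mem (Fr g d))
  add := fun d x y hx hy => by
    obtain ⟨v, hv, rfl⟩ := h.exists hx
    obtain ⟨w, hw, rfl⟩ := h.exists hy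
    rw [← map_add]; exact h.mem (Submodule.add_mem _ hv hw)
  smul := fun e d c x hc hx => by
    obtain ⟨v, hv, rfl⟩ := h.exists hx
    rw [← map_smul]; exact h.mem (Fr_smul hc hv)

lemma lin_apply {ι M : Type} [Fintype ι] [DecidableEq ι] [AddCommGroup M]
    [Module (MvPolynomial σ K) M] (ε : (ι → MvPolynomial σ K) →ₗ[MvPolynomial σ K] M) (v) :
    ε v = ∑ k, v k • ε (Pi.single k 1) := by
  rw [LinearMap.pi_apply_eq_sum_univ]
  refine Finset.sum_congr rfl fun k _ => ?_
  congr 2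
  funext j
  by_cases h : k = j
  · subst h; simp
  · simp [h, Ne.symm h]

lemma map_mem {ι M : Type} [Fintype ι] [DecidableEq ι] [AddCommGroup M]
    [Module (MvPolynomial σ K) M] (ε : (ι → MvPolynomial σ K) →ₗ[MvPolynomial σ K] M) {g : ι → ℕ}
    {B : ℕ → Set M} (hB : GS (K := K) (σ := σ) B) (h : ∀ k, ε (Pi.single k 1) ∈ B (g k)) {d v}
    (hv : v ∈ Fr g d) : ε v ∈ B d := by
  rw [lin_apply]
  exact hB.sum _ _ fun k => hB.smul _ _ _ _ (hv k) (h k)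

/-- A linear map from a free module with prescribed values. -/
noncomputable def mk {ι M : Type} [Fintype ι] [AddCommGroup M]
    [Module (MvPolynomial σ K) M] (b : ι → M) : (ι → MvPolynomial σ K) →ₗ[MvPolynomial σ K] M :=
  Fintype.linearCombination (MvPolynomial σ K) b

lemma mk_single {ι M : Type} [Fintype ι] [DecidableEq ι] [AddCommGroup M]
    [Module (MvPolynomial σ K) M] (b : ι → M) (k : ι) :
    mk (K := K) (σ := σ) b (Pi.single k 1) = b k := by
  simp [mk]

lemma lin_ext {ι M : Type} [Fintype ι] [DecidableEq ι] [AddCommGroup M]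
    [Module (MvPolynomial σ K) M] {ε ε' : (ι → MvPolynomial σ K) →ₗ[MvPolynomial σ K] M}
    (h : ∀ k, ε (Pi.single k 1) = ε' (Pi.single k 1)) : ε = ε' := by
  apply LinearMap.ext; intro v; rw [lin_apply, lin_apply ε']; simp only [h]

lemma lift {ι κ M : Type} [Fintype ι] [DecidableEq ι] [AddCommGroup M]
    [Module (MvPolynomial σ K) M] {g : ι → ℕ} {h : κ → ℕ}
    {ε : (κ → MvPolynomial σ K) →ₗ[MvPolynomial σ K] M} {B : ℕ → Set M} (hε : Pres h ε B)
    (φ : (ι → MvPolynomial σ K) →ₗ[MvPolynomial σ K] M) (hφ : ∀ k, φ (Pi.single k 1) ∈ B (g k)) :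
    ∃ ψ : (ι → MvPolynomial σ K) →ₗ[MvPolynomial σ K] (κ → MvPolynomial σ K),
      (∀ d v, v ∈ Fr g d → ψ v ∈ Fr h d) ∧ ∀ v, ε (ψ v) = φ v := by
  choose w hw hw' using fun k => hε.exists (hφ k)
  refine ⟨mk w, fun d v hv => ?_, fun v => ?_⟩
  · exact map_mem (mk w) (GS_Fr h) (fun k => by rw [mk_single]; exact hw k) hv
  · have : ε ∘ₗ (mk w) = φ := lin_ext fun k => by simp [mk_single, hw']
    rw [← this]; rfl

/-- Existence of graded free resolution (up to step `N`) with degrees in `S`. -/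
def Sh : ℕ → (ℕ → ℕ → Prop) → (M : Type) → [AddCommGroup M] → [Module (MvPolynomial σ K) M] →
    (ℕ → Set M) → Prop
  | 0, _, _, _, _, _ => True
  | N + 1, S, M, _, _, B => ∃ (ι : Type) (_ : Fintype ι) (_ : DecidableEq ι) (g : ι → ℕ)
      (ε : (ι → MvPolynomial σ K) →ₗ[MvPolynomial σ K] M),
      Pres g ε B ∧ (∀ k, S 0 (g k)) ∧
      Sh N (fun i => S (i + 1)) (ι → MvPolynomial σ K) (Kr g ε)

/-- A minimal resolution with a generator of degree `j` in position `q`. -/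
def MS (j : ℕ) : ℕ → (M : Type) → [AddCommGroup M] → [Module (MvPolynomial σ K) M] →
    (ℕ → Set M) → Prop
  | 0, M, _, _, B => ∃ (ι : Type) (_ : Fintype ι) (_ : DecidableEq ι) (g : ι → ℕ)
      (ε : (ι → MvPolynomial σ K) →ₗ[MvPolynomial σ K] M),
      Pres g ε B ∧ (∀ d, ∀ v ∈ Kr g ε d, ∀ l, g l = d → v l = 0) ∧ ∃ k, g k = j
  | q + 1, M, _, _, B => ∃ (ι : Type) (_ : Fintype ι) (_ : DecidableEq ι) (g : ι → ℕ)
      (ε : (ι → MvPolynomial σ K) →ₗ[MvPolynomial σ K] M),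
      Pres g ε B ∧ (∀ d, ∀ v ∈ Kr g ε d, ∀ l, g l = d → v l = 0) ∧
      MS j q (ι → MvPolynomial σ K) (Kr g ε)

lemma Sh_mono : ∀ (N : ℕ) (S T : ℕ → ℕ → Prop) (_ : ∀ i j, S i j → T i j) (M : Type)
    [AddCommGroup M] [Module (MvPolynomial σ K) M] (B : ℕ → Set M),
    Sh (K := K) (σ := σ) N S M B → Sh (K := K) (σ := σ) N T M B
  | 0, _, _, _, _, _, _, _, _ => trivial
  | N + 1, S, T, h, M, _, _, B, hB => by
    obtain ⟨ι, i1, i2, g, ε, h1, h2, h3⟩ := hB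
    exact ⟨ι, i1, i2, g, ε, h1, fun k => h _ _ (h2 k),
      Sh_mono N _ _ (fun i j => h (i + 1) j) _ _ h3⟩

lemma horseshoe : ∀ (N : ℕ) (S : ℕ → ℕ → Prop) (MA MB MC : Type)
    [AddCommGroup MA] [Module (MvPolynomial σ K) MA]
    [AddCommGroup MB] [Module (MvPolynomial σ K) MB]
    [AddCommGroup MC] [Module (MvPolynomial σ K) MC]
    (A : ℕ → Set MA) (B : ℕ → Set MB) (C : ℕ → Set MC)
    (f : MA →ₗ[MvPolynomial σ K] MB) (p : MB →ₗ[MvPolynomial σ K] MC)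
    (_ : ∀ d, ∀ a ∈ A d, f a ∈ B d) (_ : ∀ d, ∀ b ∈ B d, p b ∈ C d)
    (_ : ∀ d, ∀ c ∈ C d, ∃ b ∈ B d, p b = c)
    (_ : ∀ d, ∀ b ∈ B d, p b = 0 → ∃ a ∈ A d, f a = b)
    (_ : ∀ d, ∀ a ∈ A d, f a = 0 → a = 0)
    (_ : ∀ d, ∀ a ∈ A d, p (f a) = 0)
    (_ : GS (K := K) (σ := σ) B)
    (_ : Sh (K := K) (σ := σ) N S MA A) (_ : Sh (K := K) (σ := σ) N S MC C),
    Sh (K := K) (σ := σ) N S MB B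
  | 0, _, _, _, _, _, _, _, _, _, _, _, _, _, _, _, _, _, _, _, _, _, _, _, _ => trivial
  | N + 1, S, MA, MB, MC, _, _, _, _, _, _, A, B, C, f, p, hf, hp, hpo, hex, hinj, hpf, hB, hA, hC => by
    obtain ⟨ι, i1, i2, g, ε, h1, h2, h3⟩ := hA
    obtain ⟨κ, j1, j2, h, η, k1, k2, k3⟩ := hC
    choose b hb hb' using fun k => hpo _ _ (k1.mem (single_mem_Fr (K := K) (σ := σ) h k))
    have hlam : ∀ d v, v ∈ Fr (K := K) (σ := σ) h d → mk b v ∈ B d := fun d v hv =>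
      map_mem (mk b) hB (fun k => by rw [mk_single]; exact hb k) hv
    have hplam : ∀ v, p (mk b v) = η v := fun v => by
      have : p ∘ₗ (mk b) = η := lin_ext fun k => by simp [mk_single, hb']
      rw [← this]; rfl
    let ε' : (ι ⊕ κ → MvPolynomial σ K) →ₗ[MvPolynomial σ K] MB :=
      f ∘ₗ ε ∘ₗ LinearMap.funLeft _ _ Sum.inl + mk b ∘ₗ LinearMap.funLeft _ _ Sum.inr
    have hε' : ∀ v w, ε' (Sum.elim v w) = f (ε v) + mk b w := fun v w => rfl
    have hFr : ∀ d v w, Sum.elim v w ∈ Fr (K := K) (σ := σ) (Sum.elim g h) d ↔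
        v ∈ Fr g d ∧ w ∈ Fr h d := by
      intro d v w
      simp only [mem_Fr, Sum.forall, Sum.elim_inl, Sum.elim_inr]
    have hel : ∀ u : ι ⊕ κ → MvPolynomial σ K, ∃ v w, u = Sum.elim v w := fun u =>
      ⟨u ∘ Sum.inl, u ∘ Sum.inr, (Sum.elim_comp_inl_inr u).symm⟩
    refine ⟨ι ⊕ κ, inferInstance, inferInstance, Sum.elim g h, ε', ?_, ?_, ?_⟩
    · intro d
      ext x
      constructor
      · rintro ⟨u, hu, rfl⟩
        obtain ⟨v, w, rfl⟩ := hel u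
        obtain ⟨hv, hw⟩ := (hFr _ _ _).1 hu
        rw [hε']
        exact hB.add _ _ _ (hf _ _ (h1.mem hv)) (hlam _ _ hw)
      · intro hx
        obtain ⟨w, hw, hw'⟩ := k1.exists (hp _ _ hx)
        obtain ⟨a, ha, ha'⟩ := hex d (x + -(mk b w)) (hB.add _ _ _ hx (hB.neg (hlam _ _ hw)))
          (by rw [map_add, map_neg, hplam, hw', add_neg_cancel])
        obtain ⟨v, hv, rfl⟩ := h1.exists ha
        refine ⟨Sum.elim v w, (hFr _ _ _).2 ⟨hv, hw⟩, ?_⟩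
        rw [hε', ha', neg_add_cancel_right]
    · rintro (k | k)
      · exact h2 k
      · exact k2 k
    · let inj : (ι → MvPolynomial σ K) →ₗ[MvPolynomial σ K] (ι ⊕ κ → MvPolynomial σ K) :=
        { toFun := fun v => Sum.elim v 0
          map_add' := fun v w => by ext (k | k) <;> simp
          map_smul' := fun c v => by ext (k | k) <;> simp }
      have hinj' : ∀ v, inj v = Sum.elim v 0 := fun v => rfl
      refine horseshoe N _ _ _ _ (Kr g ε) _ (Kr h η) inj (LinearMap.funLeft _ _ Sum.inr)
        ?_ ?_ ?_ ?_ ?_ ?_ (GS_Kr _ _) h3 k3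
      · rintro d a ⟨ha, ha'⟩
        refine ⟨(hFr _ _ _).2 ⟨ha, Submodule.zero_mem _⟩, ?_⟩
        rw [hinj', hε', ha', map_zero, map_zero, add_zero]
      · rintro d u ⟨hu, hu'⟩
        obtain ⟨v, w, rfl⟩ := hel u
        obtain ⟨hv, hw⟩ := (hFr _ _ _).1 hu
        refine ⟨hw, ?_⟩
        rw [hε'] at hu'
        have := congrArg p hu'
        rw [map_add, hpf _ _ (h1.mem hv), zero_add, map_zero, hplam] at this
        exact this
      · rintro d w ⟨hw, hw'⟩
        obtain ⟨a, ha, ha'⟩ := hex d (mk b w) (hlam _ _ hw) (by rw [hplam, hw'])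
        obtain ⟨v, hv, rfl⟩ := h1.exists ha
        refine ⟨Sum.elim (-v) w, ⟨(hFr _ _ _).2 ⟨Submodule.neg_mem _ hv, hw⟩, ?_⟩, rfl⟩
        rw [hε', map_neg, map_neg, ha', neg_add_cancel]
      · rintro d u ⟨hu, hu'⟩ hu0
        obtain ⟨v, w, rfl⟩ := hel u
        obtain ⟨hv, hw⟩ := (hFr _ _ _).1 hu
        have hw0 : w = 0 := hu0
        subst hw0
        rw [hε', map_zero, add_zero] at hu'
        exact ⟨v, ⟨hv, hinj _ _ (h1.mem hv) hu'⟩, rfl⟩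
      · rintro d a ha ha0
        rw [hinj'] at ha0
        ext1 k
        exact congrFun ha0 (Sum.inl k)
      · rintro d a ha
        rfl

lemma cone (N : ℕ) (S : ℕ → ℕ → Prop) (M : Type) [AddCommGroup M] [Module (MvPolynomial σ K) M]
    (A B : ℕ → Set M) (e : ℕ) (γ : MvPolynomial σ K →ₗ[MvPolynomial σ K] M)
    (hAB : ∀ d, A d ⊆ B d) (hB : GS (K := K) (σ := σ) B) (hγ : γ 1 ∈ B e)
    (hsum : ∀ d, ∀ x ∈ B d, ∃ a ∈ A d, ∃ q ∈ Hs (K := K) (σ := σ) e d, x = a + γ q)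
    (hA : Sh (K := K) (σ := σ) (N + 1) S M A) (he : S 0 e)
    (hZ : Sh (K := K) (σ := σ) N (fun i => S (i + 1)) (MvPolynomial σ K)
      (fun d => {q | q ∈ Hs (K := K) (σ := σ) e d ∧ γ q ∈ A d})) :
    Sh (K := K) (σ := σ) (N + 1) S M B := by
  obtain ⟨ι, i1, i2, g, ε, h1, h2, h3⟩ := hA
  have hγ' : ∀ d q, q ∈ Hs (K := K) (σ := σ) e d → γ q ∈ B d := fun d q hq => by
    have := hB.smul _ _ _ _ hq hγ
    rwa [← map_smul, smul_eq_mul, mul_one] at this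
  let ε' : (ι ⊕ Unit → MvPolynomial σ K) →ₗ[MvPolynomial σ K] M :=
    ε ∘ₗ LinearMap.funLeft _ _ Sum.inl + γ ∘ₗ LinearMap.proj (Sum.inr ())
  have hε' : ∀ v w, ε' (Sum.elim v fun _ => w) = ε v + γ w := fun v w => rfl
  have hFr : ∀ d v w, (Sum.elim v fun _ => w) ∈ Fr (K := K) (σ := σ)
      (Sum.elim g fun _ : Unit => e) d ↔ v ∈ Fr g d ∧ w ∈ Hs e d := by
    intro d v w
    simp only [mem_Fr, Sum.forall, Sum.elim_inl, Sum.elim_inr]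
    simp
  have hel : ∀ u : ι ⊕ Unit → MvPolynomial σ K, ∃ v w, u = Sum.elim v fun _ => w := fun u =>
    ⟨u ∘ Sum.inl, u (Sum.inr ()), (Sum.elim_comp_inl_inr u).symm⟩
  refine ⟨ι ⊕ Unit, inferInstance, inferInstance, Sum.elim g fun _ => e, ε', ?_, ?_, ?_⟩
  · intro d
    ext x
    constructor
    · rintro ⟨u, hu, rfl⟩
      obtain ⟨v, w, rfl⟩ := hel u
      obtain ⟨hv, hw⟩ := (hFr _ _ _).1 hu
      rw [hε']
      exact hB.add _ _ _ (hAB _ (h1.mem hv)) (hγ' _ _ hw)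
    · intro hx
      obtain ⟨a, ha, q, hq, rfl⟩ := hsum d x hx
      obtain ⟨v, hv, rfl⟩ := h1.exists ha
      exact ⟨Sum.elim v fun _ => q, (hFr _ _ _).2 ⟨hv, hq⟩, hε' _ _⟩
  · rintro (k | k)
    · exact h2 k
    · exact he
  · let inj : (ι → MvPolynomial σ K) →ₗ[MvPolynomial σ K] (ι ⊕ Unit → MvPolynomial σ K) :=
      { toFun := fun v => Sum.elim v fun _ => 0
        map_add' := fun v w => by ext (k | k) <;> simp
        map_smul' := fun c v => by ext (k | k) <;> simp }
    have hinj' : ∀ v, inj v = Sum.elim v fun _ => 0 := fun v => rfl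
    refine horseshoe N _ _ _ _ (Kr g ε) _ _ inj (LinearMap.proj (Sum.inr ()))
      ?_ ?_ ?_ ?_ ?_ ?_ (GS_Kr _ _) h3 hZ
    · rintro d a ⟨ha, ha'⟩
      refine ⟨(hFr _ _ _).2 ⟨ha, Submodule.zero_mem _⟩, ?_⟩
      rw [hinj', hε', ha', map_zero, add_zero]
    · rintro d u ⟨hu, hu'⟩
      obtain ⟨v, w, rfl⟩ := hel u
      obtain ⟨hv, hw⟩ := (hFr _ _ _).1 hu
      refine ⟨hw, ?_⟩
      rw [hε'] at hu'
      have : γ w = ε (-v) := by rw [map_neg]; exact eq_neg_of_add_eq_zero_right hu'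
      change γ w ∈ A d
      rw [this]
      exact h1.mem (Submodule.neg_mem _ hv)
    · rintro d w ⟨hw, hw'⟩
      obtain ⟨v, hv, hv'⟩ := h1.exists hw'
      refine ⟨Sum.elim (-v) fun _ => w, ⟨(hFr _ _ _).2 ⟨Submodule.neg_mem _ hv, hw⟩, ?_⟩, rfl⟩
      rw [hε', map_neg, hv', neg_add_cancel]
    · rintro d u ⟨hu, hu'⟩ hu0
      obtain ⟨v, w, rfl⟩ := hel u
      obtain ⟨hv, hw⟩ := (hFr _ _ _).1 hu
      have hw0 : w = 0 := hu0
      subst hw0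
      rw [hε', map_zero, add_zero] at hu'
      exact ⟨v, ⟨hv, hu'⟩, rfl⟩
    · rintro d a ha ha0
      rw [hinj'] at ha0
      ext1 k
      exact congrFun ha0 (Sum.inl k)
    · rintro d a ha
      rfl

/-- Key step of the comparison. -/
lemma compare_step {ι κ M M' : Type} [Fintype ι] [DecidableEq ι] [Fintype κ] [DecidableEq κ]
    [AddCommGroup M] [Module (MvPolynomial σ K) M] [AddCommGroup M'] [Module (MvPolynomial σ K) M']
    {g : ι → ℕ} {h : κ → ℕ} {ε : (ι → MvPolynomial σ K) →ₗ[MvPolynomial σ K] M}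
    {η : (κ → MvPolynomial σ K) →ₗ[MvPolynomial σ K] M'} {B : ℕ → Set M} {B' : ℕ → Set M'}
    (hε : Pres g ε B) (hη : Pres h η B')
    (hmin : ∀ d, ∀ v ∈ Kr g ε d, ∀ l, g l = d → v l = 0)
    (s : M →ₗ[MvPolynomial σ K] M') (p : M' →ₗ[MvPolynomial σ K] M)
    (hs : ∀ d, ∀ m ∈ B d, s m ∈ B' d) (hp : ∀ d, ∀ m ∈ B' d, p m ∈ B d)
    (hps : ∀ d, ∀ m ∈ B d, p (s m) = m) :
    (∀ k, ∃ l, h l = g k) ∧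
    ∃ (s' : (ι → MvPolynomial σ K) →ₗ[MvPolynomial σ K] (κ → MvPolynomial σ K))
      (p' : (κ → MvPolynomial σ K) →ₗ[MvPolynomial σ K] (ι → MvPolynomial σ K)),
      (∀ d, ∀ m ∈ Kr g ε d, s' m ∈ Kr h η d) ∧ (∀ d, ∀ m ∈ Kr h η d, p' m ∈ Kr g ε d) ∧
      (∀ d, ∀ m ∈ Kr g ε d, p' (s' m) = m) := by
  obtain ⟨ψ, hψ, hψ'⟩ := lift (g := g) hη (s ∘ₗ ε)
    (fun k => hs _ _ (hε.mem (single_mem_Fr g k)))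
  obtain ⟨χ, hχ, hχ'⟩ := lift (g := h) hε (p ∘ₗ η)
    (fun k => hp _ _ (hη.mem (single_mem_Fr h k)))
  let x : Module.End (MvPolynomial σ K) (ι → MvPolynomial σ K) := 1 - χ ∘ₗ ψ
  have hx : ∀ v, x v = v - χ (ψ v) := fun v => rfl
  have hxFr : ∀ d v, v ∈ Fr g d → x v ∈ Fr g d := fun d v hv => by
    rw [hx]; exact Submodule.sub_mem _ hv (hχ _ _ (hψ _ _ hv))
  have hεx : ∀ v, ε (x v) = 0 := by
    intro v
    have : ε ∘ₗ x = 0 := lin_ext fun k => by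
      have h0 := hε.mem (single_mem_Fr (K := K) (σ := σ) g k)
      simp only [LinearMap.comp_apply, hx, map_sub, hχ', hψ', LinearMap.zero_apply, hps _ _ h0,
        sub_self]
    exact congrArg (fun t => t v) this
  have hx0 : ∀ k l, x (Pi.single k 1) l ≠ 0 → g l < g k := by
    intro k l hne
    have h1 := hxFr _ _ (single_mem_Fr (K := K) (σ := σ) g k)
    have h2 := Hs_le (h1 l) hne
    rcases h2.lt_or_eq with h3 | h3
    · exact h3
    · exact absurd (hmin _ _ ⟨h1, hεx _⟩ l h3) hne
  refine ⟨?_, ?_⟩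
  · intro k
    by_contra hcon
    push Not at hcon
    have h1 : x (Pi.single k 1) k = 0 := by
      by_contra hne; exact lt_irrefl _ (hx0 k k hne)
    rw [hx, Pi.sub_apply, Pi.single_eq_same, lin_apply χ, Finset.sum_apply] at h1
    rw [Finset.sum_eq_zero, sub_zero] at h1
    · exact one_ne_zero h1
    · intro l _
      rw [Pi.smul_apply, smul_eq_mul]
      by_contra hne
      have e1 := Hs_le (hψ _ _ (single_mem_Fr g k) l) (left_ne_zero_of_mul hne)
      have e2 := Hs_le (hχ _ _ (single_mem_Fr h l) k) (right_ne_zero_of_mul hne)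
      exact hcon l (le_antisymm e1 e2)
  · obtain ⟨c, hc⟩ : ∃ c, ∀ l, g l < c := ⟨Finset.univ.sup g + 1, fun l =>
      Nat.lt_succ_of_le (Finset.le_sup (Finset.mem_univ l))⟩
    have hpow : ∀ i v l, (x ^ i) v l ≠ 0 → g l + i < c := by
      intro i
      induction i with
      | zero => intro v l _; exact hc l
      | succ i ih =>
        intro v l hne
        rw [pow_succ', Module.End.mul_apply, lin_apply, Finset.sum_apply] at hne
        obtain ⟨k, _, hk⟩ := Finset.exists_ne_zero_of_sum_ne_zero hne
        rw [Pi.smul_apply, smul_eq_mul] at hk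
        have e1 := ih v k (left_ne_zero_of_mul hk)
        have e2 := hx0 k l (right_ne_zero_of_mul hk)
        omega
    have hnil : x ^ c = 0 := by
      apply LinearMap.ext
      intro v
      funext l
      by_contra hne
      have := hpow c v l hne
      omega
    have hpowFr : ∀ i d v, v ∈ Fr g d → (x ^ i) v ∈ Fr g d := by
      intro i
      induction i with
      | zero => intro d v hv; exact hv
      | succ i ih => 
        intro d v hv
        rw [pow_succ', Module.End.mul_apply]; exact hxFr _ _ (ih _ _ hv)
    let θ : Module.End (MvPolynomial σ K) (ι → MvPolynomial σ K) := ∑ i ∈ Finset.range c, x ^ i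
    have hθ : ∀ v, θ v = ∑ i ∈ Finset.range c, (x ^ i) v := fun v => LinearMap.sum_apply _ _ _
    have hθx : θ * (1 - x) = 1 := by
      rw [geom_sum_mul_neg, hnil, sub_zero]
    refine ⟨ψ, θ ∘ₗ χ, ?_, ?_, ?_⟩
    · rintro d m ⟨h1, h2⟩
      refine ⟨hψ _ _ h1, ?_⟩
      rw [hψ', LinearMap.comp_apply, h2, map_zero]
    · rintro d m ⟨h1, h2⟩
      have h3 : ε (χ m) = 0 := by rw [hχ', LinearMap.comp_apply, h2, map_zero]
      refine ⟨?_, ?_⟩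
      · rw [LinearMap.comp_apply, hθ]
        exact Submodule.sum_mem _ fun i _ => hpowFr _ _ _ (hχ _ _ h1)
      · rw [LinearMap.comp_apply, hθ, map_sum]
        refine Finset.sum_eq_zero fun i _ => ?_
        cases i with
        | zero => exact h3
        | succ i => rw [pow_succ', Module.End.mul_apply]; exact hεx _
    · rintro d m ⟨h1, h2⟩
      have h3 : (θ * (1 - x)) m = m := by rw [hθx]; rfl
      have h4 : (1 - x) m = χ (ψ m) := by
        rw [LinearMap.sub_apply, hx]; simp
      rw [Module.End.mul_apply, h4] at h3
      exact h3

lemma compare (j : ℕ) : ∀ (q : ℕ) (S : ℕ → ℕ → Prop) (M M' : Type)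
    [AddCommGroup M] [Module (MvPolynomial σ K) M] [AddCommGroup M'] [Module (MvPolynomial σ K) M']
    (B : ℕ → Set M) (B' : ℕ → Set M')
    (s : M →ₗ[MvPolynomial σ K] M') (p : M' →ₗ[MvPolynomial σ K] M)
    (_ : ∀ d, ∀ m ∈ B d, s m ∈ B' d) (_ : ∀ d, ∀ m ∈ B' d, p m ∈ B d)
    (_ : ∀ d, ∀ m ∈ B d, p (s m) = m)
    (_ : MS (K := K) (σ := σ) j q M B) (_ : Sh (K := K) (σ := σ) (q + 1) S M' B'), S q j
  | 0, S, M, M', _, _, _, _, B, B', s, p, hs, hp, hps, hB, hB' => by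
    obtain ⟨ι, i1, i2, g, ε, h1, h2, k, hk⟩ := hB
    obtain ⟨κ, j1, j2, h, η, k1, k2, k3⟩ := hB'
    obtain ⟨hl, _⟩ := compare_step h1 k1 h2 s p hs hp hps
    obtain ⟨l, hl⟩ := hl k
    rw [← hk, ← hl]
    exact k2 l
  | q + 1, S, M, M', _, _, _, _, B, B', s, p, hs, hp, hps, hB, hB' => by
    obtain ⟨ι, i1, i2, g, ε, h1, h2, h3⟩ := hB
    obtain ⟨κ, j1, j2, h, η, k1, k2, k3⟩ := hB'
    obtain ⟨_, s', p', e1, e2, e3⟩ := compare_step h1 k1 h2 s p hs hp hps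
    exact compare j q (fun i => S (i + 1)) _ _ _ _ s' p' e1 e2 e3 h3 k3

/-- degree part of an ideal shifted by `e` -/
def Id (J : Ideal (MvPolynomial σ K)) (e d : ℕ) : Set (MvPolynomial σ K) :=
  {h | h ∈ J ∧ h ∈ Hs e d}

lemma GS_Id (J : Ideal (MvPolynomial σ K)) (e : ℕ) : GS (K := K) (σ := σ) (Id J e) where
  zero := fun d => ⟨J.zero_mem, Submodule.zero_mem _⟩
  add := fun d x y hx hy => ⟨J.add_mem hx.1 hy.1, Submodule.add_mem _ hx.2 hy.2⟩
  smul := fun e d c x hc hx => ⟨J.mul_mem_left c hx.1, Hs_mul hc hx.2⟩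

/-- monomial ideal -/
noncomputable def mI (K : Type) [Field K] {σ : Type} (s : Set (σ →₀ ℕ)) : Ideal (MvPolynomial σ K) :=
  Ideal.span ((fun c => monomial c (1 : K)) '' s)

lemma mem_mI {s : Set (σ →₀ ℕ)} {x : MvPolynomial σ K} :
    x ∈ mI K s ↔ ∀ c, coeff c x ≠ 0 → ∃ b ∈ s, b ≤ c := by
  unfold mI
  rw [mem_ideal_span_monomial_image]
  simp only [mem_support_iff]

lemma cmp_mem_mI {s : Set (σ →₀ ℕ)} {x : MvPolynomial σ K} (hx : x ∈ mI K s) (e d : ℕ) :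
    cmp e d x ∈ mI K s := by
  rw [mem_mI] at hx ⊢
  intro c hc
  apply hx
  intro h
  apply hc
  rw [coeff_cmp, h, ite_self]

lemma Sh_bot : ∀ (N : ℕ) (S : ℕ → ℕ → Prop) (M : Type) [AddCommGroup M]
    [Module (MvPolynomial σ K) M] (B : ℕ → Set M) (_ : ∀ d, B d = {0}),
    Sh (K := K) (σ := σ) N S M B
  | 0, _, _, _, _, _, _ => trivial
  | N + 1, S, M, _, _, B, h => by
    refine ⟨Empty, inferInstance, inferInstance, Empty.elim, 0, ?_, fun k => k.elim,
      Sh_bot N _ _ _ ?_⟩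
    · intro d
      rw [h]
      ext x
      constructor
      · rintro ⟨u, _, rfl⟩; simp
      · rintro rfl
        exact ⟨0, Submodule.zero_mem _, rfl⟩
    · intro d
      ext x
      constructor
      · intro _; exact Subsingleton.elim _ _
      · rintro rfl; exact (GS_Kr _ _).zero d

lemma Sh_Id_empty (N : ℕ) (S : ℕ → ℕ → Prop) (e : ℕ) (J : Ideal (MvPolynomial σ K)) (hJ : J = ⊥) :
    Sh (K := K) (σ := σ) N S (MvPolynomial σ K) (Id J e) := by
  apply Sh_bot
  intro d
  ext x
  constructor
  · rintro ⟨hx, _⟩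
    rw [hJ] at hx
    simpa using hx
  · rintro rfl; exact (GS_Id _ _).zero d

lemma coneI (N : ℕ) (S : ℕ → ℕ → Prop) (s : Set (σ →₀ ℕ)) (f : σ →₀ ℕ) (e : ℕ)
    (L : Ideal (MvPolynomial σ K)) (hL : ∀ q, q ∈ L ↔ q * monomial f (1 : K) ∈ mI K s)
    (hA : Sh (K := K) (σ := σ) (N + 1) S _ (Id (mI K s) e)) (he : S 0 (f.degree + e))
    (hZ : Sh (K := K) (σ := σ) N (fun i => S (i + 1)) _ (Id L (f.degree + e))) :
    Sh (K := K) (σ := σ) (N + 1) S _ (Id (mI K (insert f s)) e) := by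
  have hf := monomial_mem_Hs (K := K) e f 1
  have hle : mI K s ≤ mI K (insert f s) := Ideal.span_mono (Set.image_mono (Set.subset_insert _ _))
  have hfm : monomial f (1 : K) ∈ mI K (insert f s) :=
    Ideal.subset_span ⟨f, Set.mem_insert _ _, rfl⟩
  refine cone N S _ (Id (mI K s) e) _ (f.degree + e)
    (LinearMap.toSpanSingleton (MvPolynomial σ K) _ (monomial f (1 : K)))
    (fun d x hx => ⟨hle hx.1, hx.2⟩) (GS_Id _ _) ?_ ?_ hA he ?_
  · rw [LinearMap.toSpanSingleton_apply, one_smul]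
    exact ⟨hfm, hf⟩
  · rintro d x ⟨hx, hx'⟩
    unfold mI at hx
    rw [Set.image_insert_eq, Ideal.mem_span_insert] at hx
    obtain ⟨a, z, hz, rfl⟩ := hx
    refine ⟨cmp e d z, ⟨cmp_mem_mI hz _ _, cmp_mem _ _ _⟩, cmp (f.degree + e) d a, cmp_mem _ _ _, ?_⟩
    conv_lhs => rw [← cmp_of_mem hx']
    rw [map_add, cmp_mul hf, LinearMap.toSpanSingleton_apply, smul_eq_mul, add_comm]
  · convert hZ using 1
    funext d
    ext q
    simp only [Id, Set.mem_ofPred_eq, LinearMap.toSpanSingleton_apply, smul_eq_mul, hL]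
    constructor
    · rintro ⟨h1, h2, _⟩; exact ⟨h2, h1⟩
    · rintro ⟨h1, h2⟩; exact ⟨h2, h1, Hs_mul h2 hf⟩

lemma mul_monomial_mem_mI {s : Set (σ →₀ ℕ)} {f : σ →₀ ℕ} {q : MvPolynomial σ K} :
    q * monomial f (1 : K) ∈ mI K s ↔ ∀ c, coeff c q ≠ 0 → ∃ b ∈ s, b ≤ c + f := by
  classical
  rw [mem_mI]
  constructor
  · intro h c hc
    apply h
    rwa [coeff_mul_monomial, mul_one]
  · intro h c hc
    rw [coeff_mul_monomial'] at hc
    by_cases hfc : f ≤ c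
    · rw [if_pos hfc, mul_one] at hc
      obtain ⟨b, hb, hb'⟩ := h _ hc
      rw [tsub_add_cancel_of_le hfc] at hb'
      exact ⟨b, hb, hb'⟩
    · rw [if_neg hfc] at hc; exact absurd rfl hc

lemma Sh_regseq {τ : Type} [DecidableEq τ] (α : τ → (σ →₀ ℕ)) (hne : ∀ t, (α t).support.Nonempty)
    (hdis : ∀ s t, s ≠ t → Disjoint (α s).support (α t).support) (u : Finset τ) :
    ∀ (N e : ℕ), Sh (K := K) (σ := σ) N
      (fun i j => i + 1 ≤ u.card ∧ j ≤ e + (i + 1) + ∑ t ∈ u, ((α t).degree - 1)) _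
      (Id (mI K (α '' (u : Set τ))) e) := by
  induction u using Finset.induction_on with
  | empty =>
    intro N e
    apply Sh_Id_empty
    simp [mI]
  | insert t u ht ih =>
    intro N e
    have hpos : 1 ≤ (α t).degree := by
      rw [Nat.one_le_iff_ne_zero, Ne, Finsupp.degree_eq_zero_iff]
      intro h0
      have := hne t
      simp [h0] at this
    cases N with
    | zero => trivial
    | succ N =>
      rw [Finset.coe_insert, Set.image_insert_eq, Finset.sum_insert ht, Finset.card_insert_of_notMem ht]
      refine coneI N _ _ _ _ (mI K (α '' (u : Set τ))) ?_ ?_ ?_ ?_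
      · intro q
        rw [mul_monomial_mem_mI, mem_mI]
        refine forall₂_congr fun c _ => ?_
        constructor
        · rintro ⟨b, hb, hbc⟩
          exact ⟨b, hb, hbc.trans (by simp)⟩
        · rintro ⟨b, ⟨t', ht', rfl⟩, hbc⟩
          refine ⟨_, ⟨t', ht', rfl⟩, fun x => ?_⟩
          have hne' : t' ≠ t := fun h => ht (h ▸ ht')
          have h1 := hbc x
          by_cases hx : x ∈ (α t').support
          · have := Finset.disjoint_left.1 (hdis _ _ hne') hx
            rw [Finsupp.notMem_support_iff] at this
            simpa [this] using h1
          · rw [Finsupp.notMem_support_iff] at hx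
            omega
      · refine Sh_mono _ _ _ ?_ _ _ (ih (N + 1) e)
        rintro i j ⟨h1, h2⟩
        constructor <;> omega
      · constructor <;> omega
      · refine Sh_mono _ _ _ ?_ _ _ (ih N ((α t).degree + e))
        rintro i j ⟨h1, h2⟩
        constructor <;> omega

/-- graded component in a free module -/
noncomputable def cF {ι : Type} (g : ι → ℕ) (d : ℕ) (v : ι → MvPolynomial σ K) :
    ι → MvPolynomial σ K := fun k => cmp (g k) d (v k)

lemma cF_mem {ι : Type} (g : ι → ℕ) (d : ℕ) (v : ι → MvPolynomial σ K) : cF g d v ∈ Fr g d :=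
  fun _ => cmp_mem _ _ _

lemma map_cF {ι : Type} [Fintype ι] [DecidableEq ι] {g : ι → ℕ} {b : ℕ}
    (φ : (ι → MvPolynomial σ K) →ₗ[MvPolynomial σ K] MvPolynomial σ K)
    (hφ : ∀ k, φ (Pi.single k 1) ∈ Hs b (g k)) (d : ℕ) (v) :
    φ (cF g d v) = cmp b d (φ v) := by
  rw [lin_apply, lin_apply φ v, map_sum]
  refine Finset.sum_congr rfl fun k _ => ?_
  rw [smul_eq_mul, smul_eq_mul, cmp_mul (hφ k)]
  rfl

lemma map_cF' {ι κ : Type} [Fintype ι] [DecidableEq ι] {g : ι → ℕ} {h : κ → ℕ}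
    (φ : (ι → MvPolynomial σ K) →ₗ[MvPolynomial σ K] (κ → MvPolynomial σ K))
    (hφ : ∀ k, φ (Pi.single k 1) ∈ Fr h (g k)) (d : ℕ) (v) :
    φ (cF g d v) = cF h d (φ v) := by
  funext l
  exact map_cF (LinearMap.proj l ∘ₗ φ) (fun k => hφ k l) d v

lemma cF_of_mem {ι : Type} {g : ι → ℕ} {d : ℕ} {v : ι → MvPolynomial σ K} (hv : v ∈ Fr g d) :
    cF g d v = v := funext fun k => cmp_of_mem (hv k)

lemma pres_of_exact {ι κ M : Type} [Fintype ι] [DecidableEq ι] [AddCommGroup M]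
    [Module (MvPolynomial σ K) M] {g : ι → ℕ} {h : κ → ℕ}
    (φ : (ι → MvPolynomial σ K) →ₗ[MvPolynomial σ K] (κ → MvPolynomial σ K))
    (hφ : ∀ k, φ (Pi.single k 1) ∈ Fr h (g k))
    (ε : (κ → MvPolynomial σ K) →ₗ[MvPolynomial σ K] M)
    (hex : LinearMap.range φ = LinearMap.ker ε) : Pres g φ (Kr h ε) := by
  intro d
  ext x
  constructor
  · rintro ⟨v, hv, rfl⟩
    refine ⟨map_mem φ (GS_Fr h) hφ hv, ?_⟩
    have : φ v ∈ LinearMap.ker ε := hex ▸ LinearMap.mem_range_self φ v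
    exact this
  · rintro ⟨hx, hx'⟩
    have : x ∈ LinearMap.range φ := by rw [hex]; exact hx'
    obtain ⟨v, rfl⟩ := this
    exact ⟨cF g d v, cF_mem _ _ _, by rw [map_cF' φ hφ, cF_of_mem hx]⟩

lemma res_Fr (res : MinFreeResData K σ) (i : ℕ) (k) :
    res.d i (Pi.single k 1) ∈ Fr (res.g i) (res.g (i + 1) k) := by
  intro l
  have := res.hdeg i k l
  split_ifs at this with h
  · rwa [mem_Hs_iff h.le]
  · rw [this]; exact Submodule.zero_mem _

lemma res_lt (res : MinFreeResData K σ) (i : ℕ) (k l) (h : res.d i (Pi.single k 1) l ≠ 0) :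
    res.g i l < res.g (i + 1) k := by
  by_contra h'
  have := res.hdeg i k l
  rw [if_neg h'] at this
  exact h this

lemma res_min (res : MinFreeResData K σ) (t : ℕ) {M : Type} [AddCommGroup M]
    [Module (MvPolynomial σ K) M]
    (ε : (Fin (res.N t) → MvPolynomial σ K) →ₗ[MvPolynomial σ K] M)
    (hε : LinearMap.range (res.d t) = LinearMap.ker ε) :
    ∀ d, ∀ v ∈ Kr (res.g t) ε d, ∀ l, res.g t l = d → v l = 0 := by
  intro d v hv l hl
  obtain ⟨w, hw, rfl⟩ := (pres_of_exact (res.d t) (res_Fr res t) ε hε).exists hv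
  rw [lin_apply, Finset.sum_apply]
  refine Finset.sum_eq_zero fun k _ => ?_
  rw [Pi.smul_apply, smul_eq_mul]
  by_contra hne
  have h1 := Hs_le (hw k) (left_ne_zero_of_mul hne)
  have h2 := res_lt res t k l (right_ne_zero_of_mul hne)
  omega

lemma MS_res (res : MinFreeResData K σ) (j : ℕ) : ∀ (q t : ℕ) (M : Type) [AddCommGroup M]
    [Module (MvPolynomial σ K) M]
    (ε : (Fin (res.N t) → MvPolynomial σ K) →ₗ[MvPolynomial σ K] M)
    (_ : LinearMap.range (res.d t) = LinearMap.ker ε) (_ : ∃ k, res.g (t + q + 1) k = j),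
    MS (K := K) (σ := σ) j q _ (Kr (res.g t) ε)
  | 0, t, M, _, _, ε, hε, hk => ⟨_, inferInstance, inferInstance, res.g (t + 1), res.d t,
      pres_of_exact (res.d t) (res_Fr res t) ε hε, res_min res (t + 1) _ (res.hexact t), hk⟩
  | q + 1, t, M, _, _, ε, hε, hk => ⟨_, inferInstance, inferInstance, res.g (t + 1), res.d t,
      pres_of_exact (res.d t) (res_Fr res t) ε hε, res_min res (t + 1) _ (res.hexact t),
      MS_res res j q (t + 1) _ (res.d t) (res.hexact t)
        (by rwa [show t + 1 + q + 1 = t + (q + 1) + 1 by omega])⟩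

lemma res_eps {I : Ideal (MvPolynomial σ K)} (res : MinFreeResOfIdeal I) (k) :
    res.ε (Pi.single k 1) ∈ Hs 0 (res.g 0 k) := by
  rw [mem_Hs_iff (Nat.zero_le _)]
  exact res.hεdeg k

lemma res_pres {I : Ideal (MvPolynomial σ K)} (res : MinFreeResOfIdeal I) :
    Pres (res.g 0) res.ε (Id I 0) := by
  intro d
  ext x
  constructor
  · rintro ⟨v, hv, rfl⟩
    have h0 : ∀ v, res.ε v ∈ I := fun v => by
      have := LinearMap.mem_range_self res.ε v
      rwa [res.hrange] at this
    exact map_mem res.ε (GS_Id I 0) (fun k => ⟨h0 _, res_eps res k⟩) hv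
  · rintro ⟨hx, hx'⟩
    rw [← res.hrange] at hx
    obtain ⟨v, rfl⟩ := hx
    exact ⟨cF _ d v, cF_mem _ _ _, by rw [map_cF res.ε (res_eps res), cmp_of_mem hx']⟩

lemma betti_shape {I : Ideal (MvPolynomial σ K)} (res : MinFreeResOfIdeal I) (S : ℕ → ℕ → Prop)
    (hS : ∀ N, Sh (K := K) (σ := σ) N S _ (Id I 0)) (q : ℕ) (k : Fin (res.N q)) :
    S q (res.g q k) := by
  refine compare (res.g q k) q S _ _ (Id I 0) (Id I 0) LinearMap.id LinearMap.id
    (fun d m hm => hm) (fun d m hm => hm) (fun d m hm => rfl) ?_ (hS (q + 1))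
  cases q with
  | zero => exact ⟨_, inferInstance, inferInstance, res.g 0, res.ε, res_pres res,
      res_min _ 0 _ res.hker.symm, k, rfl⟩
  | succ q =>
    refine ⟨_, inferInstance, inferInstance, res.g 0, res.ε, res_pres res,
      res_min _ 0 _ res.hker.symm, MS_res _ _ q 0 _ res.ε res.hker.symm ?_⟩
    have e : q + 1 = 0 + q + 1 := by omega
    rw [← e]
    exact ⟨k, rfl⟩

lemma finrank_homog (n d : ℕ) :
    Module.finrank K (homogeneousSubmodule (Fin n) K d) = (n + d - 1).choose d := by
  classical
  rw [homogeneousSubmodule_eq_finsupp_supported,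
    (AddMonoidAlgebra.supportedEquivFinsupp _).finrank_eq]
  have hset : {c : Fin n →₀ ℕ | c.degree = d} =
      ((Finset.univ : Finset (Fin n)).finsuppAntidiag d : Set (Fin n →₀ ℕ)) := by
    ext c
    simp [Finsupp.degree_eq_sum]
  rw [hset, Module.finrank_finsupp_self]
  simp [Finset.card_finsuppAntidiag_nat_eq_choose]

/-- Hilbert series of the polynomial ring -/
noncomputable def HR (K : Type) [Field K] (n : ℕ) : PowerSeries ℤ :=
  PowerSeries.mk fun d => (Module.finrank K (homogeneousSubmodule (Fin n) K d) : ℤ)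

lemma HR_mul (n : ℕ) : HR K n * (1 - PowerSeries.X) ^ n = 1 := by
  unfold HR
  simp only [finrank_homog]
  cases n with
  | zero =>
    rw [pow_zero, mul_one]
    ext d
    rw [PowerSeries.coeff_mk, PowerSeries.coeff_one]
    cases d with
    | zero => simp
    | succ d => simp
  | succ n =>
    refine Eq.trans ?_ (PowerSeries.mk_add_choose_mul_one_sub_pow_eq_one ℤ n)
    congr 2
    funext d
    rw [show n + 1 + d - 1 = n + d by omega, Nat.choose_symm_add]

lemma Hs_eq_homog {e d : ℕ} (h : e ≤ d) :
    Hs (K := K) (σ := σ) e d = homogeneousSubmodule σ K (d - e) := by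
  ext p; exact mem_Hs_iff h

lemma Hs_eq_bot' {e d : ℕ} (h : ¬ e ≤ d) : Hs (K := K) (σ := σ) e d = ⊥ := by
  rw [eq_bot_iff]; intro p hp
  exact Hs_eq_bot hp (by omega)

instance Hs_fin {n : ℕ} (e d : ℕ) : Module.Finite K (Hs (K := K) (σ := Fin n) e d) := by
  by_cases h : e ≤ d
  · rw [Hs_eq_homog h]
    exact Module.Finite.iff_fg.2 (homogeneousSubmodule_fg (Fin n) K (d - e))
  · rw [Hs_eq_bot' h]; infer_instance

lemma finrank_Hs {n : ℕ} (e d : ℕ) :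
    (Module.finrank K (Hs (K := K) (σ := Fin n) e d) : ℤ) =
      PowerSeries.coeff d (PowerSeries.X ^ e * HR K n) := by
  rw [PowerSeries.coeff_X_pow_mul']
  split_ifs with h
  · rw [Hs_eq_homog h, HR, PowerSeries.coeff_mk]
  · rw [Hs_eq_bot' h]; simp

/-- graded pieces of a free module as a product -/
def FrEquiv {ι : Type} (g : ι → ℕ) (d : ℕ) :
    Fr (K := K) (σ := σ) g d ≃ₗ[K] ((k : ι) → Hs (K := K) (σ := σ) (g k) d) where
  toFun v k := ⟨v.1 k, v.2 k⟩
  invFun w := ⟨fun k => (w k).1, fun k => (w k).2⟩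
  map_add' _ _ := rfl
  map_smul' _ _ := rfl
  left_inv _ := rfl
  right_inv _ := rfl

instance Fr_fin {n : ℕ} {ι : Type} [Fintype ι] (g : ι → ℕ) (d : ℕ) :
    Module.Finite K (Fr (K := K) (σ := Fin n) g d) :=
  Module.Finite.equiv (FrEquiv g d).symm

lemma finrank_Fr {n : ℕ} {ι : Type} [Fintype ι] (g : ι → ℕ) (d : ℕ) :
    (Module.finrank K (Fr (K := K) (σ := Fin n) g d) : ℤ) =
      PowerSeries.coeff d ((∑ k, PowerSeries.X ^ g k) * HR K n) := by
  rw [(FrEquiv g d).finrank_eq, Module.finrank_pi_fintype, Finset.sum_mul, map_sum]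
  push_cast
  exact Finset.sum_congr rfl fun k _ => finrank_Hs _ _

lemma rank_null {V W : Type} [AddCommGroup V] [Module K V] [AddCommGroup W] [Module K W]
    (f : V →ₗ[K] W) (U : Submodule K V) [Module.Finite K U] :
    Module.finrank K U = Module.finrank K (U.map f) + 
      Module.finrank K ↥(U ⊓ LinearMap.ker f) := by
  rw [← LinearMap.finrank_range_add_finrank_ker (f.domRestrict U)]
  congr 1
  · rw [LinearMap.range_domRestrict]
  · rw [LinearMap.ker_domRestrict]
    have := (Submodule.equivSubtypeMap U (LinearMap.ker f |>.submoduleOf U)).finrank_eq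
    rw [Submodule.submoduleOf, Submodule.map_comap_subtype] at this
    exact this

section hilb
variable {n : ℕ} {I : Ideal (MvPolynomial (Fin n) K)} (res : MinFreeResOfIdeal I)

/-- boundaries -/
noncomputable def bd (t d : ℕ) : Submodule K (Fin (res.N t) → MvPolynomial (Fin n) K) :=
  (Fr (res.g (t + 1)) d).map ((res.d t).restrictScalars K)

lemma bd_eq (t d : ℕ) {M : Type} [AddCommGroup M]
    [Module (MvPolynomial (Fin n) K) M] [Module K M] [IsScalarTower K (MvPolynomial (Fin n) K) M]
    (ε : (Fin (res.N t) → MvPolynomial (Fin n) K) →ₗ[MvPolynomial (Fin n) K] M)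
    (hε : LinearMap.range (res.d t) = LinearMap.ker ε) :
    Fr (res.g t) d ⊓ LinearMap.ker (ε.restrictScalars K) = bd res t d := by
  have := pres_of_exact (res.d t) (res_Fr res.toMinFreeResData t) ε hε d
  apply SetLike.coe_injective
  exact this.symm

lemma eps_eq (d : ℕ) : (Fr (res.g 0) d).map (res.ε.restrictScalars K) =
    Submodule.restrictScalars K I ⊓ homogeneousSubmodule (Fin n) K d := by
  have := res_pres res d
  apply SetLike.coe_injective
  refine Eq.trans this ?_
  ext x
  simp only [Id, mem_Hs_iff (Nat.zero_le _)]
  rfl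

/-- Hilbert series of boundaries -/
noncomputable def hb (t : ℕ) : PowerSeries ℤ :=
  PowerSeries.mk fun d => (Module.finrank K (bd res t d) : ℤ)

lemma hb_zero : hilbSeries I + hb res 0 = (∑ k, PowerSeries.X ^ res.g 0 k) * HR K n := by
  ext d
  rw [← finrank_Fr, map_add, hilbSeries, hb, PowerSeries.coeff_mk, PowerSeries.coeff_mk,
    rank_null (res.ε.restrictScalars K) (Fr (res.g 0) d), bd_eq res 0 d res.ε res.hker.symm, eps_eq]
  push_cast
  rfl

lemma hb_succ (t : ℕ) :
    hb res t + hb res (t + 1) = (∑ k, PowerSeries.X ^ res.g (t + 1) k) * HR K n := by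
  ext d
  rw [← finrank_Fr, map_add, hb, hb, PowerSeries.coeff_mk, PowerSeries.coeff_mk,
    rank_null ((res.d t).restrictScalars K) (Fr (res.g (t + 1)) d), bd_eq res (t + 1) d (res.d t) (res.hexact t)]
  push_cast
  rfl

lemma coeff_free {ι : Type} [Fintype ι] (g : ι → ℕ) (D : ℕ) (h : ∀ k, g k ≠ D) :
    PowerSeries.coeff D ((∑ k, PowerSeries.X ^ g k) * HR K n * (1 - PowerSeries.X) ^ n) = 0 := by
  rw [mul_assoc, HR_mul, mul_one, map_sum]
  refine Finset.sum_eq_zero fun k _ => ?_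
  rw [PowerSeries.coeff_X_pow, if_neg (Ne.symm (h k))]

lemma hilb_coeff (T D : ℕ) (hT : ∀ i, T ≤ i → res.N i = 0) (hD : ∀ i k, res.g i k ≠ D) :
    PowerSeries.coeff D (hilbSeries I * (1 - PowerSeries.X) ^ n) = 0 := by
  have key : ∀ m t, T ≤ t + m →
      PowerSeries.coeff D (hb res t * (1 - PowerSeries.X) ^ n) = 0 := by
    intro m
    induction m with
    | zero =>
      intro t ht
      have h0 : hb res t = 0 := by
        ext d
        rw [hb, PowerSeries.coeff_mk, map_zero]
        have : IsEmpty (Fin (res.N (t + 1))) := by rw [hT (t + 1) (by omega)]; infer_instance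
        have h1 : bd res t d = ⊥ := by
          rw [eq_bot_iff]
          rintro _ ⟨v, _, rfl⟩
          have : v = 0 := Subsingleton.elim _ _
          rw [this, map_zero]
          exact Submodule.zero_mem _
        rw [h1]; simp
      rw [h0, zero_mul, map_zero]
    | succ m ih =>
      intro t ht
      have h1 := coeff_free (K := K) (n := n) (res.g (t + 1)) D (hD (t + 1))
      rw [← hb_succ, add_mul, map_add, ih (t + 1) (by omega), add_zero] at h1
      exact h1
  have h1 := coeff_free (K := K) (n := n) (res.g 0) D (hD 0)
  rw [← hb_zero, add_mul, map_add, key T 0 (by omega), add_zero] at h1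
  exact h1

end hilb

lemma deg_mono {n : ℕ} (c : Fin n →₀ ℕ) : (monomial c (1 : K)).totalDegree = c.degree := by
  rw [totalDegree_monomial _ one_ne_zero, Finsupp.degree_apply]; rfl

lemma regseq_pos {n : ℕ} {L : Ideal (MvPolynomial (Fin n) K)} {r : ℕ} {a : Fin r → ℕ}
    (h : IsRegSeqSpan L r a) (t) : 1 ≤ a t := by
  obtain ⟨α, h1, h2, h3, h4⟩ := h
  rw [← h3, deg_mono, Nat.one_le_iff_ne_zero, Ne, Finsupp.degree_eq_zero_iff]
  intro h0
  have := h1 t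
  simp [h0] at this

lemma sum_sub_one {r : ℕ} {a : Fin r → ℕ} (h : ∀ t, 1 ≤ a t) :
    (∑ t, (a t - 1)) + r = ∑ t, a t := by
  have : ∑ t, a t = ∑ t, ((a t - 1) + 1) :=
    Finset.sum_congr rfl fun t _ => (Nat.sub_add_cancel (h t)).symm
  rw [this, Finset.sum_add_distrib]
  simp

lemma Sh_regspan {n : ℕ} {L : Ideal (MvPolynomial (Fin n) K)} {r : ℕ} {a : Fin r → ℕ}
    (h : IsRegSeqSpan L r a) (N e : ℕ) : Sh (K := K) (σ := Fin n) N
      (fun i j => i + 1 ≤ r ∧ j ≤ e + (i + 1) + ∑ t, (a t - 1)) _ (Id L e) := by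
  obtain ⟨α, h1, h2, h3, h4⟩ := h
  have := Sh_regseq (K := K) α h1 h2 Finset.univ N e
  have hL : L = mI K (α '' ((Finset.univ : Finset (Fin r)) : Set (Fin r))) := by
    rw [h4, mI, Finset.coe_univ, Set.image_univ, ← Set.range_comp]; rfl
  rw [← hL] at this
  refine Sh_mono _ _ _ ?_ _ _ this
  intro i j hij
  simp only [Finset.card_univ, Fintype.card_fin, ← deg_mono (K := K), h3] at hij
  exact hij

lemma shape_I {n m : ℕ} (f : Fin m → (Fin n →₀ ℕ)) (d r : Fin m → ℕ)
    (a : (k : Fin m) → Fin (r k) → ℕ)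
    (hd : ∀ k, (monomial (f k) (1 : K)).totalDegree = d k)
    (hcolon : ∀ k : Fin m, 0 < (k : ℕ) →
      IsRegSeqSpan
        ((Ideal.span ((fun l => monomial (f l) (1 : K)) '' {l : Fin m | (l : ℕ) < (k : ℕ)})).colon
          (Ideal.span {monomial (f k) (1 : K)}))
        (r k) (a k))
    (S : ℕ → ℕ → Prop) (h0 : ∀ k, S 0 (d k))
    (h1 : ∀ k : Fin m, 0 < (k : ℕ) → ∀ i j, i + 1 ≤ r k →
      j ≤ d k + (i + 1) + ∑ t, (a k t - 1) → S (i + 1) j) :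
    ∀ k ≤ m, ∀ N, Sh (K := K) (σ := Fin n) N S _ (Id (mI K (f '' {l : Fin m | (l : ℕ) < k})) 0) := by
  intro k
  induction k with
  | zero =>
    intro _ N
    apply Sh_Id_empty
    simp [mI]
  | succ k ih =>
    intro hk N
    cases N with
    | zero => trivial
    | succ N =>
      let k' : Fin m := ⟨k, hk⟩
      have hset : f '' {l : Fin m | (l : ℕ) < k + 1} =
          insert (f k') (f '' {l : Fin m | (l : ℕ) < k}) := by
        rw [← Set.image_insert_eq]
        congr 1
        ext l
        simp only [Set.mem_ofPred_eq, Set.mem_insert_iff, Fin.ext_iff, k']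
        omega
      have hdeg : (f k').degree + 0 = d k' := by rw [← hd, deg_mono, add_zero]
      rw [hset]
      rcases Nat.eq_zero_or_pos k with hk0 | hk0
      · have hemp : mI K (f '' {l : Fin m | (l : ℕ) < k}) = ⊥ := by simp [mI, hk0]
        refine coneI N S _ _ 0 ⊥ ?_ (ih (by omega) _) ?_ ?_
        · intro q
          rw [hemp, Ideal.mem_bot, Ideal.mem_bot, mul_eq_zero, monomial_eq_zero]
          simp
        · rw [hdeg]; exact h0 _
        · exact Sh_Id_empty _ _ _ _ rfl
      · have hc := hcolon k' hk0
        refine coneI N S _ _ 0 _ ?_ (ih (by omega) _) ?_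
          (Sh_mono _ _ _ ?_ _ _ (Sh_regspan hc N _))
        · intro q
          have e := Submodule.mem_colon_span_singleton
            (N := Ideal.span ((fun l => monomial (f l) (1 : K)) '' {l : Fin m | (l : ℕ) < (k' : ℕ)}))
            (x := monomial (f k') (1 : K)) (r := q)
          refine Iff.trans e ?_
          rw [smul_eq_mul, mI, Set.image_image]
        · rw [hdeg]; exact h0 _
        · rintro i j ⟨h2, h3⟩
          rw [hdeg] at h3
          exact h1 k' hk0 i j h2 h3

lemma d0_le {n m : ℕ} (f : Fin m → (Fin n →₀ ℕ)) (hm : 0 < m) (hm1 : 1 < m)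
    (hmin : ∀ k : Fin m, monomial (f k) (1 : K) ∉
      Ideal.span ((fun l => monomial (f l) (1 : K)) '' {l : Fin m | l ≠ k}))
    (r : ℕ) (a : Fin r → ℕ)
    (hcolon : IsRegSeqSpan
        ((Ideal.span ((fun l => monomial (f l) (1 : K)) '' {l : Fin m | (l : ℕ) < 1})).colon
          (Ideal.span {monomial (f ⟨1, hm1⟩) (1 : K)})) r a) :
    (f ⟨0, hm⟩).degree ≤ (f ⟨1, hm1⟩).degree + ∑ t, (a t - 1) := by
  set f0 := f ⟨0, hm⟩ with hf0
  set f1 := f ⟨1, hm1⟩ with hf1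
  have hset : {l : Fin m | (l : ℕ) < 1} = {⟨0, hm⟩} := by
    ext l; simp [Fin.ext_iff]
  have hspan : Ideal.span ((fun l => monomial (f l) (1 : K)) '' {l : Fin m | (l : ℕ) < 1}) =
      mI K {f0} := by
    rw [hset, mI]; simp [hf0]
  rw [hspan] at hcolon
  have hmem : ∀ q, q ∈ (mI K {f0}).colon (Ideal.span {monomial f1 (1 : K)}) ↔
      q * monomial f1 (1 : K) ∈ mI K {f0} := fun q =>
    Submodule.mem_colon_span_singleton (N := mI K {f0}) (x := monomial f1 (1 : K)) (r := q)
  obtain ⟨α, h1, h2, h3, h4⟩ := hcolon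
  have hr : Nonempty (Fin r) := by
    by_contra hne
    rw [not_nonempty_iff] at hne
    have : monomial f0 (1 : K) ∈ (mI K {f0}).colon (Ideal.span {monomial f1 (1 : K)}) := by
      rw [hmem]
      exact Ideal.mul_mem_right _ _ (Ideal.subset_span ⟨f0, rfl, rfl⟩)
    rw [h4, Set.range_eq_empty, Ideal.span_empty, Ideal.mem_bot, monomial_eq_zero] at this
    exact one_ne_zero this
  obtain ⟨t⟩ := hr
  have hα : monomial (α t) (1 : K) ∈ (mI K {f0}).colon (Ideal.span {monomial f1 (1 : K)}) := by
    rw [h4]; exact Ideal.subset_span ⟨t, rfl⟩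
  rw [hmem, mul_monomial_mem_mI] at hα
  obtain ⟨b, hb, hle⟩ := hα (α t) (by simp)
  rw [Set.mem_singleton_iff] at hb
  subst hb
  have hne : f0 ≠ α t + f1 := by
    intro h
    apply hmin ⟨0, hm⟩
    rw [← hf0, h, show monomial (α t + f1) (1 : K) = monomial (α t) 1 * monomial f1 1 by
      rw [monomial_mul, one_mul]]
    exact Ideal.mul_mem_left _ _ (Ideal.subset_span ⟨⟨1, hm1⟩, by simp, rfl⟩)
  obtain ⟨c, hc⟩ := exists_add_of_le hle
  have hc0 : c.degree ≠ 0 := by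
    rw [Ne, Finsupp.degree_eq_zero_iff]
    rintro rfl
    rw [add_zero] at hc
    exact hne hc.symm
  have hdeg := congrArg Finsupp.degree hc
  rw [map_add, map_add] at hdeg
  have hle2 : a t - 1 ≤ ∑ t, (a t - 1) :=
    Finset.single_le_sum (f := fun t => a t - 1) (fun _ _ => Nat.zero_le _) (Finset.mem_univ t)
  have h5 := h3 t
  rw [deg_mono] at h5
  omega

lemma hilb_ne {n : ℕ} (I : Ideal (MvPolynomial (Fin n) K)) (c : Fin n →₀ ℕ)
    (hc : monomial c (1 : K) ∈ I) : hilbSeries I * (1 - PowerSeries.X) ^ n ≠ 0 := by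
  intro h
  have h1 : hilbSeries I = 0 := by
    have := congrArg (fun t => t * HR K n) h
    simp only [zero_mul] at this
    rwa [mul_assoc, mul_comm _ (HR K n), HR_mul, mul_one] at this
  have h2 := congrArg (PowerSeries.coeff c.degree) h1
  rw [hilbSeries, PowerSeries.coeff_mk, map_zero] at h2
  have h3 : Module.finrank K
      ↥(Submodule.restrictScalars K I ⊓ homogeneousSubmodule (Fin n) K c.degree) = 0 := by
    exact_mod_cast h2
  have : Module.Finite K (homogeneousSubmodule (Fin n) K c.degree) :=
    Module.Finite.iff_fg.2 (homogeneousSubmodule_fg (Fin n) K _)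
  have : Module.Finite K
      ↥(Submodule.restrictScalars K I ⊓ homogeneousSubmodule (Fin n) K c.degree) :=
    Submodule.finiteDimensional_inf_right _ _
  rw [Submodule.finrank_eq_zero] at h3
  have h4 : monomial c (1 : K) ∈
      Submodule.restrictScalars K I ⊓ homogeneousSubmodule (Fin n) K c.degree :=
    ⟨hc, isHomogeneous_monomial _ rfl⟩
  rw [h3, Submodule.mem_bot, monomial_eq_zero] at h4
  exact one_ne_zero h4

end BettiAux

/-- Let `I` be a monomial ideal with regular quotients, `Q(I)` and `P(I)` the upper bounds
for `reg` and `pdim`, and `D(I)` the degree of the polynomial `(1-t)ⁿ·HS(I,t)`. If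
`P(I) + Q(I) = D(I)` then `reg(I) = Q(I)`, `pdim(I) = P(I)`, and `β_{P(I),P(I)+Q(I)}(I) ≠ 0`
is the unique extremal Betti number of `I`. -/
theorem stmt_17 {K : Type} [Field K] {n m : ℕ} (hm : 0 < m)
    (f : Fin m → (Fin n →₀ ℕ)) (d r : Fin m → ℕ) (a : (k : Fin m) → Fin (r k) → ℕ)
    (I : Ideal (MvPolynomial (Fin n) K))
    (hI : I = Ideal.span (Set.range fun k => monomial (f k) (1 : K)))
    (hmin : ∀ k : Fin m, monomial (f k) (1 : K) ∉
      Ideal.span ((fun l => monomial (f l) (1 : K)) '' {l : Fin m | l ≠ k}))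
    (hd : ∀ k, (monomial (f k) (1 : K)).totalDegree = d k)
    (hcolon : ∀ k : Fin m, 0 < (k : ℕ) →
      IsRegSeqSpan
        ((Ideal.span ((fun l => monomial (f l) (1 : K)) '' {l : Fin m | (l : ℕ) < (k : ℕ)})).colon
          (Ideal.span {monomial (f k) (1 : K)}))
        (r k) (a k))
    (Q P D : ℕ)
    (hQ : Q = (Finset.univ.filter fun k : Fin m => 0 < (k : ℕ)).sup
      (fun k => d k + (∑ t, a k t) - r k))
    (hP : P = (Finset.univ.filter fun k : Fin m => 0 < (k : ℕ)).sup r)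
    (hD : ∃ Pol : Polynomial ℤ, (Pol : PowerSeries ℤ) = hilbSeries I * (1 - PowerSeries.X) ^ n
      ∧ Pol.natDegree = D)
    (hPQD : P + Q = D) (res : MinFreeResOfIdeal I) :
    res.toMinFreeResData.reg = (Q : ℕ∞) ∧
    res.toMinFreeResData.pdim = (P : ℕ∞) ∧
    res.toMinFreeResData.betti P (P + Q) ≠ 0 ∧
    ∀ k l : ℕ, P ≤ k → Q ≤ l → ¬(k = P ∧ l = Q) →
      res.toMinFreeResData.betti k (k + l) = 0 := by
  classical
  have hI' : I = BettiAux.mI K (f '' {l : Fin m | (l : ℕ) < m}) := by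
    rw [hI, BettiAux.mI, Set.image_image]
    congr 1
    ext x
    simp
  have hshape : ∀ S : ℕ → ℕ → Prop, (∀ k, S 0 (d k)) →
      (∀ k : Fin m, 0 < (k : ℕ) → ∀ i j, i + 1 ≤ r k →
        j ≤ d k + (i + 1) + ∑ t, (a k t - 1) → S (i + 1) j) →
      ∀ q (k : Fin (res.N q)), S q (res.g q k) := by
    intro S h0 h1
    apply BettiAux.betti_shape res
    intro N
    have := BettiAux.shape_I f d r a hd hcolon S h0 h1 m le_rfl N
    rwa [← hI'] at this
  have hQk : ∀ k : Fin m, 0 < (k : ℕ) → d k + ∑ t, (a k t - 1) ≤ Q := by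
    intro k hk
    have h1 := BettiAux.sum_sub_one (BettiAux.regseq_pos (hcolon k hk))
    have h2 : d k + (∑ t, a k t) - r k ≤ Q := by
      rw [hQ]
      exact Finset.le_sup (f := fun k => d k + (∑ t, a k t) - r k)
        (Finset.mem_filter.2 ⟨Finset.mem_univ k, hk⟩)
    omega
  have hPk : ∀ k : Fin m, 0 < (k : ℕ) → r k ≤ P := by
    intro k hk
    rw [hP]
    exact Finset.le_sup (f := r) (Finset.mem_filter.2 ⟨Finset.mem_univ k, hk⟩)
  have hS : ∀ Q' : ℕ, Q ≤ Q' → d ⟨0, hm⟩ ≤ Q' → ∀ q (k : Fin (res.N q)),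
      q ≤ P ∧ res.g q k ≤ q + Q' := by
    intro Q' hQQ' hd0
    apply hshape (fun i j => i ≤ P ∧ j ≤ i + Q')
    · intro k
      refine ⟨Nat.zero_le _, ?_⟩
      rcases Nat.eq_zero_or_pos (k : ℕ) with hk | hk
      · have : k = ⟨0, hm⟩ := Fin.ext hk
        rw [this]; omega
      · have := hQk k hk
        omega
    · intro k hk i j hi hj
      have h1 := hQk k hk
      have h2 := hPk k hk
      constructor <;> omega
  have hN : ∀ i, P + 1 ≤ i → res.N i = 0 := by
    intro i hi
    by_contra hne
    have := (hS (max Q (d ⟨0, hm⟩)) (le_max_left _ _) (le_max_right _ _) i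
      ⟨0, Nat.pos_of_ne_zero hne⟩).1
    omega
  obtain ⟨Pol, hPol, hdeg⟩ := hD
  have hPol0 : Pol ≠ 0 := by
    rintro rfl
    apply BettiAux.hilb_ne I (f ⟨0, hm⟩)
    · rw [hI]; exact Ideal.subset_span ⟨_, rfl⟩
    · rw [← hPol]; simp
  have hcoef : PowerSeries.coeff D (hilbSeries I * (1 - PowerSeries.X) ^ n) ≠ 0 := by
    rw [← hPol, Polynomial.coeff_coe, ← hdeg]
    exact Polynomial.leadingCoeff_ne_zero.2 hPol0
  obtain ⟨i, k, hik⟩ : ∃ i k, res.g i k = D := by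
    by_contra hcon
    push Not at hcon
    exact hcoef (BettiAux.hilb_coeff res (P + 1) D hN hcon)
  have hd0 : d ⟨0, hm⟩ ≤ Q := by
    rcases Nat.lt_or_ge 1 m with hm1 | hm1
    · have h1 := BettiAux.d0_le f hm hm1 hmin _ _ (hcolon ⟨1, hm1⟩ Nat.one_pos)
      have h2 := hQk ⟨1, hm1⟩ Nat.one_pos
      rw [← BettiAux.deg_mono (K := K), ← BettiAux.deg_mono (K := K), hd, hd] at h1
      omega
    · have hk0 : ∀ k : Fin m, (k : ℕ) = 0 := fun k => by omega
      have h1 := hshape (fun _ j => j = d ⟨0, hm⟩)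
        (fun k => by rw [show k = ⟨0, hm⟩ from Fin.ext (hk0 k)])
        (fun k hk => by have := hk0 k; omega) i k
      have hP0 : P = 0 := by
        rw [hP, Finset.filter_false_of_mem (fun k _ => by have := hk0 k; omega)]; rfl
      omega
  have hfin := hS Q le_rfl hd0
  have hbetti : ∀ i j, res.toMinFreeResData.betti i j ≠ 0 ↔ ∃ k, res.g i k = j := by
    intro i j
    rw [MinFreeResData.betti, Finset.card_ne_zero]
    constructor
    · rintro ⟨k, hk⟩; exact ⟨k, (Finset.mem_filter.1 hk).2⟩
    · rintro ⟨k, hk⟩; exact ⟨k, Finset.mem_filter.2 ⟨Finset.mem_univ _, hk⟩⟩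
  have hmain : res.toMinFreeResData.betti P (P + Q) ≠ 0 := by
    rw [hbetti]
    have h1 := hfin i k
    have h2 : i = P := by omega
    subst h2
    exact ⟨k, by omega⟩
  refine ⟨?_, ?_, hmain, ?_⟩
  · apply le_antisymm
    · apply sSup_le
      rintro _ ⟨⟨i, j⟩, hij, rfl⟩
      obtain ⟨k, hk⟩ := (hbetti i j).1 hij
      have := (hfin i k).2
      rw [hk] at this
      have h3 : j - i ≤ Q := by omega
      show ((j - i : ℕ) : ℕ∞) ≤ (Q : ℕ∞)
      exact_mod_cast h3
    · apply le_sSup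
      refine ⟨(P, P + Q), hmain, ?_⟩
      simp only [Nat.add_sub_cancel_left]
  · apply le_antisymm
    · apply sSup_le
      rintro _ ⟨i, ⟨j, hij⟩, rfl⟩
      obtain ⟨k, hk⟩ := (hbetti i j).1 hij
      have h3 := (hfin i k).1
      show ((i : ℕ) : ℕ∞) ≤ (P : ℕ∞)
      exact_mod_cast h3
    · exact le_sSup ⟨P, ⟨_, hmain⟩, rfl⟩
  · intro k l hk hl hne
    by_contra hcon
    obtain ⟨t, ht⟩ := (hbetti _ _).1 hcon
    have := hfin k t
    omega
end
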